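/- arXiv:2305.08934 — 5 statements merged into one kernel-verified Lean document; each statement's English description precedes it below -/
import Mathlib

section
/- Let d ≥ 1 be an integer and ν₀, ν₁ ∈ ℝ satisfy -1 < ν₀ < ν₁. Then there exists a constant C = C(d,ν₀,ν₁) > 0 such that for every x ∈ ℝ^d with x¹ > 0, ∫_{{z ∈ ℝ^d : z¹ < 0}} (-z¹)^{ν₀} · |x-z|^{-d-ν₁} dz ≤ C · (x¹)^{ν₀-ν₁}. -/
open MeasureTheory ENNReal

lemma lintegral_add_norm_sub_rpow_neg {E : Type*} [NormedAddCommGroup E] [NormedSpace ℝ E]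
    [FiniteDimensional ℝ E] [MeasurableSpace E] [BorelSpace E] (μ : Measure E)
    [μ.IsAddHaarMeasure] (r : ℝ) {s : ℝ} (hs : 0 < s) (a : E) :
    ∫⁻ y, ENNReal.ofReal ((s + ‖a - y‖) ^ (-r)) ∂μ =
      ENNReal.ofReal (s ^ ((Module.finrank ℝ E : ℝ) - r)) *
        ∫⁻ y, ENNReal.ofReal ((1 + ‖y‖) ^ (-r)) ∂μ := by
  rw [lintegral_sub_left_eq_self (fun y => ENNReal.ofReal ((s + ‖y‖) ^ (-r))) a]
  have hscale (y : E) : ENNReal.ofReal ((s + ‖y‖) ^ (-r)) =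
      ENNReal.ofReal (s ^ (-r)) * ENNReal.ofReal ((1 + ‖s⁻¹ • y‖) ^ (-r)) := by
    rw [← ENNReal.ofReal_mul (by positivity), ← Real.mul_rpow hs.le (by positivity), norm_smul,
      Real.norm_of_nonneg (by positivity), mul_add, mul_one, mul_inv_cancel_left₀ hs.ne']
  have hmeas : Measurable fun y : E => ENNReal.ofReal ((1 + ‖y‖) ^ (-r)) := by fun_prop
  simp_rw [hscale]
  rw [lintegral_const_mul _ (by fun_prop),
    ← lintegral_map hmeas (measurable_const_smul s⁻¹),
    Measure.map_addHaar_smul μ (inv_ne_zero hs.ne'), lintegral_smul_measure, smul_eq_mul,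
    ← mul_assoc, ← ENNReal.ofReal_mul (by positivity), abs_of_nonneg (by positivity), inv_pow,
    inv_inv, ← Real.rpow_natCast, ← Real.rpow_add hs, neg_add_eq_sub]

lemma setLIntegral_Iio_neg_rpow_mul_sub_rpow_le {a b : ℝ} (ha : -1 < a) (hab : a < b)
    {c : ℝ} (hc : 0 < c) :
    ∫⁻ t in Set.Iio (0 : ℝ), ENNReal.ofReal ((-t) ^ a * (c - t) ^ (-1 - b)) ≤
      ENNReal.ofReal ((1 / (a + 1) + 1 / (b - a)) * c ^ (a - b)) := by
  have hreflect : ∫⁻ t in Set.Iio (0 : ℝ), ENNReal.ofReal ((-t) ^ a * (c - t) ^ (-1 - b)) =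
      ∫⁻ t in Set.Ioi (0 : ℝ), ENNReal.ofReal (t ^ a * (c + t) ^ (-1 - b)) := by
    rw [← (Measure.measurePreserving_neg (volume : Measure ℝ)).setLIntegral_comp_preimage
      measurableSet_Ioi (by fun_prop)]
    simp [sub_eq_add_neg]
  have hnear : ∫⁻ t in Set.Ioc 0 c, ENNReal.ofReal (t ^ a * (c + t) ^ (-1 - b)) ≤
      ENNReal.ofReal (1 / (a + 1) * c ^ (a - b)) := by
    have hint : IntegrableOn (fun t : ℝ => t ^ a * c ^ (-1 - b)) (Set.Ioc 0 c) :=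
      ((intervalIntegrable_iff_integrableOn_Ioc_of_le hc.le).1
        (intervalIntegral.intervalIntegrable_rpow' ha)).mul_const _
    calc
      _ ≤ ∫⁻ t in Set.Ioc 0 c, ENNReal.ofReal (t ^ a * c ^ (-1 - b)) := by
        refine setLIntegral_mono' measurableSet_Ioc fun t ht => ENNReal.ofReal_le_ofReal ?_
        exact mul_le_mul_of_nonneg_left
          (Real.rpow_le_rpow_of_nonpos hc (by linarith [ht.1]) (by linarith))
          (Real.rpow_nonneg ht.1.le _)
      _ = ENNReal.ofReal (∫ t in Set.Ioc 0 c, t ^ a * c ^ (-1 - b)) := by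
        refine (ofReal_integral_eq_lintegral_ofReal hint ?_).symm
        refine (ae_restrict_iff' measurableSet_Ioc).2 (.of_forall fun t ht => ?_)
        exact mul_nonneg (Real.rpow_nonneg ht.1.le _) (Real.rpow_nonneg hc.le _)
      _ = _ := by
        rw [integral_mul_const, ← intervalIntegral.integral_of_le hc.le,
          integral_rpow (Or.inl ha), Real.zero_rpow (by linarith), sub_zero, div_mul_eq_mul_div,
          ← Real.rpow_add hc, one_div_mul_eq_div]
        ring_nf
  have hfar : ∫⁻ t in Set.Ioi c, ENNReal.ofReal (t ^ a * (c + t) ^ (-1 - b)) ≤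
      ENNReal.ofReal (1 / (b - a) * c ^ (a - b)) := by
    calc
      _ ≤ ∫⁻ t in Set.Ioi c, ENNReal.ofReal (t ^ (a - b - 1)) := by
        refine setLIntegral_mono' measurableSet_Ioi fun t ht => ENNReal.ofReal_le_ofReal ?_
        have ht0 : 0 < t := hc.trans ht
        rw [show a - b - 1 = a + (-1 - b) by ring, Real.rpow_add ht0]
        exact mul_le_mul_of_nonneg_left
          (Real.rpow_le_rpow_of_nonpos ht0 (by linarith) (by linarith))
          (Real.rpow_nonneg ht0.le _)
      _ = ENNReal.ofReal (∫ t in Set.Ioi c, t ^ (a - b - 1)) := by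
        refine (ofReal_integral_eq_lintegral_ofReal
          (integrableOn_Ioi_rpow_of_lt (by linarith) hc) ?_).symm
        refine (ae_restrict_iff' measurableSet_Ioi).2 (.of_forall fun t ht => ?_)
        exact Real.rpow_nonneg (hc.trans ht).le _
      _ = _ := by
        rw [integral_Ioi_rpow_of_lt (by linarith) hc, sub_add_cancel, ← neg_sub b a, neg_div_neg_eq,
          one_div_mul_eq_div]
  have ha' : 0 < a + 1 := by linarith
  have hba : 0 < b - a := by linarith
  rw [hreflect, ← Set.Ioc_union_Ioi_eq_Ioi hc.le, add_mul,
    ENNReal.ofReal_add (by positivity) (by positivity)]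
  exact (lintegral_union_le _ _ _).trans (add_le_add hnear hfar)

lemma setLIntegral_euclidean_le_lintegral_lintegral {n : ℕ} (i : Fin (n + 1))
    (f : ℝ → (Fin n → ℝ) → ℝ≥0∞) (s : Set ℝ) :
    ∫⁻ z in {z : EuclideanSpace ℝ (Fin (n + 1)) | z i ∈ s},
        f (z i) (fun j => z (i.succAbove j)) ≤ ∫⁻ t in s, ∫⁻ y, f t y := by
  have hmp := (volume_preserving_piFinSuccAbove (fun _ : Fin (n + 1) => ℝ) i).comp
    (PiLp.volume_preserving_ofLp (Fin (n + 1)))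
  have hemb : MeasurableEmbedding (MeasurableEquiv.piFinSuccAbove (fun _ => ℝ) i ∘
      @WithLp.ofLp 2 (Fin (n + 1) → ℝ)) :=
    (MeasurableEquiv.piFinSuccAbove (fun _ => ℝ) i).measurableEmbedding.comp
      (MeasurableEquiv.toLp 2 (Fin (n + 1) → ℝ)).symm.measurableEmbedding
  calc
    _ = ∫⁻ p in s ×ˢ Set.univ, f p.1 p.2 := by
      rw [← hmp.setLIntegral_comp_preimage_emb hemb]
      congr 2
      ext z
      exact (and_iff_left trivial).symm
    _ ≤ _ := by
      rw [Measure.volume_eq_prod, ← Measure.prod_restrict, Measure.restrict_univ]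
      exact lintegral_prod_le _

/-- Half-space elliptic auxiliary estimate: for `d ≥ 1` and `-1 < ν₀ < ν₁` there is
`C = C(d,ν₀,ν₁) > 0` such that for every `x` in the half space `{x¹ > 0}`,
`∫_{z¹<0} (-z¹)^{ν₀} |x-z|^{-d-ν₁} dz ≤ C (x¹)^{ν₀-ν₁}`. -/
theorem stmt_3 (d : ℕ) (hd : 1 ≤ d) (ν₀ ν₁ : ℝ) (h0 : -1 < ν₀) (h1 : ν₀ < ν₁) :
    ∃ C : ℝ, 0 < C ∧ ∀ x : EuclideanSpace ℝ (Fin d), 0 < x ⟨0, hd⟩ →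
      ∫⁻ z in {z : EuclideanSpace ℝ (Fin d) | z ⟨0, hd⟩ < 0},
          ENNReal.ofReal ((-(z ⟨0, hd⟩)) ^ ν₀ * ‖x - z‖ ^ (-(d : ℝ) - ν₁))
        ≤ ENNReal.ofReal (C * (x ⟨0, hd⟩) ^ (ν₀ - ν₁)) := by
  obtain ⟨n, rfl⟩ : ∃ n, d = n + 1 := ⟨d - 1, by omega⟩
  set i : Fin (n + 1) := ⟨0, hd⟩
  set r : ℝ := ((n + 1 : ℕ) : ℝ) + ν₁ with hr
  have hrn : (n : ℝ) < r := by rw [hr]; push_cast; linarith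
  have hr0 : 0 < r := n.cast_nonneg.trans_lt hrn
  set K : ℝ≥0∞ := ∫⁻ y : Fin n → ℝ, ENNReal.ofReal ((1 + ‖y‖) ^ (-r)) with hK
  have hKtop : K ≠ ∞ := (finite_integral_one_add_norm (by simpa using hrn)).ne
  have hν₀ : 0 < ν₀ + 1 := by linarith
  have hν : 0 < ν₁ - ν₀ := by linarith
  set A : ℝ := 1 / (ν₀ + 1) + 1 / (ν₁ - ν₀) with hA
  have hA0 : 0 < A := by positivity
  refine ⟨2 ^ r * (K.toReal + 1) * A, by positivity, fun x hx => ?_⟩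
  set x' : Fin n → ℝ := fun j => x (i.succAbove j)
  have hnorm (z : EuclideanSpace ℝ (Fin (n + 1))) (hz : z i < 0) :
      ‖x - z‖ ^ (-r) ≤
        2 ^ r * ((x i - z i) + ‖x' - fun j => z (i.succAbove j)‖) ^ (-r) := by
    have hcoord (j : Fin (n + 1)) : |x j - z j| ≤ ‖x - z‖ := by
      simpa using PiLp.norm_apply_le (x - z) j
    have htail : ‖x' - fun j => z (i.succAbove j)‖ ≤ ‖x - z‖ :=
      (pi_norm_le_iff_of_nonneg (norm_nonneg _)).2 fun j => hcoord (i.succAbove j)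
    have hfirst : x i - z i ≤ ‖x - z‖ := (le_abs_self _).trans (hcoord i)
    have hpos : 0 < x i - z i := by linarith
    calc
      _ ≤ (2⁻¹ * ((x i - z i) + ‖x' - fun j => z (i.succAbove j)‖)) ^ (-r) :=
        Real.rpow_le_rpow_of_nonpos (by positivity) (by linarith) (by linarith)
      _ = _ := by
        rw [Real.mul_rpow (by positivity) (by positivity), Real.inv_rpow (by positivity),
          Real.rpow_neg (by positivity), inv_inv]
  calc
    _ ≤ ∫⁻ z in {z : EuclideanSpace ℝ (Fin (n + 1)) | z i ∈ Set.Iio 0},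
        ENNReal.ofReal (2 ^ r * (-(z i)) ^ ν₀) *
          ENNReal.ofReal (((x i - z i) + ‖x' - fun j => z (i.succAbove j)‖) ^ (-r)) := by
      refine setLIntegral_mono' (measurableSet_lt (by fun_prop) measurable_const) fun z hz => ?_
      have hz : z i < 0 := hz
      have hz' : 0 ≤ (-(z i)) ^ ν₀ := Real.rpow_nonneg (by linarith) _
      rw [← ENNReal.ofReal_mul (by positivity), ← neg_add', mul_right_comm, mul_comm]
      exact ENNReal.ofReal_le_ofReal (mul_le_mul_of_nonneg_right (hnorm z hz) hz')
    _ ≤ ∫⁻ t in Set.Iio 0, ∫⁻ y : Fin n → ℝ, ENNReal.ofReal (2 ^ r * (-t) ^ ν₀) *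
          ENNReal.ofReal (((x i - t) + ‖x' - y‖) ^ (-r)) :=
      setLIntegral_euclidean_le_lintegral_lintegral i (fun t y =>
        ENNReal.ofReal (2 ^ r * (-t) ^ ν₀) * ENNReal.ofReal (((x i - t) + ‖x' - y‖) ^ (-r)))
        _
    _ = ∫⁻ t in Set.Iio 0, ENNReal.ofReal (2 ^ r) * K *
          ENNReal.ofReal ((-t) ^ ν₀ * (x i - t) ^ (-1 - ν₁)) := by
      refine setLIntegral_congr_fun measurableSet_Iio fun t ht => ?_
      have ht : t < 0 := ht
      have ht' : 0 ≤ (-t) ^ ν₀ := Real.rpow_nonneg (by linarith) _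
      simp only
      rw [lintegral_const_mul _ (by fun_prop),
        lintegral_add_norm_sub_rpow_neg volume r (by linarith) x', ← hK,
        ENNReal.ofReal_mul (by positivity), ENNReal.ofReal_mul ht', Module.finrank_fin_fun,
        show (n : ℝ) - r = -1 - ν₁ by rw [hr]; push_cast; ring]
      ring
    _ = ENNReal.ofReal (2 ^ r) * K *
          ∫⁻ t in Set.Iio 0, ENNReal.ofReal ((-t) ^ ν₀ * (x i - t) ^ (-1 - ν₁)) :=
      lintegral_const_mul' _ _ (mul_ne_top ofReal_ne_top hKtop)
    _ ≤ ENNReal.ofReal (2 ^ r) * ENNReal.ofReal (K.toReal + 1) *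
          ENNReal.ofReal (A * x i ^ (ν₀ - ν₁)) := by
      gcongr
      · exact (ofReal_toReal hKtop).ge.trans (ENNReal.ofReal_le_ofReal (by linarith))
      · exact setLIntegral_Iio_neg_rpow_mul_sub_rpow_le h0 h1 hx
    _ = _ := by
      rw [← ENNReal.ofReal_mul (by positivity), ← ENNReal.ofReal_mul (by positivity), mul_assoc _ A]
end

section
/- Let d ≥ 1 be an integer and α ∈ (0,2). Then there exists a constant C = C(d,α) > 0 such that for all s > 0 and t > 0, ∫_{{w ∈ ℝ^d : |w| ≥ s}} min(|w|^{-d-α}, t^{-1/2}·|w|^{-d-α/2}) dw ≤ C · s^{-α} · min(1, s^{α/2}/√t). -/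
open MeasureTheory ENNReal

open Module Set in
theorem lintegral_norm_rpow_compl_ball {E : Type*} [NormedAddCommGroup E] [NormedSpace ℝ E]
    [FiniteDimensional ℝ E] [Nontrivial E] [MeasurableSpace E] [BorelSpace E]
    (μ : Measure E) [μ.IsAddHaarMeasure] {β s : ℝ} (hβ : 0 < β) (hs : 0 < s) :
    ∫⁻ w in {w : E | s ≤ ‖w‖}, ENNReal.ofReal (‖w‖ ^ (-(finrank ℝ E : ℝ) - β)) ∂μ =
      ENNReal.ofReal (finrank ℝ E * μ.real (Metric.ball 0 1) / β * s ^ (-β)) := by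
  set f : ℝ → ℝ := (Ici s).indicator fun y ↦ y ^ (-(finrank ℝ E : ℝ) - β)
  have hf : EqOn (fun y ↦ y ^ (finrank ℝ E - 1) • f y)
      ((Ici s).indicator fun y ↦ y ^ (-1 - β)) (Ioi 0) := by
    intro y (hy : 0 < y)
    by_cases hys : y ∈ Ici s
    · have hdim : 1 ≤ finrank ℝ E := finrank_pos
      simp only [f, indicator_of_mem hys, smul_eq_mul]
      rw [← Real.rpow_natCast, ← Real.rpow_add hy, Nat.cast_sub hdim]
      congr 1
      push_cast
      ring
    · simp [f, indicator_of_notMem hys]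
  have hsub : Ioi (0 : ℝ) ∩ Ici s = Ici s :=
    inter_eq_right.2 fun y hy ↦ hs.trans_le hy
  have hint : Integrable (fun w : E ↦ f ‖w‖) μ := by
    rw [integrable_fun_norm_addHaar, integrableOn_congr_fun hf measurableSet_Ioi,
      IntegrableOn, integrable_indicator_iff measurableSet_Ici, IntegrableOn,
      Measure.restrict_restrict measurableSet_Ici, inter_comm, hsub, ← IntegrableOn,
      integrableOn_Ici_iff_integrableOn_Ioi]
    exact integrableOn_Ioi_rpow_of_lt (by linarith) hs
  have hnonneg : ∀ w : E, 0 ≤ f ‖w‖ := fun w ↦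
    indicator_nonneg (fun y hy ↦ Real.rpow_nonneg (hs.le.trans hy) _) _
  have hmeas : MeasurableSet {w : E | s ≤ ‖w‖} := measurableSet_le measurable_const measurable_norm
  calc
    _ = ∫⁻ w, ENNReal.ofReal (f ‖w‖) ∂μ := by
      rw [← lintegral_indicator hmeas]
      congr with w
      by_cases hw : s ≤ ‖w‖ <;> simp [f, hw]
    _ = ENNReal.ofReal (∫ w, f ‖w‖ ∂μ) :=
      (ofReal_integral_eq_lintegral_ofReal hint (.of_forall hnonneg)).symm
    _ = _ := by
      rw [integral_fun_norm_addHaar, setIntegral_congr_fun measurableSet_Ioi hf,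
        setIntegral_indicator measurableSet_Ici, hsub, integral_Ici_eq_integral_Ioi,
        integral_Ioi_rpow_of_lt (by linarith) hs, nsmul_eq_mul, smul_eq_mul,
        show -1 - β + 1 = -β by ring, neg_div_neg_eq]
      congr 1
      ring

/-- Exterior-of-ball integral estimate: for `d ≥ 1` and `α ∈ (0,2)` there is `C = C(d,α) > 0`
such that for all `s > 0` and `t > 0`,
`∫_{|w| ≥ s} (|w|^{-d-α} ∧ t^{-1/2}|w|^{-d-α/2}) dw ≤ C s^{-α} (1 ∧ s^{α/2}/√t)`. -/
theorem stmt_7 (d : ℕ) (hd : 1 ≤ d) (α : ℝ) (hα : α ∈ Set.Ioo (0 : ℝ) 2) :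
    ∃ C : ℝ, 0 < C ∧ ∀ s t : ℝ, 0 < s → 0 < t →
      ∫⁻ w in {w : EuclideanSpace ℝ (Fin d) | s ≤ ‖w‖},
          ENNReal.ofReal
            (min (‖w‖ ^ (-(d : ℝ) - α)) (t ^ (-(1 : ℝ) / 2) * ‖w‖ ^ (-(d : ℝ) - α / 2)))
        ≤ ENNReal.ofReal (C * s ^ (-α) * min 1 (s ^ (α / 2) / Real.sqrt t)) := by
  have hα0 : 0 < α := hα.1
  have : Nonempty (Fin d) := ⟨⟨0, hd⟩⟩
  set V : ℝ := d * volume.real (Metric.ball (0 : EuclideanSpace ℝ (Fin d)) 1) with hV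
  have hVpos : 0 < V :=
    mul_pos (by exact_mod_cast hd)
      (ENNReal.toReal_pos (Metric.measure_ball_pos _ _ one_pos).ne' measure_ball_lt_top.ne)
  have hext {β s : ℝ} (hβ : 0 < β) (hs : 0 < s) :
      ∫⁻ w in {w : EuclideanSpace ℝ (Fin d) | s ≤ ‖w‖}, ENNReal.ofReal (‖w‖ ^ (-(d : ℝ) - β)) =
        ENNReal.ofReal (V / β * s ^ (-β)) := by
    simpa [hV] using
      lintegral_norm_rpow_compl_ball (volume : Measure (EuclideanSpace ℝ (Fin d))) hβ hs
  refine ⟨V / (α / 2), by positivity, fun s t hs ht ↦ ?_⟩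
  rw [mul_min_of_nonneg _ _ (by positivity), ENNReal.ofReal_min]
  refine le_min ?_ ?_
  · calc
      _ ≤ ∫⁻ w in {w : EuclideanSpace ℝ (Fin d) | s ≤ ‖w‖},
            ENNReal.ofReal (‖w‖ ^ (-(d : ℝ) - α)) :=
        lintegral_mono fun w ↦ ENNReal.ofReal_le_ofReal (min_le_left _ _)
      _ = ENNReal.ofReal (V / α * s ^ (-α)) := hext hα0 hs
      _ ≤ _ := by
        rw [mul_one]
        gcongr
        linarith
  · have htpos : 0 ≤ t ^ (-(1 : ℝ) / 2) := Real.rpow_nonneg ht.le _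
    calc
      _ ≤ ∫⁻ w in {w : EuclideanSpace ℝ (Fin d) | s ≤ ‖w‖},
            ENNReal.ofReal (t ^ (-(1 : ℝ) / 2)) * ENNReal.ofReal (‖w‖ ^ (-(d : ℝ) - α / 2)) :=
        lintegral_mono fun w ↦ by
          rw [← ENNReal.ofReal_mul htpos]
          exact ENNReal.ofReal_le_ofReal (min_le_right _ _)
      _ = ENNReal.ofReal (t ^ (-(1 : ℝ) / 2) * (V / (α / 2) * s ^ (-(α / 2)))) := by
        rw [lintegral_const_mul' _ _ ENNReal.ofReal_ne_top, hext (half_pos hα0) hs,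
          ENNReal.ofReal_mul htpos]
      _ = _ := by
        have hsplit : s ^ (-(α / 2)) = s ^ (-α) * s ^ (α / 2) := by
          rw [← Real.rpow_add hs]
          congr 1
          ring
        have hsqrt : t ^ (-(1 : ℝ) / 2) = (Real.sqrt t)⁻¹ := by
          rw [Real.sqrt_eq_rpow, ← Real.rpow_neg ht.le]
          congr 1
          ring
        rw [hsplit, hsqrt]
        congr 1
        ring
end

section
/- Let d ≥ 1 be an integer, α ∈ (0,2), p ∈ (1,∞), and θ ∈ (d-1, d-1+p). Then there exists a constant C = C(d,α,θ,p) > 0 such that for every measurable function g : {z ∈ ℝ^d : z¹ < 0} → [0,∞], ∫_{{x : x¹ > 0}} (x¹)^{θ-d-αp/2} · ( ∫_{{z : z¹ < 0}} (x¹)^{α/2} · |z¹|^{-α/2} · |x-z|^{-d} · g(z) dz )^p dx ≤ C · ∫_{{z : z¹ < 0}} |z¹|^{θ-d-αp/2} · g(z)^p dz. -/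
open MeasureTheory ENNReal

/-- The one-dimensional profile `(1 + |t|)^{-b} |t|^{-σ}` is integrable on the line. -/
theorem integrable_one_add_abs_rpow_mul_abs_rpow {b σ : ℝ} (hb : 0 ≤ b) (hσ : σ < 1)
    (hbσ : 1 < b + σ) : Integrable fun t : ℝ => (1 + |t|) ^ (-b) * |t| ^ (-σ) := by
  have hmeas : Measurable fun t : ℝ => (1 + |t|) ^ (-b) * |t| ^ (-σ) := by fun_prop
  have hnear : IntegrableOn (fun t : ℝ => (1 + |t|) ^ (-b) * |t| ^ (-σ)) (Set.Ioc 0 1) := by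
    have hint : IntegrableOn (fun t : ℝ => t ^ (-σ)) (Set.Ioc 0 1) :=
      (intervalIntegrable_iff_integrableOn_Ioc_of_le zero_le_one).1
        (intervalIntegral.intervalIntegrable_rpow' (by linarith))
    refine hint.mono' hmeas.aestronglyMeasurable ?_
    filter_upwards [ae_restrict_mem measurableSet_Ioc] with t ht
    rw [Real.norm_of_nonneg (by positivity), abs_of_pos ht.1]
    exact mul_le_of_le_one_left (Real.rpow_nonneg ht.1.le _)
      (Real.rpow_le_one_of_one_le_of_nonpos (by linarith [ht.1]) (neg_nonpos.2 hb))
  have hfar : IntegrableOn (fun t : ℝ => (1 + |t|) ^ (-b) * |t| ^ (-σ)) (Set.Ioi 1) := by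
    have hint : IntegrableOn (fun t : ℝ => t ^ (-b - σ)) (Set.Ioi 1) :=
      integrableOn_Ioi_rpow_of_lt (by linarith) one_pos
    refine hint.mono' hmeas.aestronglyMeasurable ?_
    filter_upwards [ae_restrict_mem measurableSet_Ioi] with t (ht : 1 < t)
    have ht0 : 0 < t := by linarith
    rw [Real.norm_of_nonneg (by positivity), abs_of_pos ht0, sub_eq_add_neg, Real.rpow_add ht0]
    exact mul_le_mul_of_nonneg_right
      (Real.rpow_le_rpow_of_nonpos ht0 (by linarith) (by linarith)) (Real.rpow_nonneg ht0.le _)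
  have hpos : IntegrableOn (fun t : ℝ => (1 + |t|) ^ (-b) * |t| ^ (-σ)) (Set.Ioi 0) := by
    rw [← Set.Ioc_union_Ioi_eq_Ioi zero_le_one]
    exact hnear.union hfar
  have hneg : IntegrableOn (fun t : ℝ => (1 + |t|) ^ (-b) * |t| ^ (-σ)) (Set.Iic 0) := by
    rw [← integrableOn_Ici_iff_integrableOn_Ioi] at hpos
    simpa using hpos.comp_neg
  rw [← integrableOn_univ, ← Set.Iic_union_Ioi (a := (0 : ℝ))]
  exact hneg.union hpos

theorem add_abs_rpow_mul_abs_rpow_eq_scaled {b σ r : ℝ} (hr : 0 < r) (t : ℝ) :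
    (r + |t|) ^ (-b) * |t| ^ (-σ) =
      r ^ (-b - σ) * ((1 + |t / r|) ^ (-b) * |t / r| ^ (-σ)) := by
  have hsum : r + |t| = r * (1 + |t / r|) := by
    rw [abs_div, abs_of_pos hr]; field_simp
  have habs : |t| = r * |t / r| := by
    rw [abs_div, abs_of_pos hr]; field_simp
  have hpow : |t| ^ (-σ) = r ^ (-σ) * |t / r| ^ (-σ) := by
    rw [← Real.mul_rpow hr.le (abs_nonneg _), ← habs]
  rw [hsum, hpow, Real.mul_rpow hr.le (by positivity), sub_eq_add_neg, Real.rpow_add hr]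
  ring

theorem integrable_add_abs_rpow_mul_abs_rpow {b σ r : ℝ} (hb : 0 ≤ b) (hσ : σ < 1)
    (hbσ : 1 < b + σ) (hr : 0 < r) (c : ℝ) :
    Integrable fun t : ℝ => (r + |t - c|) ^ (-b) * |t - c| ^ (-σ) := by
  simp_rw [add_abs_rpow_mul_abs_rpow_eq_scaled hr]
  exact (((integrable_one_add_abs_rpow_mul_abs_rpow hb hσ hbσ).comp_div hr.ne').comp_sub_right
    c).const_mul _

theorem integral_add_abs_rpow_mul_abs_rpow (b σ : ℝ) {r : ℝ} (hr : 0 < r) (c : ℝ) :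
    ∫ t : ℝ, (r + |t - c|) ^ (-b) * |t - c| ^ (-σ) =
      r ^ (1 - b - σ) * ∫ t : ℝ, (1 + |t|) ^ (-b) * |t| ^ (-σ) := by
  rw [integral_sub_right_eq_self (fun t : ℝ => (r + |t|) ^ (-b) * |t| ^ (-σ)) c]
  simp_rw [add_abs_rpow_mul_abs_rpow_eq_scaled hr]
  rw [integral_const_mul,
    Measure.integral_comp_div (fun t : ℝ => (1 + |t|) ^ (-b) * |t| ^ (-σ)), abs_of_pos hr,
    smul_eq_mul, ← mul_assoc, ← Real.rpow_add_one hr.ne']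
  ring_nf

/-- A product profile whose exponents satisfy `∑ bᵢ = d` and `∑ σᵢ = s` has integral of
order `r ^ (-s)`, uniformly in the centre. -/
theorem lintegral_prod_add_abs_rpow {d : ℕ} {b σ : Fin d → ℝ} (hb : ∀ i, 0 ≤ b i)
    (hσ : ∀ i, σ i < 1) (hbσ : ∀ i, 1 < b i + σ i) {r : ℝ} (hr : 0 < r) (c : Fin d → ℝ) :
    ∫⁻ z : EuclideanSpace ℝ (Fin d),
        ENNReal.ofReal (∏ i, ((r + |z i - c i|) ^ (-b i) * |z i - c i| ^ (-σ i))) =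
      ENNReal.ofReal (r ^ (∑ i, (1 - b i - σ i)) *
        ∏ i, ∫ t : ℝ, (1 + |t|) ^ (-b i) * |t| ^ (-σ i)) := by
  rw [(PiLp.volume_preserving_ofLp (Fin d)).lintegral_comp
    (f := fun y : Fin d → ℝ => ENNReal.ofReal
      (∏ i, ((r + |y i - c i|) ^ (-b i) * |y i - c i| ^ (-σ i)))) (by fun_prop)]
  have hint : Integrable fun y : Fin d → ℝ =>
      ∏ i, ((r + |y i - c i|) ^ (-b i) * |y i - c i| ^ (-σ i)) :=
    Integrable.fintype_prod (f := fun i t => (r + |t - c i|) ^ (-b i) * |t - c i| ^ (-σ i))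
      fun i => integrable_add_abs_rpow_mul_abs_rpow (hb i) (hσ i) (hbσ i) hr (c i)
  rw [← ofReal_integral_eq_lintegral_ofReal hint
    (.of_forall fun y => Finset.prod_nonneg fun i _ => by positivity)]
  rw [integral_fintype_prod_volume_eq_prod
    (fun i t => (r + |t - c i|) ^ (-b i) * |t - c i| ^ (-σ i))]
  simp_rw [integral_add_abs_rpow_mul_abs_rpow _ _ hr]
  rw [Finset.prod_mul_distrib, Real.rpow_sum_of_pos hr]

/-- Hölder's inequality with a weight `w`, as used in Schur's test. -/
theorem lintegral_mul_rpow_le_schur {Y : Type*} [MeasurableSpace Y] (ν : Measure Y) {p : ℝ}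
    (hp : 1 < p) {K w h : Y → ℝ≥0∞} (hK : Measurable K) (hw : Measurable w) (hh : Measurable h)
    (hw0 : ∀ᵐ z ∂ν, w z ≠ 0) (hwt : ∀ᵐ z ∂ν, w z ≠ ∞) :
    (∫⁻ z, K z * h z ∂ν) ^ p ≤
      (∫⁻ z, K z * w z ∂ν) ^ (p - 1) * ∫⁻ z, K z * (w z ^ (-(p - 1)) * h z ^ p) ∂ν := by
  have hp0 : 0 < p := by linarith
  set q := p.conjExponent with hq
  have hpq : p.HolderConjugate q := .conjExponent hp
  have hq0 : 0 < q := hpq.symm.pos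
  have hqp : q⁻¹ * p = p - 1 := by rw [hq, Real.conjExponent]; field_simp
  have hinv : q⁻¹ + p⁻¹ = 1 := by rw [add_comm]; exact hpq.inv_add_inv_eq_one
  have hHolder := ENNReal.lintegral_mul_le_Lp_mul_Lq ν hpq.symm
    (f := fun z => (K z * w z) ^ q⁻¹) (g := fun z => K z ^ p⁻¹ * (w z ^ (-q⁻¹) * h z))
    (by fun_prop) (by fun_prop)
  have hleft : ∫⁻ z, K z * h z ∂ν =
      ∫⁻ z, ((fun z => (K z * w z) ^ q⁻¹) * fun z => K z ^ p⁻¹ * (w z ^ (-q⁻¹) * h z)) z ∂ν := by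
    refine lintegral_congr_ae ?_
    filter_upwards [hw0, hwt] with z h0 ht
    rw [Pi.mul_apply, ENNReal.mul_rpow_of_nonneg _ _ (by positivity)]
    calc K z * h z = K z ^ (q⁻¹ + p⁻¹) * w z ^ (q⁻¹ + -q⁻¹) * h z := by simp [hinv]
      _ = _ := by
        rw [ENNReal.rpow_add_of_nonneg _ _ (by positivity) (by positivity),
          ENNReal.rpow_add _ _ h0 ht]
        ring
  have hf (z : Y) : ((K z * w z) ^ q⁻¹) ^ q = K z * w z := ENNReal.rpow_inv_rpow hq0.ne' _
  have hg (z : Y) : (K z ^ p⁻¹ * (w z ^ (-q⁻¹) * h z)) ^ p =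
      K z * (w z ^ (-(p - 1)) * h z ^ p) := by
    rw [ENNReal.mul_rpow_of_nonneg _ _ hp0.le, ENNReal.mul_rpow_of_nonneg _ _ hp0.le,
      ENNReal.rpow_inv_rpow hp0.ne', ← ENNReal.rpow_mul, neg_mul, hqp]
  simp_rw [← hleft, hf, hg, one_div] at hHolder
  calc _ ≤ _ := ENNReal.rpow_le_rpow hHolder hp0.le
    _ = _ := by
      rw [ENNReal.mul_rpow_of_nonneg _ _ hp0.le, ENNReal.rpow_inv_rpow hp0.ne',
        ← ENNReal.rpow_mul, hqp]

/-- If `x` and `z` lie on opposite sides of the boundary, then `‖x - z‖` controls the sum of the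
height of `x` and the height of `z`. -/
theorem abs_add_abs_le_norm_sub {d : ℕ} {x z : EuclideanSpace ℝ (Fin d)} {k : Fin d}
    (hxz : z k * x k < 0) : |x k| + |z k| ≤ ‖x - z‖ := by
  have hnorm : |x k - z k| ≤ ‖x - z‖ := PiLp.norm_apply_le (x - z) k
  rcases mul_neg_iff.1 hxz with ⟨hz, hx⟩ | ⟨hz, hx⟩
  · rw [abs_of_neg (by linarith)] at hnorm
    rw [abs_of_neg hx, abs_of_pos hz]; linarith
  · rw [abs_of_pos (by linarith)] at hnorm
    rw [abs_of_neg hz, abs_of_pos hx]; linarith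

/-- The kernel `‖x - z‖^{-d}` maps `|z¹|^{-s}`, restricted to the opposite side of the boundary,
into a multiple of `|x¹|^{-s}`. -/
theorem exists_lintegral_norm_sub_rpow_mul_le {d : ℕ} (k : Fin d) {s : ℝ} (hs0 : 0 < s)
    (hs1 : s < 1) :
    ∃ C : ℝ, 0 < C ∧ ∀ x : EuclideanSpace ℝ (Fin d), x k ≠ 0 →
      ∫⁻ z in {z : EuclideanSpace ℝ (Fin d) | z k * x k < 0},
          ENNReal.ofReal (‖x - z‖ ^ (-(d : ℝ))) * ENNReal.ofReal (|z k| ^ (-s)) ≤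
        ENNReal.ofReal (C * |x k| ^ (-s)) := by
  have hd : (0 : ℝ) < d := by exact_mod_cast k.pos
  set δ : ℝ := s / (2 * d) with hδ
  have hδ0 : 0 < δ := by positivity
  have hdδ : d * δ = s / 2 := by rw [hδ]; field_simp
  set b : Fin d → ℝ := fun i => if i = k then 1 + δ - d * δ else 1 + δ with hb
  set σ : Fin d → ℝ := fun i => if i = k then s else 0 with hσ
  have hb0 (i : Fin d) : 0 ≤ b i := by
    simp only [hb]; split_ifs <;> linarith
  have hσ1 (i : Fin d) : σ i < 1 := by
    simp only [hσ]; split_ifs <;> linarith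
  have hbσ (i : Fin d) : 1 < b i + σ i := by
    simp only [hb, hσ]; split_ifs <;> linarith
  have hsumb : ∑ i, b i = d := by
    have hbi (i : Fin d) : b i = (1 + δ) - if i = k then d * δ else 0 := by
      simp only [hb]; split_ifs <;> ring
    simp_rw [hbi, Finset.sum_sub_distrib]
    simp
  have hsum : ∑ i, (1 - b i - σ i) = -s := by
    rw [Finset.sum_sub_distrib, Finset.sum_sub_distrib, hsumb]
    simp [hσ]
  set I : ℝ := ∏ i, ∫ t : ℝ, (1 + |t|) ^ (-b i) * |t| ^ (-σ i) with hI
  have hI0 : 0 ≤ I := Finset.prod_nonneg fun i _ => integral_nonneg fun t => by positivity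
  refine ⟨2 ^ (d : ℝ) * I + 1, by positivity, fun x hx => ?_⟩
  have hr : 0 < |x k| := abs_pos.2 hx
  set c : Fin d → ℝ := fun i => if i = k then 0 else x i with hc
  have hmeas : MeasurableSet {z : EuclideanSpace ℝ (Fin d) | z k * x k < 0} :=
    measurableSet_lt (by fun_prop) (by fun_prop)
  have hpoint (z : EuclideanSpace ℝ (Fin d)) (hz : z k * x k < 0) :
      ENNReal.ofReal (‖x - z‖ ^ (-(d : ℝ))) * ENNReal.ofReal (|z k| ^ (-s)) ≤
        ENNReal.ofReal (2 ^ (d : ℝ)) * ENNReal.ofReal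
          (∏ i, ((|x k| + |z i - c i|) ^ (-b i) * |z i - c i| ^ (-σ i))) := by
    rw [← ENNReal.ofReal_mul (by positivity), ← ENNReal.ofReal_mul (by positivity)]
    apply ENNReal.ofReal_le_ofReal
    have hside := abs_add_abs_le_norm_sub hz
    have hN : 0 < ‖x - z‖ := by linarith [abs_nonneg (z k)]
    have hprodσ : ∏ i, |z i - c i| ^ (-σ i) = |z k| ^ (-s) := by
      rw [Finset.prod_eq_single k (fun i _ hi => by simp [hσ, hi]) (by simp)]
      simp [hσ, hc]
    have hprodb : (2 * ‖x - z‖) ^ (-(d : ℝ)) ≤ ∏ i, (|x k| + |z i - c i|) ^ (-b i) := by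
      rw [← hsumb, ← Finset.sum_neg_distrib, Real.rpow_sum_of_pos (by positivity)]
      refine Finset.prod_le_prod (fun i _ => by positivity) fun i _ => ?_
      refine Real.rpow_le_rpow_of_nonpos (by positivity) ?_ (neg_nonpos.2 (hb0 i))
      by_cases hi : i = k
      · subst hi
        simp only [hc, if_true, sub_zero]
        linarith
      · have hnorm : |x i - z i| ≤ ‖x - z‖ := PiLp.norm_apply_le (x - z) i
        simp only [hc, if_neg hi, abs_sub_comm (z i)]
        linarith [abs_nonneg (z k)]
    have hscale : ‖x - z‖ ^ (-(d : ℝ)) = 2 ^ (d : ℝ) * (2 * ‖x - z‖) ^ (-(d : ℝ)) := by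
      rw [Real.mul_rpow two_pos.le hN.le, ← mul_assoc, ← Real.rpow_add two_pos]
      simp
    rw [Finset.prod_mul_distrib, hprodσ, hscale, mul_assoc]
    gcongr
  calc _ ≤ ∫⁻ z in {z : EuclideanSpace ℝ (Fin d) | z k * x k < 0}, ENNReal.ofReal (2 ^ (d : ℝ)) *
        ENNReal.ofReal (∏ i, ((|x k| + |z i - c i|) ^ (-b i) * |z i - c i| ^ (-σ i))) :=
        setLIntegral_mono' hmeas hpoint
    _ ≤ ∫⁻ z : EuclideanSpace ℝ (Fin d), ENNReal.ofReal (2 ^ (d : ℝ)) *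
        ENNReal.ofReal (∏ i, ((|x k| + |z i - c i|) ^ (-b i) * |z i - c i| ^ (-σ i))) :=
        setLIntegral_le_lintegral _ _
    _ = ENNReal.ofReal (2 ^ (d : ℝ) * I * |x k| ^ (-s)) := by
      rw [lintegral_const_mul _ (by fun_prop), lintegral_prod_add_abs_rpow hb0 hσ1 hbσ hr c, hsum,
        ← ENNReal.ofReal_mul (by positivity), ← hI, mul_comm (|x k| ^ (-s)), mul_assoc]
    _ ≤ _ := by
      gcongr
      linarith

/-- Weighted `L_p` boundedness of the half-space Poisson integral of exterior data:
for `d ≥ 1`, `α ∈ (0,2)`, `p ∈ (1,∞)` and `θ ∈ (d-1, d-1+p)` there is `C = C(d,α,θ,p) > 0`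
such that for every measurable `g : {z¹ < 0} → [0,∞]`,
`∫_{x¹>0} (x¹)^{θ-d-αp/2} (∫_{z¹<0} (x¹)^{α/2}|z¹|^{-α/2}|x-z|^{-d} g(z) dz)^p dx
  ≤ C ∫_{z¹<0} |z¹|^{θ-d-αp/2} g(z)^p dz`. -/
theorem stmt_8 (d : ℕ) (hd : 1 ≤ d) (α p θ : ℝ) (hα : α ∈ Set.Ioo (0 : ℝ) 2)
    (hp : 1 < p) (hθ : θ ∈ Set.Ioo ((d : ℝ) - 1) ((d : ℝ) - 1 + p)) :
    ∃ C : ℝ, 0 < C ∧ ∀ g : EuclideanSpace ℝ (Fin d) → ℝ≥0∞, Measurable g →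
      ∫⁻ x in {x : EuclideanSpace ℝ (Fin d) | 0 < x ⟨0, hd⟩},
          ENNReal.ofReal ((x ⟨0, hd⟩) ^ (θ - d - α * p / 2)) *
            (∫⁻ z in {z : EuclideanSpace ℝ (Fin d) | z ⟨0, hd⟩ < 0},
              ENNReal.ofReal
                ((x ⟨0, hd⟩) ^ (α / 2) * |z ⟨0, hd⟩| ^ (-α / 2) * ‖x - z‖ ^ (-(d : ℝ))) *
                g z) ^ p
        ≤ ENNReal.ofReal C *
            ∫⁻ z in {z : EuclideanSpace ℝ (Fin d) | z ⟨0, hd⟩ < 0},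
              ENNReal.ofReal (|z ⟨0, hd⟩| ^ (θ - d - α * p / 2)) * g z ^ p := by
  obtain ⟨hθ1, hθ2⟩ := hθ
  set k : Fin d := ⟨0, hd⟩
  obtain ⟨τ, hτ, hτ'⟩ : ∃ τ, max 0 (θ - d) < τ ∧ τ < min (p - 1) (θ - d + 1) :=
    exists_between (max_lt (lt_min (by linarith) (by linarith)) (lt_min (by linarith) (by linarith)))
  obtain ⟨hτ0, hτβ⟩ := max_lt_iff.1 hτ
  obtain ⟨hτp, hτβ'⟩ := lt_min_iff.1 hτ'
  have hp1 : 0 < p - 1 := by linarith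
  have hp0 : 0 < p := by linarith
  set s : ℝ := τ / (p - 1) with hs
  have hsp : s * (p - 1) = τ := by rw [hs]; field_simp
  obtain ⟨C₁, hC₁, hK₁⟩ := exists_lintegral_norm_sub_rpow_mul_le k (s := s) (by positivity)
    ((div_lt_one hp1).2 hτp)
  obtain ⟨C₂, hC₂, hK₂⟩ := exists_lintegral_norm_sub_rpow_mul_le k (s := τ - (θ - d))
    (by linarith) (by linarith)
  refine ⟨C₁ ^ (p - 1) * C₂, by positivity, fun g hg => ?_⟩
  set U := {x : EuclideanSpace ℝ (Fin d) | 0 < x k} with hU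
  set V := {z : EuclideanSpace ℝ (Fin d) | z k < 0} with hV
  have hUm : MeasurableSet U := measurableSet_lt (by fun_prop) (by fun_prop)
  have hVm : MeasurableSet V := measurableSet_lt (by fun_prop) (by fun_prop)
  set w : EuclideanSpace ℝ (Fin d) → ℝ≥0∞ := fun z => ENNReal.ofReal (|z k| ^ (-s)) with hw
  set h : EuclideanSpace ℝ (Fin d) → ℝ≥0∞ :=
    fun z => ENNReal.ofReal (|z k| ^ (-α / 2)) * g z with hh
  have hhm : Measurable h := by fun_prop
  have hwm : Measurable w := by fun_prop
  set H : EuclideanSpace ℝ (Fin d) → ℝ≥0∞ := fun z => w z ^ (-(p - 1)) * h z ^ p with hH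
  have hHm : Measurable H := by fun_prop
  have hwpow (z : EuclideanSpace ℝ (Fin d)) (hz : z ∈ V) :
      w z ^ (-(p - 1)) = ENNReal.ofReal (|z k| ^ τ) := by
    have hz0 : 0 < |z k| := abs_pos.2 (ne_of_lt hz)
    rw [hw, ENNReal.ofReal_rpow_of_pos (by positivity), ← Real.rpow_mul hz0.le, neg_mul_neg, hsp]
  have hleft (x : EuclideanSpace ℝ (Fin d)) (hx : x ∈ U) :
      ENNReal.ofReal ((x k) ^ (θ - d - α * p / 2)) *
          (∫⁻ z in V, ENNReal.ofReal
            ((x k) ^ (α / 2) * |z k| ^ (-α / 2) * ‖x - z‖ ^ (-(d : ℝ))) * g z) ^ p ≤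
        ENNReal.ofReal (C₁ ^ (p - 1)) * ∫⁻ z in V, ENNReal.ofReal (|x k| ^ (-(τ - (θ - d)))) *
          (ENNReal.ofReal (‖z - x‖ ^ (-(d : ℝ))) * H z) := by
    have hx0 : 0 < x k := hx
    have hinner : ∫⁻ z in V, ENNReal.ofReal
          ((x k) ^ (α / 2) * |z k| ^ (-α / 2) * ‖x - z‖ ^ (-(d : ℝ))) * g z =
        ENNReal.ofReal ((x k) ^ (α / 2)) *
          ∫⁻ z in V, ENNReal.ofReal (‖x - z‖ ^ (-(d : ℝ))) * h z := by
      rw [← lintegral_const_mul _ (by fun_prop)]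
      refine lintegral_congr fun z => ?_
      rw [ENNReal.ofReal_mul (by positivity), ENNReal.ofReal_mul (by positivity), hh]
      ring
    have hschur := lintegral_mul_rpow_le_schur (volume.restrict V) hp
      (K := fun z => ENNReal.ofReal (‖x - z‖ ^ (-(d : ℝ)))) (by fun_prop) hwm hhm
      (by
        filter_upwards [ae_restrict_mem hVm] with z hz
        have hz0 : 0 < |z k| := abs_pos.2 (ne_of_lt hz)
        exact (ENNReal.ofReal_pos.2 (by positivity)).ne')
      (.of_forall fun z => ENNReal.ofReal_ne_top)
    have hweight : ∫⁻ z in V, ENNReal.ofReal (‖x - z‖ ^ (-(d : ℝ))) * w z ≤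
        ENNReal.ofReal (C₁ * x k ^ (-s)) := by
      refine (lintegral_mono_set fun z hz => ?_).trans ((hK₁ x hx0.ne').trans_eq ?_)
      · exact mul_neg_of_neg_of_pos hz hx0
      · rw [abs_of_pos hx0]
    have hconst : ENNReal.ofReal ((x k) ^ (θ - d - α * p / 2)) *
        (ENNReal.ofReal ((x k) ^ (α / 2)) ^ p * ENNReal.ofReal (C₁ * x k ^ (-s)) ^ (p - 1)) =
        ENNReal.ofReal (C₁ ^ (p - 1)) * ENNReal.ofReal (|x k| ^ (-(τ - (θ - d)))) := by
      rw [ENNReal.ofReal_rpow_of_pos (by positivity), ENNReal.ofReal_rpow_of_pos (by positivity),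
        ← ENNReal.ofReal_mul (by positivity), ← ENNReal.ofReal_mul (by positivity),
        ← ENNReal.ofReal_mul (by positivity), Real.mul_rpow hC₁.le (by positivity),
        ← Real.rpow_mul hx0.le, ← Real.rpow_mul hx0.le, neg_mul, hsp, abs_of_pos hx0]
      have hexp : -(τ - (θ - d)) = (θ - d - α * p / 2) + α / 2 * p + -τ := by ring
      rw [hexp, Real.rpow_add hx0, Real.rpow_add hx0]
      ring_nf
    rw [hinner, ENNReal.mul_rpow_of_nonneg _ _ hp0.le, lintegral_const_mul _ (by fun_prop),
      ← mul_assoc (ENNReal.ofReal (C₁ ^ (p - 1))), ← hconst]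
    simp_rw [norm_sub_rev _ x]
    rw [mul_assoc, mul_assoc]
    gcongr
    exact hschur.trans (by gcongr)
  have hright (z : EuclideanSpace ℝ (Fin d)) (hz : z ∈ V) :
      ∫⁻ x in U, ENNReal.ofReal (|x k| ^ (-(τ - (θ - d)))) *
          (ENNReal.ofReal (‖z - x‖ ^ (-(d : ℝ))) * H z) ≤
        ENNReal.ofReal C₂ *
          (ENNReal.ofReal (|z k| ^ (θ - d - α * p / 2)) * g z ^ p) := by
    have hz0 : 0 < |z k| := abs_pos.2 (ne_of_lt hz)
    have hkernel : ∫⁻ x in U, ENNReal.ofReal (‖z - x‖ ^ (-(d : ℝ))) *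
        ENNReal.ofReal (|x k| ^ (-(τ - (θ - d)))) ≤
          ENNReal.ofReal (C₂ * |z k| ^ (-(τ - (θ - d)))) := by
      refine (lintegral_mono_set fun x hx => ?_).trans (hK₂ z (ne_of_lt hz))
      have hx0 : 0 < x k := hx
      exact mul_neg_of_pos_of_neg hx0 hz
    have hHz : ENNReal.ofReal (|z k| ^ (-(τ - (θ - d)))) * H z =
        ENNReal.ofReal (|z k| ^ (θ - d - α * p / 2)) * g z ^ p := by
      simp only [hH, hh]
      rw [hwpow z hz, ENNReal.mul_rpow_of_nonneg _ _ hp0.le,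
        ENNReal.ofReal_rpow_of_pos (by positivity), ← Real.rpow_mul hz0.le, ← mul_assoc,
        ← mul_assoc, ← ENNReal.ofReal_mul (by positivity), ← ENNReal.ofReal_mul (by positivity),
        ← Real.rpow_add hz0, ← Real.rpow_add hz0]
      ring_nf
    calc _ = (∫⁻ x in U, ENNReal.ofReal (‖z - x‖ ^ (-(d : ℝ))) *
        ENNReal.ofReal (|x k| ^ (-(τ - (θ - d))))) * H z := by
          rw [← lintegral_mul_const _ (by fun_prop)]
          exact lintegral_congr fun x => by ring
      _ ≤ ENNReal.ofReal (C₂ * |z k| ^ (-(τ - (θ - d)))) * H z := by gcongr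
      _ = _ := by rw [ENNReal.ofReal_mul hC₂.le, mul_assoc, hHz]
  calc _ ≤ ∫⁻ x in U, ENNReal.ofReal (C₁ ^ (p - 1)) * ∫⁻ z in V,
        ENNReal.ofReal (|x k| ^ (-(τ - (θ - d)))) *
          (ENNReal.ofReal (‖z - x‖ ^ (-(d : ℝ))) * H z) := setLIntegral_mono' hUm hleft
    _ = ENNReal.ofReal (C₁ ^ (p - 1)) * ∫⁻ z in V, ∫⁻ x in U,
        ENNReal.ofReal (|x k| ^ (-(τ - (θ - d)))) *
          (ENNReal.ofReal (‖z - x‖ ^ (-(d : ℝ))) * H z) := by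
      rw [lintegral_const_mul' _ _ ENNReal.ofReal_ne_top, lintegral_lintegral_swap]
      simp only [Function.uncurry_def]
      fun_prop
    _ ≤ ENNReal.ofReal (C₁ ^ (p - 1)) * ∫⁻ z in V, ENNReal.ofReal C₂ *
        (ENNReal.ofReal (|z k| ^ (θ - d - α * p / 2)) * g z ^ p) := by
      exact mul_le_mul_right (setLIntegral_mono' hVm hright) _
    _ = _ := by
      rw [lintegral_const_mul _ (by fun_prop), ← mul_assoc,
        ← ENNReal.ofReal_mul (by positivity)]
end

section
/- Let d ≥ 1 be an integer, α ∈ (0,2), p ∈ (1,∞), and θ ∈ (d-1, d-1+p). Define for t > 0, x with x¹ > 0 and z with z¹ < 0 the kernel q(t,x,z) := min(t^{-d/α-1}, |x-z|^{-d-α}) · min(1, (x¹)^{α/2}/√t) · min(1, |z¹|^{α/2}/√t)^{-1}. Then there exists a constant C = C(d,α,θ,p) > 0 such that for every T ∈ (0,∞] and every measurable g : (0,T) × {z : z¹ < 0} → [0,∞], ∫_0^T ∫_{{x : x¹ > 0}} (x¹)^{θ-d-αp/2} ( ∫_0^t ∫_{{z : z¹ < 0}} q(t-s,x,z) g(s,z)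 dz ds )^p dx dt ≤ C ∫_0^T ∫_{{z : z¹ < 0}} |z¹|^{θ-d-αp/2} g(s,z)^p dz ds. -/
open MeasureTheory ENNReal

/-- The truncated power `|y|^{-τ} (b ∨ |y|)^{-κ}` on the line. -/
noncomputable def truncPow (τ κ b y : ℝ) : ℝ := |y| ^ (-τ) * max b |y| ^ (-κ)

theorem truncPow_nonneg {τ κ b y : ℝ} : 0 ≤ truncPow τ κ b y := by
  have : 0 ≤ max b |y| := le_max_of_le_right (abs_nonneg y)
  unfold truncPow
  positivity

theorem measurable_truncPow {X : Type*} [MeasurableSpace X] {τ κ : ℝ} {b y : X → ℝ}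
    (hb : Measurable b) (hy : Measurable y) :
    Measurable fun x => truncPow τ κ (b x) (y x) := by
  have hy' : Measurable fun x => |y x| := hy.norm
  exact (hy'.pow_const _).mul ((hb.max hy').pow_const _)

theorem setLIntegral_Ioi_truncPow_le {τ κ b : ℝ} (hτ : τ < 1) (hκ : 1 < τ + κ) (hb : 0 < b) :
    ∫⁻ y in Set.Ioi (0 : ℝ), ENNReal.ofReal (truncPow τ κ b y) ≤
      ENNReal.ofReal ((1 / (1 - τ) + 1 / (τ + κ - 1)) * b ^ (1 - τ - κ)) := by
  have h1 : ∫⁻ y in Set.Ioc (0 : ℝ) b, ENNReal.ofReal (truncPow τ κ b y) =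
      ENNReal.ofReal (1 / (1 - τ) * b ^ (1 - τ - κ)) := by
    have hint : IntegrableOn (fun y : ℝ => y ^ (-τ) * b ^ (-κ)) (Set.Ioc 0 b) :=
      ((intervalIntegrable_iff_integrableOn_Ioc_of_le hb.le).1
        (intervalIntegral.intervalIntegrable_rpow' (by linarith))).mul_const _
    have hcongr : ∫⁻ y in Set.Ioc (0 : ℝ) b, ENNReal.ofReal (truncPow τ κ b y) =
        ∫⁻ y in Set.Ioc (0 : ℝ) b, ENNReal.ofReal (y ^ (-τ) * b ^ (-κ)) := by
      refine setLIntegral_congr_fun measurableSet_Ioc fun y hy => ?_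
      simp only [truncPow, abs_of_pos hy.1, max_eq_left hy.2]
    rw [hcongr, ← ofReal_integral_eq_lintegral_ofReal hint, integral_mul_const,
      ← intervalIntegral.integral_of_le hb.le, integral_rpow (Or.inl (by linarith)),
      Real.zero_rpow (by linarith)]
    · congr 1
      rw [show 1 - τ - κ = (-τ + 1) + -κ by ring, Real.rpow_add hb (-τ + 1),
        neg_add_eq_sub τ 1]
      ring
    · filter_upwards [ae_restrict_mem measurableSet_Ioc] with y hy
      have := hy.1
      positivity
  have h2 : ∫⁻ y in Set.Ioi b, ENNReal.ofReal (truncPow τ κ b y) =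
      ENNReal.ofReal (1 / (τ + κ - 1) * b ^ (1 - τ - κ)) := by
    have hcongr : ∫⁻ y in Set.Ioi b, ENNReal.ofReal (truncPow τ κ b y) =
        ∫⁻ y in Set.Ioi b, ENNReal.ofReal (y ^ (-τ - κ)) := by
      refine setLIntegral_congr_fun measurableSet_Ioi fun y hy => ?_
      have hy0 : 0 < y := hb.trans hy
      simp only [truncPow, abs_of_pos hy0, max_eq_right (Set.mem_Ioi.1 hy).le]
      rw [← Real.rpow_add hy0, sub_eq_add_neg]
    rw [hcongr, ← ofReal_integral_eq_lintegral_ofReal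
      (integrableOn_Ioi_rpow_of_lt (by linarith) hb),
      integral_Ioi_rpow_of_lt (by linarith) hb]
    · congr 1
      have : τ + κ - 1 ≠ 0 := by linarith
      have : -τ - κ + 1 ≠ 0 := by linarith
      rw [show 1 - τ - κ = -τ - κ + 1 by ring]
      field_simp
      ring
    · filter_upwards [ae_restrict_mem measurableSet_Ioi] with y hy
      have : 0 < y := hb.trans hy
      positivity
  rw [← Set.Ioc_union_Ioi_eq_Ioi hb.le]
  refine (lintegral_union_le _ _ _).trans ?_
  have : 0 < 1 - τ := by linarith
  have : 0 < τ + κ - 1 := by linarith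
  rw [h1, h2, ← ENNReal.ofReal_add (by positivity) (by positivity), add_mul]

theorem lintegral_truncPow_le {τ κ b : ℝ} (hτ : τ < 1) (hκ : 1 < τ + κ) (hb : 0 < b) (c : ℝ) :
    ∫⁻ y, ENNReal.ofReal (truncPow τ κ b (y - c)) ≤
      ENNReal.ofReal (2 * (1 / (1 - τ) + 1 / (τ + κ - 1)) * b ^ (1 - τ - κ)) := by
  have hpos := setLIntegral_Ioi_truncPow_le hτ hκ hb
  have hneg : ∫⁻ y in Set.Iio (0 : ℝ), ENNReal.ofReal (truncPow τ κ b y) =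
      ∫⁻ y in Set.Ioi (0 : ℝ), ENNReal.ofReal (truncPow τ κ b y) := by
    have := (Measure.measurePreserving_neg (volume : Measure ℝ)).setLIntegral_comp_preimage_emb
      (MeasurableEquiv.neg ℝ).measurableEmbedding
      (fun y => ENNReal.ofReal (truncPow τ κ b y)) (Set.Ioi 0)
    rw [← this]
    simp [truncPow]
  rw [lintegral_sub_right_eq_self (fun y => ENNReal.ofReal (truncPow τ κ b y)) c,
    ← setLIntegral_univ, ← Set.Iic_union_Ioi (a := (0 : ℝ))]
  refine (lintegral_union_le _ _ _).trans ?_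
  rw [setLIntegral_congr Iio_ae_eq_Iic.symm, hneg]
  refine (add_le_add hpos hpos).trans (le_of_eq ?_)
  rw [← two_mul, ← ENNReal.ofReal_ofNat 2, ← ENNReal.ofReal_mul (by norm_num), mul_assoc]

theorem lintegral_fin_prod_eq_prod {n : ℕ} {f : Fin n → ℝ → ℝ≥0∞} (hf : ∀ i, Measurable (f i)) :
    ∫⁻ x : Fin n → ℝ, ∏ i, f i (x i) = ∏ i, ∫⁻ y, f i y := by
  induction n with
  | zero => simp [volume_pi]
  | succ n ih =>
    have hmp := (volume_preserving_piFinSuccAbove (fun _ : Fin (n + 1) => ℝ) 0).symm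
    rw [← hmp.lintegral_comp_emb (MeasurableEquiv.measurableEmbedding _), Measure.volume_eq_prod]
    simp_rw [MeasurableEquiv.piFinSuccAbove_symm_apply, Fin.insertNthEquiv, Fin.prod_univ_succ]
    simp only [Equiv.coe_fn_mk, Fin.insertNth_zero, Fin.cons_zero, Fin.cons_succ]
    rw [← ih fun i => hf i.succ]
    exact lintegral_prod_mul (hf 0).aemeasurable
      (Finset.measurable_prod _ fun i _ => (hf (Fin.succ i)).comp (measurable_pi_apply i)).aemeasurable

/-- A Schur test for positive integral operators between weighted `L_p` spaces. -/
theorem lintegral_rpow_kernel_le {X Y : Type*} [MeasurableSpace X] [MeasurableSpace Y]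
    {μ : Measure X} {ν : Measure Y} [SFinite μ] [SFinite ν] {p q : ℝ} (hpq : p.HolderConjugate q)
    {K : X → Y → ℝ≥0∞} (hK : Measurable (Function.uncurry K)) {φ ψ h V : Y → ℝ≥0∞}
    {v w : X → ℝ≥0∞} (hφ : Measurable φ) (hψ : Measurable ψ) (hh : Measurable h)
    (hv : Measurable v) (hw : Measurable w) {A B : ℝ≥0∞} (hφψ : ∀ᵐ y ∂ν, ψ y * φ y = 1)
    (hA : ∀ᵐ x ∂μ, ∫⁻ y, K x y * ψ y ^ q ∂ν ≤ A * w x)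
    (hB : ∀ᵐ y ∂ν, (∫⁻ x, K x y * (v x * w x ^ (p / q)) ∂μ) * φ y ^ p ≤ B * V y) :
    ∫⁻ x, v x * (∫⁻ y, K x y * h y ∂ν) ^ p ∂μ ≤
      A ^ (p / q) * (∫⁻ y, B * (V y * h y ^ p) ∂ν) := by
  have hp := hpq.pos
  have hq := hpq.symm.pos
  have hKx : ∀ x, Measurable (K x) := fun x => hK.comp measurable_prodMk_left
  have hholder : ∀ x, (∫⁻ y, K x y * h y ∂ν) ^ p ≤
      (∫⁻ y, K x y * ψ y ^ q ∂ν) ^ (p / q) * ∫⁻ y, K x y * (φ y * h y) ^ p ∂ν := by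
    intro x
    have h1 : ∫⁻ y, K x y * h y ∂ν =
        ∫⁻ y, ((fun y => K x y ^ (1 / p) * (φ y * h y)) *
          (fun y => K x y ^ (1 / q) * ψ y)) y ∂ν := by
      refine lintegral_congr_ae ?_
      filter_upwards [hφψ] with y hy
      simp only [Pi.mul_apply]
      calc K x y * h y = K x y ^ (1 / p + 1 / q) * h y := by
            rw [one_div, one_div, hpq.inv_add_inv_eq_one, ENNReal.rpow_one]
        _ = (K x y ^ (1 / p) * K x y ^ (1 / q)) * ((ψ y * φ y) * h y) := by
            rw [ENNReal.rpow_add_of_nonneg _ _ (by positivity) (by positivity), hy, one_mul]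
        _ = _ := by ring
    have h2 := ENNReal.lintegral_mul_le_Lp_mul_Lq ν hpq
      (f := fun y => K x y ^ (1 / p) * (φ y * h y)) (g := fun y => K x y ^ (1 / q) * ψ y)
      (((hKx x).pow_const _).mul (hφ.mul hh)).aemeasurable
      (((hKx x).pow_const _).mul hψ).aemeasurable
    have h3 : ∀ a b : ℝ≥0∞, ∀ r : ℝ, 0 < r → (a ^ (1 / r) * b) ^ r = a * b ^ r := by
      intro a b r hr
      rw [ENNReal.mul_rpow_of_nonneg _ _ hr.le, ← ENNReal.rpow_mul, one_div,
        inv_mul_cancel₀ hr.ne', ENNReal.rpow_one]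
    simp only [h3 _ _ p hp, h3 _ _ q hq] at h2
    rw [h1]
    refine (ENNReal.rpow_le_rpow h2 hp.le).trans (le_of_eq ?_)
    rw [mul_comm, ENNReal.mul_rpow_of_nonneg _ _ hp.le,
      ← ENNReal.rpow_mul, ← ENNReal.rpow_mul]
    congr 2
    · field_simp
    · rw [one_div, inv_mul_cancel₀ hp.ne', ENNReal.rpow_one]
  calc ∫⁻ x, v x * (∫⁻ y, K x y * h y ∂ν) ^ p ∂μ
      ≤ ∫⁻ x, A ^ (p / q) * ∫⁻ y, K x y * (v x * w x ^ (p / q)) * (φ y ^ p * h y ^ p) ∂ν ∂μ := by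
        refine lintegral_mono_ae ?_
        filter_upwards [hA] with x hx
        calc v x * (∫⁻ y, K x y * h y ∂ν) ^ p
            ≤ v x * ((A * w x) ^ (p / q) * ∫⁻ y, K x y * (φ y * h y) ^ p ∂ν) := by
              gcongr
              exact (hholder x).trans (by gcongr)
          _ = A ^ (p / q) * ((v x * w x ^ (p / q)) * ∫⁻ y, K x y * (φ y * h y) ^ p ∂ν) := by
              rw [ENNReal.mul_rpow_of_nonneg _ _ (by positivity)]
              ring
          _ = _ := by
              rw [← lintegral_const_mul (f := fun y => K x y * (φ y * h y) ^ p) _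
                ((hKx x).mul ((hφ.mul hh).pow_const _))]
              congr 1
              refine lintegral_congr fun y => ?_
              rw [ENNReal.mul_rpow_of_nonneg _ _ hp.le]
              ring
    _ = A ^ (p / q) *
          ∫⁻ y, (∫⁻ x, K x y * (v x * w x ^ (p / q)) ∂μ) * (φ y ^ p * h y ^ p) ∂ν := by
        have hm : Measurable (Function.uncurry fun x y =>
            K x y * (v x * w x ^ (p / q)) * (φ y ^ p * h y ^ p)) := by
          have hK' : Measurable fun z : X × Y => K z.1 z.2 := hK
          simp only [Function.uncurry_def]
          fun_prop
        rw [lintegral_const_mul (f := fun x =>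
          ∫⁻ y, K x y * (v x * w x ^ (p / q)) * (φ y ^ p * h y ^ p) ∂ν) _
          hm.lintegral_prod_right', lintegral_lintegral_swap hm.aemeasurable]
        congr 1
        refine lintegral_congr fun y => ?_
        refine lintegral_mul_const _ ?_
        have : Measurable fun x => K x y := hK.comp measurable_prodMk_right
        fun_prop
    _ ≤ _ := by
        gcongr 1
        refine lintegral_mono_ae ?_
        filter_upwards [hB] with y hy
        rw [← mul_assoc, ← mul_assoc]
        gcongr

/-- Time-integrable majorant, at distance `r`, of the heat kernel part of the parabolic Poisson
kernel. -/
noncomputable def caloricMajorant (d : ℕ) (α u r : ℝ) : ℝ :=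
  truncPow 0 (d / α + 1) (r ^ α) u + r ^ (α / 2) * truncPow (1 / 2) (d / α + 1) (r ^ α) u

theorem measurable_caloricMajorant {X : Type*} [MeasurableSpace X] (d : ℕ) (α : ℝ) {u r : X → ℝ}
    (hu : Measurable u) (hr : Measurable r) :
    Measurable fun x => caloricMajorant d α (u x) (r x) :=
  (measurable_truncPow (hr.pow_const _) hu).add
    ((hr.pow_const _).mul (measurable_truncPow (hr.pow_const _) hu))

theorem caloricMajorant_neg (d : ℕ) (α u r : ℝ) :
    caloricMajorant d α (-u) r = caloricMajorant d α u r := by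
  simp [caloricMajorant, truncPow]

theorem lintegral_caloricMajorant_le {d : ℕ} (hd : 1 ≤ d) {α : ℝ} (hα : 0 < α) :
    ∃ C : ℝ, 0 < C ∧ ∀ r, 0 < r → ∀ t : ℝ,
      ∫⁻ s, ENNReal.ofReal (caloricMajorant d α (s - t) r) ≤
        ENNReal.ofReal (C * r ^ (-(d : ℝ))) := by
  have hd' : (0 : ℝ) < d := by exact_mod_cast hd
  have hκ : 0 < d / α := by positivity
  have e0 : 0 < (0 : ℝ) + (d / α + 1) - 1 := by linarith
  have e1 : 0 < (1 / 2 : ℝ) + (d / α + 1) - 1 := by linarith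
  set C₀ : ℝ := 2 * (1 / (1 - 0) + 1 / (0 + (d / α + 1) - 1)) with hC₀
  set C₁ : ℝ := 2 * (1 / (1 - 1 / 2) + 1 / (1 / 2 + (d / α + 1) - 1)) with hC₁
  have hC₀' : 0 < C₀ := by positivity
  have hC₁' : 0 < C₁ := by
    have : (0 : ℝ) < 1 - 1 / 2 := by norm_num
    positivity
  refine ⟨C₀ + C₁, by positivity, fun r hr t => ?_⟩
  have hrα : 0 < r ^ α := by positivity
  have h0 := lintegral_truncPow_le (τ := 0) (κ := d / α + 1) (by norm_num) (by linarith) hrα t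
  have h1 := lintegral_truncPow_le (τ := 1 / 2) (κ := d / α + 1) (by norm_num) (by linarith) hrα t
  rw [← hC₀, ← Real.rpow_mul hr.le,
    show α * (1 - 0 - (d / α + 1)) = -(d : ℝ) by field_simp; ring] at h0
  rw [← hC₁, ← Real.rpow_mul hr.le] at h1
  have hm : ∀ τ : ℝ, Measurable fun s : ℝ =>
      ENNReal.ofReal (truncPow τ (d / α + 1) (r ^ α) (s - t)) := fun τ =>
    (measurable_truncPow measurable_const (measurable_id.sub_const t)).ennreal_ofReal
  have hsplit : ∀ s : ℝ, ENNReal.ofReal (caloricMajorant d α (s - t) r) =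
      ENNReal.ofReal (truncPow 0 (d / α + 1) (r ^ α) (s - t)) +
        ENNReal.ofReal (r ^ (α / 2)) *
          ENNReal.ofReal (truncPow (1 / 2) (d / α + 1) (r ^ α) (s - t)) := by
    intro s
    rw [caloricMajorant, ENNReal.ofReal_add truncPow_nonneg
      (mul_nonneg (by positivity) truncPow_nonneg), ENNReal.ofReal_mul (by positivity)]
  simp_rw [hsplit]
  rw [lintegral_add_left (hm 0), lintegral_const_mul _ (hm _)]
  calc _ ≤ ENNReal.ofReal (C₀ * r ^ (-(d : ℝ))) + ENNReal.ofReal (r ^ (α / 2)) *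
        ENNReal.ofReal (C₁ * r ^ (α * (1 - 1 / 2 - (d / α + 1)))) := by gcongr
    _ = _ := by
      rw [← ENNReal.ofReal_mul (by positivity), ← ENNReal.ofReal_add (by positivity)
        (by positivity), mul_left_comm, ← Real.rpow_add hr,
        show α / 2 + α * (1 - 1 / 2 - (d / α + 1)) = -(d : ℝ) by field_simp; ring, add_mul]

theorem le_caloricMajorant {d : ℕ} {α u r a b : ℝ} (hα : 0 < α) (hu : 0 < u) (ha : 0 < a)
    (hb : 0 < b) (hbr : b ≤ r) :
    min (u ^ (-(d : ℝ) / α - 1)) (r ^ (-(d : ℝ) - α)) * min 1 (a ^ (α / 2) / Real.sqrt u) *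
        (min 1 (b ^ (α / 2) / Real.sqrt u))⁻¹ ≤
      a ^ (α / 2) * (caloricMajorant d α u r * b ^ (-(α / 2))) := by
  have hr : 0 < r := hb.trans_le hbr
  have hκ : 0 ≤ d / α + 1 := by positivity
  have hM : min (u ^ (-(d : ℝ) / α - 1)) (r ^ (-(d : ℝ) - α)) =
      max (r ^ α) |u| ^ (-(d / α + 1)) := by
    rw [abs_of_pos hu]
    have e1 : u ^ (-(d : ℝ) / α - 1) = u ^ (-(d / α + 1)) := by congr 1; ring
    have e2 : r ^ (-(d : ℝ) - α) = (r ^ α) ^ (-(d / α + 1)) := by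
      rw [← Real.rpow_mul hr.le]; congr 1; field_simp; ring
    rw [e1, e2]
    have hrα : 0 < r ^ α := by positivity
    rcases le_total (r ^ α) u with h | h
    · rw [max_eq_right h, min_eq_left]
      exact Real.rpow_le_rpow_of_nonpos hrα h (by linarith)
    · rw [max_eq_left h, min_eq_right]
      exact Real.rpow_le_rpow_of_nonpos hu h (by linarith)
  set M := max (r ^ α) |u| ^ (-(d / α + 1)) with hMdef
  have hM0 : 0 ≤ M := by
    have : 0 ≤ max (r ^ α) |u| := le_max_of_le_right (abs_nonneg u)
    positivity
  have hF : caloricMajorant d α u r = M * (1 + r ^ (α / 2) / Real.sqrt u) := by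
    simp only [caloricMajorant, truncPow, ← hMdef]
    rw [abs_of_pos hu, Real.rpow_neg hu.le (1 / 2), ← Real.sqrt_eq_rpow, neg_zero, Real.rpow_zero]
    ring
  rw [hM, hF, Real.rpow_neg hb.le]
  have hA : 0 < a ^ (α / 2) := by positivity
  have hB : 0 < b ^ (α / 2) := by positivity
  have hBR : b ^ (α / 2) ≤ r ^ (α / 2) := by gcongr
  have hs : 0 < Real.sqrt u := Real.sqrt_pos.2 hu
  have hinv : (min 1 (b ^ (α / 2) / Real.sqrt u))⁻¹ ≤ 1 + Real.sqrt u / b ^ (α / 2) := by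
    rcases le_total 1 (b ^ (α / 2) / Real.sqrt u) with h | h
    · rw [min_eq_left h, inv_one]
      exact le_add_of_nonneg_right (by positivity)
    · rw [min_eq_right h, inv_div]
      linarith
  calc M * min 1 (a ^ (α / 2) / Real.sqrt u) * (min 1 (b ^ (α / 2) / Real.sqrt u))⁻¹
      ≤ M * (a ^ (α / 2) / Real.sqrt u) * (1 + Real.sqrt u / b ^ (α / 2)) := by
        gcongr
        exact min_le_right _ _
    _ = a ^ (α / 2) * (M * (1 + b ^ (α / 2) / Real.sqrt u) * (b ^ (α / 2))⁻¹) := by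
        field_simp
        rw [add_comm]
    _ ≤ _ := by gcongr

/-- The integral of a Riesz-type kernel against a power weight over the opposite half space. -/
theorem setLIntegral_norm_sub_rpow_le {d : ℕ} (i₀ : Fin d) {τ : ℝ} (hτ0 : 0 < τ) (hτ1 : τ < 1) :
    ∃ C : ℝ, 0 < C ∧ ∀ z : EuclideanSpace ℝ (Fin d), z i₀ ≠ 0 →
      ∫⁻ x in {x : EuclideanSpace ℝ (Fin d) | x i₀ * z i₀ < 0},
        ENNReal.ofReal (‖x - z‖ ^ (-(d : ℝ))) * ENNReal.ofReal (|x i₀| ^ (-τ)) ≤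
      ENNReal.ofReal (C * |z i₀| ^ (-τ)) := by
  classical
  have hd : 0 < d := Fin.pos i₀
  have hd' : (0 : ℝ) < d := by exact_mod_cast hd
  set ε : ℝ := τ / (2 * d) with hε
  have hε0 : 0 < ε := by positivity
  have hdε : d * ε = τ / 2 := by rw [hε]; field_simp
  set σ : Fin d → ℝ := fun i => if i = i₀ then τ else 0 with hσ
  set κ : Fin d → ℝ := fun i => if i = i₀ then 1 - (d - 1) * ε else 1 + ε with hκ
  have hκ0 : ∀ i, 0 ≤ κ i := by
    intro i
    simp only [hκ]
    split_ifs <;> nlinarith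
  have hσ1 : ∀ i, σ i < 1 := by
    intro i
    simp only [hσ]
    split_ifs <;> linarith
  have hσκ : ∀ i, 1 < σ i + κ i := by
    intro i
    simp only [hσ, hκ]
    split_ifs <;> nlinarith
  have hsumκ : ∑ i, κ i = d := by
    have : ∀ i, κ i = (1 + ε) + if i = i₀ then -(d * ε) else 0 := by
      intro i
      simp only [hκ]
      split_ifs <;> ring
    simp_rw [this, Finset.sum_add_distrib]
    simp
  have hsumσ : ∑ i, σ i = τ := by simp [hσ]
  set c : Fin d → ℝ := fun i => 2 * (1 / (1 - σ i) + 1 / (σ i + κ i - 1)) with hc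
  have hc0 : ∀ i, 0 < c i := by
    intro i
    have h1 : 0 < 1 - σ i := by linarith [hσ1 i]
    have h2 : 0 < σ i + κ i - 1 := by linarith [hσκ i]
    simp only [hc]
    positivity
  refine ⟨∏ i, c i, Finset.prod_pos fun i _ => hc0 i, fun z hz => ?_⟩
  set b := |z i₀| with hb
  have hb0 : 0 < b := abs_pos.2 hz
  set m : Fin d → ℝ := fun i => if i = i₀ then 0 else z i with hm
  have hmeas : ∀ i, Measurable fun y : ℝ => ENNReal.ofReal (truncPow (σ i) (κ i) b (y - m i)) :=
    fun i => (measurable_truncPow measurable_const (measurable_id.sub_const _)).ennreal_ofReal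
  have hpt : ∀ x ∈ {x : EuclideanSpace ℝ (Fin d) | x i₀ * z i₀ < 0},
      ENNReal.ofReal (‖x - z‖ ^ (-(d : ℝ))) * ENNReal.ofReal (|x i₀| ^ (-τ)) ≤
        ∏ i, ENNReal.ofReal (truncPow (σ i) (κ i) b (x i - m i)) := by
    intro x hx
    have hx : x i₀ * z i₀ < 0 := hx
    have hcoord : ∀ i, |x i - z i| ≤ ‖x - z‖ := fun i => by
      simpa using PiLp.norm_apply_le (x - z) i
    have habs : |x i₀| ≤ |x i₀ - z i₀| ∧ |z i₀| ≤ |x i₀ - z i₀| := by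
      constructor <;> refine sq_le_sq.1 ?_ <;> nlinarith [sq_nonneg (x i₀), sq_nonneg (z i₀)]
    have hbn : b ≤ ‖x - z‖ := habs.2.trans (hcoord i₀)
    have hmax : ∀ i, max b |x i - m i| ≤ ‖x - z‖ := by
      intro i
      refine max_le hbn ?_
      simp only [hm]
      split_ifs with h
      · rw [h, sub_zero]
        exact habs.1.trans (hcoord i₀)
      · exact hcoord i
    have hn : 0 < ‖x - z‖ := hb0.trans_le hbn
    rw [← ENNReal.ofReal_mul (by positivity), ← ENNReal.ofReal_prod_of_nonneg
      fun i _ => truncPow_nonneg]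
    refine ENNReal.ofReal_le_ofReal ?_
    simp only [truncPow]
    rw [Finset.prod_mul_distrib, mul_comm]
    have h1 : ∏ i, |x i - m i| ^ (-σ i) = |x i₀| ^ (-τ) := by
      rw [Finset.prod_eq_single i₀]
      · simp [hm, hσ]
      · intro i _ hi
        simp [hσ, hi]
      · simp
    have h2 : ‖x - z‖ ^ (-(d : ℝ)) = ∏ i, ‖x - z‖ ^ (-κ i) := by
      rw [← Real.rpow_sum_of_pos hn, Finset.sum_neg_distrib, hsumκ]
    rw [h1, h2]
    refine mul_le_mul_of_nonneg_left (Finset.prod_le_prod (fun i _ => by positivity) fun i _ => ?_)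
      (by positivity)
    exact Real.rpow_le_rpow_of_nonpos (lt_max_of_lt_left hb0) (hmax i) (by linarith [hκ0 i])
  calc _ ≤ ∫⁻ x in {x : EuclideanSpace ℝ (Fin d) | x i₀ * z i₀ < 0},
        ∏ i, ENNReal.ofReal (truncPow (σ i) (κ i) b (x i - m i)) := by
        refine setLIntegral_mono ?_ hpt
        refine Finset.measurable_prod _ fun i _ => ?_
        exact (hmeas i).comp (by fun_prop)
    _ ≤ ∫⁻ x : EuclideanSpace ℝ (Fin d),
        ∏ i, ENNReal.ofReal (truncPow (σ i) (κ i) b (x i - m i)) := setLIntegral_le_lintegral _ _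
    _ = ∫⁻ x : Fin d → ℝ, ∏ i, ENNReal.ofReal (truncPow (σ i) (κ i) b (x i - m i)) := by
        have hmp := (EuclideanSpace.volume_preserving_symm_measurableEquiv_toLp (Fin d)).symm
        rw [← hmp.lintegral_comp_emb (MeasurableEquiv.measurableEmbedding _)]
        rfl
    _ = ∏ i, ∫⁻ y, ENNReal.ofReal (truncPow (σ i) (κ i) b (y - m i)) :=
        lintegral_fin_prod_eq_prod hmeas
    _ ≤ ∏ i, ENNReal.ofReal (c i * b ^ (1 - σ i - κ i)) :=
        Finset.prod_le_prod' fun i _ => lintegral_truncPow_le (hσ1 i) (hσκ i) hb0 _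
    _ = _ := by
        rw [← ENNReal.ofReal_prod_of_nonneg fun i _ => by have := hc0 i; positivity,
          Finset.prod_mul_distrib, ← Real.rpow_sum_of_pos hb0]
        congr 3
        simp only [Finset.sum_sub_distrib, hsumκ, hsumσ]
        simp

theorem lintegral_caloricMajorant_weight_le {d : ℕ} (i₀ : Fin d) {α τ : ℝ} (hα : 0 < α)
    (hτ0 : 0 < τ) (hτ1 : τ < 1) :
    ∃ C : ℝ, 0 < C ∧ ∀ (t : ℝ) (z : EuclideanSpace ℝ (Fin d)), z i₀ ≠ 0 →
      ∫⁻ y in (Set.univ : Set ℝ) ×ˢ {x : EuclideanSpace ℝ (Fin d) | x i₀ * z i₀ < 0},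
        ENNReal.ofReal (caloricMajorant d α (y.1 - t) ‖y.2 - z‖) *
          ENNReal.ofReal (|y.2 i₀| ^ (-τ)) ≤
      ENNReal.ofReal (C * |z i₀| ^ (-τ)) := by
  obtain ⟨C₁, hC₁, h₁⟩ := lintegral_caloricMajorant_le (Fin.pos i₀) hα
  obtain ⟨C₂, hC₂, h₂⟩ := setLIntegral_norm_sub_rpow_le i₀ hτ0 hτ1
  refine ⟨C₁ * C₂, by positivity, fun t z hz => ?_⟩
  have hF : Measurable fun y : ℝ × EuclideanSpace ℝ (Fin d) =>
      ENNReal.ofReal (caloricMajorant d α (y.1 - t) ‖y.2 - z‖) :=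
    (measurable_caloricMajorant d α (by fun_prop) (by fun_prop)).ennreal_ofReal
  have hFw : Measurable fun y : ℝ × EuclideanSpace ℝ (Fin d) =>
      ENNReal.ofReal (caloricMajorant d α (y.1 - t) ‖y.2 - z‖) *
        ENNReal.ofReal (|y.2 i₀| ^ (-τ)) :=
    hF.mul (by fun_prop)
  have hS : MeasurableSet {x : EuclideanSpace ℝ (Fin d) | x i₀ * z i₀ < 0} :=
    measurableSet_lt (by fun_prop) measurable_const
  rw [Measure.volume_eq_prod, ← Measure.prod_restrict, Measure.restrict_univ,
    lintegral_prod_symm' _ hFw]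
  calc _ ≤ ∫⁻ x in {x : EuclideanSpace ℝ (Fin d) | x i₀ * z i₀ < 0}, ENNReal.ofReal C₁ *
        (ENNReal.ofReal (‖x - z‖ ^ (-(d : ℝ))) * ENNReal.ofReal (|x i₀| ^ (-τ))) := by
        refine setLIntegral_mono' hS fun x hx => ?_
        dsimp only
        rw [lintegral_mul_const' _ _ ENNReal.ofReal_ne_top, ← mul_assoc,
          ← ENNReal.ofReal_mul hC₁.le]
        gcongr
        refine h₁ _ (norm_pos_iff.2 (sub_ne_zero.2 ?_)) t
        rintro rfl
        exact (mul_self_nonneg (x i₀)).not_gt hx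
    _ ≤ ENNReal.ofReal C₁ * ENNReal.ofReal (C₂ * |z i₀| ^ (-τ)) := by
        rw [lintegral_const_mul _ (by fun_prop)]
        gcongr
        exact h₂ z hz
    _ = _ := by rw [← ENNReal.ofReal_mul hC₁.le, mul_assoc]

/-- Weighted space-time `L_p` boundedness of the parabolic Poisson integral of exterior data
on the half space, with constant independent of the time horizon `T ∈ (0,∞]`. Here
`q(t,x,z) = (t^{-d/α-1} ∧ |x-z|^{-d-α})(1 ∧ (x¹)^{α/2}/√t)(1 ∧ |z¹|^{α/2}/√t)^{-1}`. -/
theorem stmt_9 (d : ℕ) (hd : 1 ≤ d) (α p θ : ℝ) (hα : α ∈ Set.Ioo (0 : ℝ) 2)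
    (hp : 1 < p) (hθ : θ ∈ Set.Ioo ((d : ℝ) - 1) ((d : ℝ) - 1 + p)) :
    ∃ C : ℝ, 0 < C ∧ ∀ T : ℝ≥0∞, 0 < T →
      ∀ g : ℝ → EuclideanSpace ℝ (Fin d) → ℝ≥0∞, Measurable (Function.uncurry g) →
      ∫⁻ t in {t : ℝ | 0 < t ∧ ENNReal.ofReal t < T},
        ∫⁻ x in {x : EuclideanSpace ℝ (Fin d) | 0 < x ⟨0, hd⟩},
          ENNReal.ofReal ((x ⟨0, hd⟩) ^ (θ - d - α * p / 2)) *
            (∫⁻ s in Set.Ioo (0 : ℝ) t,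
              ∫⁻ z in {z : EuclideanSpace ℝ (Fin d) | z ⟨0, hd⟩ < 0},
                ENNReal.ofReal
                  (min ((t - s) ^ (-(d : ℝ) / α - 1)) (‖x - z‖ ^ (-(d : ℝ) - α)) *
                    min 1 ((x ⟨0, hd⟩) ^ (α / 2) / Real.sqrt (t - s)) *
                    (min 1 (|z ⟨0, hd⟩| ^ (α / 2) / Real.sqrt (t - s)))⁻¹) * g s z) ^ p
        ≤ ENNReal.ofReal C *
            ∫⁻ s in {t : ℝ | 0 < t ∧ ENNReal.ofReal t < T},
              ∫⁻ z in {z : EuclideanSpace ℝ (Fin d) | z ⟨0, hd⟩ < 0},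
                ENNReal.ofReal (|z ⟨0, hd⟩| ^ (θ - d - α * p / 2)) * g s z ^ p := by
  obtain ⟨hα0, -⟩ := hα
  obtain ⟨hθ0, hθ1⟩ := hθ
  have hp0 : 0 < p := by linarith
  set i₀ : Fin d := ⟨0, hd⟩
  set q := p.conjExponent
  have hpq : p.HolderConjugate q := Real.HolderConjugate.conjExponent hp
  have hq0 : 0 < q := hpq.symm.pos
  set γ := θ - d with hγ
  obtain ⟨σ, hσ0, hσ1⟩ : ∃ σ, max 0 (γ / p) < σ ∧ σ < min (1 / q) ((γ + 1) / p) := by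
    have h1 : 0 < 1 / q := by positivity
    have h2 : 0 < (γ + 1) / p := div_pos (by linarith) hp0
    have h3 : γ / p < 1 / q := by
      rw [one_div, ← hpq.one_sub_inv, div_lt_iff₀ hp0, sub_mul, inv_mul_cancel₀ hp0.ne']
      linarith
    have h4 : γ / p < (γ + 1) / p := by gcongr; linarith
    exact exists_between (max_lt (lt_min h1 h2) (lt_min h3 h4))
  rw [max_lt_iff] at hσ0
  rw [lt_min_iff] at hσ1
  have hσγ : γ < σ * p := (div_lt_iff₀ hp0).1 hσ0.2
  have hσγ' : σ * p < γ + 1 := (lt_div_iff₀ hp0).1 hσ1.2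
  have hσq : σ * q < 1 := (lt_div_iff₀ hq0).1 hσ1.1
  obtain ⟨A, hA0, hA⟩ := lintegral_caloricMajorant_weight_le i₀ hα0 (mul_pos hσ0.1 hq0) hσq
  obtain ⟨B, hB0, hB⟩ := lintegral_caloricMajorant_weight_le i₀ hα0
    (show 0 < σ * p - γ by linarith) (by linarith)
  refine ⟨A ^ (p / q) * B, by positivity, fun T hT g hg => ?_⟩
  set S : Set ℝ := {t : ℝ | 0 < t ∧ ENNReal.ofReal t < T}
  set Hp : Set (EuclideanSpace ℝ (Fin d)) := {x | 0 < x i₀}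
  set Hm : Set (EuclideanSpace ℝ (Fin d)) := {z | z i₀ < 0}
  have hS : MeasurableSet S :=
    (measurableSet_lt measurable_const measurable_id).inter
      (measurableSet_lt ENNReal.measurable_ofReal measurable_const)
  have hHp : MeasurableSet Hp := measurableSet_lt measurable_const (by fun_prop)
  have hHm : MeasurableSet Hm := measurableSet_lt (by fun_prop) measurable_const
  set K : ℝ × EuclideanSpace ℝ (Fin d) → ℝ × EuclideanSpace ℝ (Fin d) → ℝ≥0∞ := fun y y' =>
    ENNReal.ofReal (caloricMajorant d α (y.1 - y'.1) ‖y.2 - y'.2‖) with hK_def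
  have hK : Measurable (Function.uncurry K) :=
    (measurable_caloricMajorant d α (by fun_prop) (by fun_prop)).ennreal_ofReal
  set pw : ℝ → ℝ × EuclideanSpace ℝ (Fin d) → ℝ≥0∞ := fun r y =>
    ENNReal.ofReal (|y.2 i₀| ^ r) with hpw
  have hpwm : ∀ r, Measurable (pw r) := fun r => by simp only [hpw]; fun_prop
  have hpw_rpow : ∀ (r e : ℝ) (y : ℝ × EuclideanSpace ℝ (Fin d)), y.2 i₀ ≠ 0 →
      pw r y ^ e = pw (r * e) y := by
    intro r e y hy
    have hy' : 0 < |y.2 i₀| := abs_pos.2 hy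
    simp only [hpw]
    rw [ENNReal.ofReal_rpow_of_pos (by positivity), Real.rpow_mul hy'.le]
  have hpw_mul : ∀ (r e : ℝ) (y : ℝ × EuclideanSpace ℝ (Fin d)), y.2 i₀ ≠ 0 →
      pw r y * pw e y = pw (r + e) y := by
    intro r e y hy
    have hy' : 0 < |y.2 i₀| := abs_pos.2 hy
    simp only [hpw]
    rw [← ENNReal.ofReal_mul (by positivity), Real.rpow_add hy']
  have hg' : Measurable fun y : ℝ × EuclideanSpace ℝ (Fin d) => g y.1 y.2 := hg
  set h : ℝ × EuclideanSpace ℝ (Fin d) → ℝ≥0∞ := fun y => pw (-(α / 2)) y * g y.1 y.2 with hh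
  have hhm : Measurable h := (hpwm _).mul hg'
  set μ : Measure (ℝ × EuclideanSpace ℝ (Fin d)) :=
    (volume.restrict S).prod (volume.restrict Hp) with hμ
  set ν : Measure (ℝ × EuclideanSpace ℝ (Fin d)) :=
    (volume.restrict S).prod (volume.restrict Hm) with hν
  have hμmem : ∀ᵐ y ∂μ, 0 < y.2 i₀ := by
    rw [hμ, Measure.prod_restrict]
    filter_upwards [ae_restrict_mem (hS.prod hHp)] with y hy using hy.2
  have hνmem : ∀ᵐ y ∂ν, y.2 i₀ < 0 := by
    rw [hν, Measure.prod_restrict]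
    filter_upwards [ae_restrict_mem (hS.prod hHm)] with y hy using hy.2
  have hpq_div : σ * q * (p / q) = σ * p := by field_simp
  have key : ∫⁻ y, pw γ y * (∫⁻ y', K y y' * h y' ∂ν) ^ p ∂μ ≤
      ENNReal.ofReal A ^ (p / q) * ∫⁻ y', ENNReal.ofReal B * (pw γ y' * h y' ^ p) ∂ν := by
    refine lintegral_rpow_kernel_le hpq hK (φ := pw σ) (ψ := pw (-σ)) (w := pw (-(σ * q)))
      (hpwm _) (hpwm _) hhm (hpwm _) (hpwm _) ?_ ?_ ?_
    · filter_upwards [hνmem] with y hy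
      rw [hpw_mul _ _ _ hy.ne, neg_add_cancel]
      simp [hpw]
    · filter_upwards [hμmem] with y hy
      calc ∫⁻ y', K y y' * pw (-σ) y' ^ q ∂ν
          = ∫⁻ y' in S ×ˢ Hm,
              ENNReal.ofReal (caloricMajorant d α (y'.1 - y.1) ‖y'.2 - y.2‖) *
                ENNReal.ofReal (|y'.2 i₀| ^ (-(σ * q))) := by
            rw [Measure.volume_eq_prod, ← Measure.prod_restrict]
            refine lintegral_congr_ae ?_
            filter_upwards [hνmem] with y' hy'
            rw [hpw_rpow _ _ _ hy'.ne, neg_mul]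
            simp only [hK_def, hpw]
            rw [← neg_sub, caloricMajorant_neg, norm_sub_rev]
        _ ≤ ∫⁻ y' in (Set.univ : Set ℝ) ×ˢ {x : EuclideanSpace ℝ (Fin d) | x i₀ * y.2 i₀ < 0},
              ENNReal.ofReal (caloricMajorant d α (y'.1 - y.1) ‖y'.2 - y.2‖) *
                ENNReal.ofReal (|y'.2 i₀| ^ (-(σ * q))) :=
            lintegral_mono_set (Set.prod_mono (Set.subset_univ _)
              fun z hz => mul_neg_of_neg_of_pos hz hy)
        _ ≤ ENNReal.ofReal (A * |y.2 i₀| ^ (-(σ * q))) := hA _ _ hy.ne'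
        _ = _ := ENNReal.ofReal_mul hA0.le
    · filter_upwards [hνmem] with y' hy'
      have hbound : ∫⁻ y, K y y' * (pw γ y * pw (-(σ * q)) y ^ (p / q)) ∂μ ≤
          ENNReal.ofReal B * pw (-(σ * p - γ)) y' :=
        calc ∫⁻ y, K y y' * (pw γ y * pw (-(σ * q)) y ^ (p / q)) ∂μ
            = ∫⁻ y in S ×ˢ Hp,
                ENNReal.ofReal (caloricMajorant d α (y.1 - y'.1) ‖y.2 - y'.2‖) *
                  ENNReal.ofReal (|y.2 i₀| ^ (-(σ * p - γ))) := by
              rw [Measure.volume_eq_prod, ← Measure.prod_restrict]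
              refine lintegral_congr_ae ?_
              filter_upwards [hμmem] with y hy
              rw [hpw_rpow _ _ _ hy.ne', hpw_mul _ _ _ hy.ne', neg_mul, hpq_div, neg_sub,
                ← sub_eq_add_neg]
          _ ≤ ∫⁻ y in (Set.univ : Set ℝ) ×ˢ {x : EuclideanSpace ℝ (Fin d) | x i₀ * y'.2 i₀ < 0},
                ENNReal.ofReal (caloricMajorant d α (y.1 - y'.1) ‖y.2 - y'.2‖) *
                  ENNReal.ofReal (|y.2 i₀| ^ (-(σ * p - γ))) :=
              lintegral_mono_set (Set.prod_mono (Set.subset_univ _)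
                fun x hx => mul_neg_of_pos_of_neg hx hy')
          _ ≤ ENNReal.ofReal (B * |y'.2 i₀| ^ (-(σ * p - γ))) := hB _ _ hy'.ne
          _ = _ := ENNReal.ofReal_mul hB0.le
      calc _ ≤ ENNReal.ofReal B * pw (-(σ * p - γ)) y' * pw σ y' ^ p := by gcongr
        _ = _ := by
          rw [mul_assoc, hpw_rpow _ _ _ hy'.ne, hpw_mul _ _ _ hy'.ne]
          congr 2
          ring
  have hinner : ∀ t ∈ S, ∀ x ∈ Hp,
      ∫⁻ s in Set.Ioo (0 : ℝ) t, ∫⁻ z in Hm,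
        ENNReal.ofReal
          (min ((t - s) ^ (-(d : ℝ) / α - 1)) (‖x - z‖ ^ (-(d : ℝ) - α)) *
            min 1 ((x i₀) ^ (α / 2) / Real.sqrt (t - s)) *
            (min 1 (|z i₀| ^ (α / 2) / Real.sqrt (t - s)))⁻¹) * g s z ≤
      pw (α / 2) (t, x) * ∫⁻ y', K (t, x) y' * h y' ∂ν := by
    intro t ht x hx
    have hx : 0 < x i₀ := hx
    have hKt : Measurable (K (t, x)) := hK.of_uncurry_left
    calc _ ≤ ∫⁻ s in Set.Ioo (0 : ℝ) t, ∫⁻ z in Hm,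
            pw (α / 2) (t, x) * (K (t, x) (s, z) * h (s, z)) := by
          refine setLIntegral_mono' measurableSet_Ioo fun s hs => ?_
          refine setLIntegral_mono' hHm fun z hz => ?_
          have hz : z i₀ < 0 := hz
          have hbr : |z i₀| ≤ ‖x - z‖ := by
            have : |x i₀ - z i₀| ≤ ‖x - z‖ := by simpa using PiLp.norm_apply_le (x - z) i₀
            rw [abs_of_pos (by linarith)] at this
            rw [abs_of_neg hz]
            linarith
          have hz' : 0 < |z i₀| := abs_pos.2 hz.ne
          have hF0 : 0 ≤ caloricMajorant d α (t - s) ‖x - z‖ :=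
            add_nonneg truncPow_nonneg (mul_nonneg (by positivity) truncPow_nonneg)
          simp only [hh, hK_def, hpw]
          rw [abs_of_pos hx, ← mul_assoc (ENNReal.ofReal (caloricMajorant _ _ _ _)),
            ← ENNReal.ofReal_mul hF0, ← mul_assoc, ← ENNReal.ofReal_mul (by positivity)]
          exact mul_le_mul' (ENNReal.ofReal_le_ofReal
            (le_caloricMajorant hα0 (sub_pos.2 hs.2) hx hz' hbr)) le_rfl
      _ ≤ ∫⁻ s in S, ∫⁻ z in Hm, pw (α / 2) (t, x) * (K (t, x) (s, z) * h (s, z)) :=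
          lintegral_mono_set fun s hs =>
            ⟨hs.1, (ENNReal.ofReal_le_ofReal hs.2.le).trans_lt ht.2⟩
      _ = ∫⁻ y', pw (α / 2) (t, x) * (K (t, x) y' * h y') ∂ν :=
          (lintegral_prod _ ((hKt.mul hhm).const_mul _).aemeasurable).symm
      _ = _ := lintegral_const_mul' _ _ ENNReal.ofReal_ne_top
  have houter : ∀ y : ℝ × EuclideanSpace ℝ (Fin d), y.2 i₀ ≠ 0 → ∀ a : ℝ≥0∞,
      pw (γ - α * p / 2) y * (pw (α / 2) y * a) ^ p = pw γ y * a ^ p := by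
    intro y hy a
    rw [ENNReal.mul_rpow_of_nonneg _ _ hp0.le, ← mul_assoc, hpw_rpow _ _ _ hy, hpw_mul _ _ _ hy]
    congr 2
    ring
  have hKh : Measurable fun y => ∫⁻ y', K y y' * h y' ∂ν :=
    Measurable.lintegral_prod_right' (f := fun z => Function.uncurry K z * h z.2)
      (hK.mul (hhm.comp measurable_snd))
  calc _ ≤ ∫⁻ t in S, ∫⁻ x in Hp, pw γ (t, x) * (∫⁻ y', K (t, x) y' * h y' ∂ν) ^ p := by
        refine setLIntegral_mono' hS fun t ht => ?_
        refine setLIntegral_mono' hHp fun x hx => ?_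
        rw [← houter (t, x) (ne_of_gt hx)]
        simp only [hpw] at hinner ⊢
        rw [abs_of_pos hx]
        have := hinner t ht x hx
        rw [abs_of_pos hx] at this
        gcongr
    _ = ∫⁻ y, pw γ y * (∫⁻ y', K y y' * h y' ∂ν) ^ p ∂μ :=
        (lintegral_prod _ ((hpwm _).mul (hKh.pow_const _)).aemeasurable).symm
    _ ≤ ENNReal.ofReal A ^ (p / q) * ∫⁻ y', ENNReal.ofReal B * (pw γ y' * h y' ^ p) ∂ν := key
    _ = ENNReal.ofReal (A ^ (p / q) * B) *
          ∫⁻ y, pw (γ - α * p / 2) y * g y.1 y.2 ^ p ∂ν := by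
        rw [lintegral_const_mul' _ _ ENNReal.ofReal_ne_top, ← mul_assoc,
          ENNReal.ofReal_rpow_of_pos hA0, ← ENNReal.ofReal_mul (by positivity)]
        congr 1
        refine lintegral_congr_ae ?_
        filter_upwards [hνmem] with y hy
        simp only [hh]
        rw [ENNReal.mul_rpow_of_nonneg _ _ hp0.le, ← mul_assoc, hpw_rpow _ _ _ hy.ne,
          hpw_mul _ _ _ hy.ne]
        congr 2
        ring
    _ = _ := congrArg _ (lintegral_prod (fun y => pw (γ - α * p / 2) y * g y.1 y.2 ^ p)
        ((hpwm _).mul (hg'.pow_const _)).aemeasurable)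
end

section
/- Let d ≥ 1 be an integer, α ∈ (0,2), p ∈ (1,∞), and θ ∈ (d-1, d-1+p). Then there exists a constant C = C(d,p,α,θ) > 0 such that for every u ∈ C_c^∞(ℝ^d) whose support is a compact subset of the open half space ℝ^d_+ = {x : x¹ > 0}, and for the function w : ℝ^d → ℝ defined by the (existing) principal value limits w(x) = lim_{ε→0+} ∫_{{y : |y| > ε}} (u(x+y) - u(x)) · |y|^{-d-α} dy, one has ∫_{ℝ^d_+} (x¹)^{θ-d-αp/2} |u(x)|^p dx ≤ C ∫_{ℝ^d_+} (x¹)^{θ-d+αp/2} |w(x)|^p dx. -/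
open MeasureTheory Filter Topology ENNReal

/-- The fundamental theorem of calculus for a nonnegative derivative, as a lower integral. -/
lemma lintegral_Ioo_eq_ofReal_sub {F f : ℝ → ℝ} {a b : ℝ} (hab : a ≤ b)
    (hF : ContinuousOn F (Set.Icc a b)) (hd : ∀ x ∈ Set.Ioo a b, HasDerivAt F (f x) x)
    (hf : ∀ x ∈ Set.Ioo a b, 0 ≤ f x) :
    ∫⁻ x in Set.Ioo a b, ENNReal.ofReal (f x) = ENNReal.ofReal (F b - F a) := by
  have hi := intervalIntegral.integrableOn_deriv_of_nonneg hF hd hf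
  have h1 := intervalIntegral.integral_eq_sub_of_hasDerivAt_of_le hab hF hd
    ((intervalIntegrable_iff_integrableOn_Ioc_of_le hab).2 hi)
  rw [← h1, intervalIntegral.integral_of_le hab, integral_Ioc_eq_integral_Ioo,
    ofReal_integral_eq_lintegral_ofReal (hi.mono_set Set.Ioo_subset_Ioc_self)]
  filter_upwards [ae_restrict_mem measurableSet_Ioo] with x hx using hf x hx

lemma lintegral_Ioo_zero_eq {a b : ℝ} (ha : 0 < a) (hb : b ∈ Set.Ioo (0 : ℝ) 1) :
    ∫⁻ y in Set.Ioo 0 b, ENNReal.ofReal ((y ^ a + y ^ (a - 1)) * (1 - y) ^ (-1 - 2 * a)) =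
      ENNReal.ofReal (a⁻¹ * b ^ a * (1 - b) ^ (-(2 * a))) := by
  have h := lintegral_Ioo_eq_ofReal_sub (F := fun y => a⁻¹ * y ^ a * (1 - y) ^ (-(2 * a)))
    (f := fun y => (y ^ a + y ^ (a - 1)) * (1 - y) ^ (-1 - 2 * a)) hb.1.le ?_ ?_ ?_
  · rw [h, Real.zero_rpow ha.ne']; simp
  · intro x hx
    have : (1 : ℝ) - x ≠ 0 := by linarith [hx.2, hb.2]
    exact ((continuousAt_const.mul (Real.continuousAt_rpow_const x a (Or.inr ha.le))).mul
      ((continuousAt_const.sub continuousAt_id).rpow_const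
        (Or.inl this))).continuousWithinAt
  · intro x hx
    have hx0 : 0 < x := hx.1
    have hx1 : 0 < 1 - x := by linarith [hx.2, hb.2]
    have h1 := ((Real.hasDerivAt_rpow_const (p := a) (Or.inl hx0.ne')).const_mul a⁻¹).mul
      (((hasDerivAt_id x).const_sub 1).rpow_const (p := -(2 * a)) (Or.inl hx1.ne'))
    refine h1.congr_deriv ?_
    simp only [id]
    rw [show -(2 * a) = (-1 - 2 * a) + 1 by ring, Real.rpow_add_one hx1.ne',
      show a = (a - 1) + 1 by ring, Real.rpow_add_one hx0.ne']
    simp only [sub_add_cancel]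
    rw [show (-1 - 2 * a + 1 - 1) = -1 - 2 * a by ring]
    field_simp
    ring
  · intro x hx
    have hx1 : 0 < 1 - x := by linarith [hx.2, hb.2]
    have := hx.1
    positivity

lemma lintegral_Ioo_rpow_mul_one_sub_rpow {a b c : ℝ} (ha : 0 < a) (hb : 0 < b) (hbc : b ≤ c)
    (hc : c < 1) :
    ∫⁻ y in Set.Ioo b c, ENNReal.ofReal (y ^ (a - 1) * (1 - y) ^ (-1 - a)) =
      ENNReal.ofReal (a⁻¹ * c ^ a * (1 - c) ^ (-a) - a⁻¹ * b ^ a * (1 - b) ^ (-a)) := by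
  have h := lintegral_Ioo_eq_ofReal_sub (F := fun y => a⁻¹ * y ^ a * (1 - y) ^ (-a))
    (f := fun y => y ^ (a - 1) * (1 - y) ^ (-1 - a)) hbc ?_ ?_ ?_
  · rw [h]
  · intro x hx
    have : (1 : ℝ) - x ≠ 0 := by linarith [hx.2]
    exact ((continuousAt_const.mul (Real.continuousAt_rpow_const x a (Or.inr ha.le))).mul
      ((continuousAt_const.sub continuousAt_id).rpow_const
        (Or.inl this))).continuousWithinAt
  · intro x hx
    have hx0 : 0 < x := hb.trans hx.1
    have hx1 : 0 < 1 - x := by linarith [hx.2]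
    have h1 := ((Real.hasDerivAt_rpow_const (p := a) (Or.inl hx0.ne')).const_mul a⁻¹).mul
      (((hasDerivAt_id x).const_sub 1).rpow_const (p := -a) (Or.inl hx1.ne'))
    refine h1.congr_deriv ?_
    simp only [id]
    rw [show -a = (-1 - a) + 1 by ring, Real.rpow_add_one hx1.ne',
      show a = (a - 1) + 1 by ring, Real.rpow_add_one hx0.ne']
    simp only [sub_add_cancel]
    rw [show (-1 - a + 1 - 1) = -1 - a by ring]
    field_simp
    ring
  · intro x hx
    have hx1 : 0 < 1 - x := by linarith [hx.2]
    have := hb.trans hx.1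
    positivity

lemma lintegral_Ioi_one_add_rpow (s α : ℝ) {δ : ℝ} (hδ : 0 < δ) :
    ∫⁻ t in Set.Ioi δ, ENNReal.ofReal ((1 + t) ^ s * t ^ (-1 - α)) =
      ∫⁻ y in Set.Ioo 0 (1 + δ)⁻¹, ENNReal.ofReal (y ^ (α - 1 - s) * (1 - y) ^ (-1 - α)) := by
  have him : (fun y : ℝ => y⁻¹ - 1) '' Set.Ioo 0 (1 + δ)⁻¹ = Set.Ioi δ := by
    ext t
    simp only [Set.mem_image, Set.mem_Ioo, Set.mem_Ioi]
    constructor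
    · rintro ⟨y, ⟨h0, h1⟩, rfl⟩
      have := (lt_inv_comm₀ h0 (by positivity)).1 h1
      linarith
    · intro ht
      have h1 : 0 < 1 + t := by linarith
      refine ⟨(1 + t)⁻¹, ⟨by positivity, ?_⟩, by simp⟩
      exact inv_strictAnti₀ (by positivity) (by linarith)
  rw [← him, lintegral_image_eq_lintegral_abs_deriv_mul (f' := fun y => -(y ^ 2)⁻¹)
    measurableSet_Ioo]
  · refine setLIntegral_congr_fun measurableSet_Ioo fun y hy => ?_
    have h0 : 0 < y := hy.1
    have h1 : 0 < 1 - y := by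
      have : (1 + δ)⁻¹ < 1 := inv_lt_one_of_one_lt₀ (by linarith)
      linarith [hy.2]
    rw [← ENNReal.ofReal_mul (abs_nonneg _), abs_neg, abs_of_nonneg (by positivity),
      show 1 + (y⁻¹ - 1) = y⁻¹ by ring, show y⁻¹ - 1 = (1 - y) * y⁻¹ by field_simp,
      Real.mul_rpow h1.le (by positivity), Real.inv_rpow h0.le, Real.inv_rpow h0.le,
      ← Real.rpow_neg h0.le, ← Real.rpow_neg h0.le, ← Real.rpow_natCast, ← Real.rpow_neg h0.le,
      show α - 1 - s = -((2 : ℕ) : ℝ) + -s + -(-1 - α) by push_cast; ring,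
      Real.rpow_add h0, Real.rpow_add h0]
    congr 1
    ring
  · intro x hx
    have := (hasDerivAt_inv hx.1.ne').sub_const 1
    exact this.hasDerivWithinAt
  · intro x _ y _ h
    simpa using h

lemma lintegral_Ioo_one_sub_rpow (s α δ : ℝ) :
    ∫⁻ t in Set.Ioo δ 1, ENNReal.ofReal ((1 - t) ^ s * t ^ (-1 - α)) =
      ∫⁻ y in Set.Ioo 0 (1 - δ), ENNReal.ofReal (y ^ s * (1 - y) ^ (-1 - α)) := by
  have him : (fun y : ℝ => 1 - y) '' Set.Ioo 0 (1 - δ) = Set.Ioo δ 1 := by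
    simp
  rw [← him, lintegral_image_eq_lintegral_abs_deriv_mul (f' := fun y => -1)
    measurableSet_Ioo]
  · simp
  · intro x hx
    exact ((hasDerivAt_id x).const_sub 1).hasDerivWithinAt
  · intro x _ y _ h
    simpa using h

lemma exists_truncated_rpow_estimate {α s : ℝ} (hα : α ∈ Set.Ioo (0 : ℝ) 2)
    (hs : s ∈ Set.Ioo (α / 2 - 1) (α / 2)) :
    ∃ c δ₀ : ℝ, 0 < c ∧ 0 < δ₀ ∧ δ₀ < 1 ∧ ∀ δ ∈ Set.Ioo 0 δ₀,
      (∫⁻ t in Set.Ioi δ, ENNReal.ofReal ((1 + t) ^ s * t ^ (-1 - α))) +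
        (∫⁻ t in Set.Ioo δ 1, ENNReal.ofReal ((1 - t) ^ s * t ^ (-1 - α))) +
        ENNReal.ofReal c ≤ ENNReal.ofReal (2 * α⁻¹ * δ ^ (-α)) := by
  obtain ⟨hα0, hα2⟩ := hα
  obtain ⟨hs1, hs2⟩ := hs
  set P : ℝ → ℝ := fun y => y ^ (α / 2 - 1) * (1 - y ^ (s - α / 2 + 1)) * (1 - y ^ (α / 2 - s)) *
    (1 - y) ^ (-1 - α) with hP
  have hPpos : ∀ y ∈ Set.Ioo (0 : ℝ) 1, 0 < P y := by
    intro y hy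
    have h0 := hy.1
    have h1 : 0 < 1 - y := by linarith [hy.2]
    have h2 : y ^ (s - α / 2 + 1) < 1 := Real.rpow_lt_one h0.le hy.2 (by linarith)
    have h3 : y ^ (α / 2 - s) < 1 := Real.rpow_lt_one h0.le hy.2 (by linarith)
    have h4 : 0 < 1 - y ^ (s - α / 2 + 1) := by linarith
    have h5 : 0 < 1 - y ^ (α / 2 - s) := by linarith
    simp only [hP]
    positivity
  have hPm : Measurable P := by fun_prop
  have hsum : ∀ y ∈ Set.Ioo (0 : ℝ) 1, y ^ s * (1 - y) ^ (-1 - α) +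
      y ^ (α - 1 - s) * (1 - y) ^ (-1 - α) + P y =
      (y ^ (α / 2) + y ^ (α / 2 - 1)) * (1 - y) ^ (-1 - 2 * (α / 2)) := by
    intro y hy
    have h0 := hy.1
    have e1 : y ^ s = y ^ (α / 2 - 1) * y ^ (s - α / 2 + 1) := by
      rw [← Real.rpow_add h0]; ring_nf
    have e2 : y ^ (α - 1 - s) = y ^ (α / 2 - 1) * y ^ (α / 2 - s) := by
      rw [← Real.rpow_add h0]; ring_nf
    have e3 : y ^ (α / 2) = y ^ (α / 2 - 1) * (y ^ (s - α / 2 + 1) * y ^ (α / 2 - s)) := by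
      rw [← Real.rpow_add h0, ← Real.rpow_add h0]; ring_nf
    have e4 : -1 - 2 * (α / 2) = -1 - α := by ring
    simp only [hP]
    rw [e1, e2, e3, e4]
    ring
  set J := ∫⁻ y in Set.Ioo (0 : ℝ) (1 / 2), ENNReal.ofReal (P y) with hJ
  have hJpos : 0 < J := by
    rw [hJ, setLIntegral_pos_iff (by fun_prop)]
    have : Function.support (fun y => ENNReal.ofReal (P y)) ∩ Set.Ioo (0 : ℝ) (1 / 2) =
        Set.Ioo (0 : ℝ) (1 / 2) := by
      refine Set.inter_eq_right.2 fun y hy => ?_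
      have := hPpos y ⟨hy.1, by linarith [hy.2]⟩
      simpa using this
    rw [this]
    simp
  obtain ⟨c', hc'0, hc'J⟩ : ∃ c' : ℝ, 0 < c' ∧ ENNReal.ofReal c' ≤ J := by
    obtain ⟨r, hr0, hr⟩ := ENNReal.lt_iff_exists_nnreal_btwn.1 hJpos
    exact ⟨r, by simpa using hr0, by simpa using hr.le⟩
  set c := c' / 2 with hc
  have hc0 : 0 < c := by positivity
  refine ⟨c, min (1 / 2) ((α * c / 4) ^ (1 / (2 - α))), hc0, ?_, ?_, ?_⟩
  · have : 0 < α * c / 4 := by positivity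
    positivity
  · exact (min_le_left _ _).trans_lt (by norm_num)
  rintro δ ⟨hδ0, hδ⟩
  have hδ1 : δ < 1 / 2 := hδ.trans_le (min_le_left _ _)
  have hδ2 : δ ^ (2 - α) ≤ α * c / 4 := by
    have h := (hδ.trans_le (min_le_right _ _)).le
    calc δ ^ (2 - α) ≤ ((α * c / 4) ^ (1 / (2 - α))) ^ (2 - α) :=
          Real.rpow_le_rpow hδ0.le h (by linarith)
      _ = α * c / 4 := by
          rw [← Real.rpow_mul (by positivity), one_div, inv_mul_cancel₀ (by linarith),
            Real.rpow_one]
  rw [lintegral_Ioi_one_add_rpow s α hδ0, lintegral_Ioo_one_sub_rpow s α δ]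
  have hb0 : 0 < 1 - δ := by linarith
  have hbc : 1 - δ ≤ (1 + δ)⁻¹ := by
    rw [le_inv_comm₀ hb0 (by linarith), ← one_div, le_div_iff₀ hb0]
    nlinarith
  have hc1 : (1 + δ)⁻¹ < 1 := inv_lt_one_of_one_lt₀ (by linarith)
  set g : ℝ → ℝ≥0∞ := fun y => ENNReal.ofReal (y ^ (α - 1 - s) * (1 - y) ^ (-1 - α)) with hg
  set A := (α / 2)⁻¹ * (1 - δ) ^ (α / 2) * δ ^ (-α) with hA
  set B := (1 - δ)⁻¹ * (α⁻¹ * δ ^ (-α) - α⁻¹ * (1 - δ) ^ α * δ ^ (-α)) with hB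
  have hsplit : ∫⁻ y in Set.Ioo 0 (1 + δ)⁻¹, g y ≤
      (∫⁻ y in Set.Ioo 0 (1 - δ), g y) + ∫⁻ y in Set.Ioo (1 - δ) (1 + δ)⁻¹, g y := by
    rw [setLIntegral_congr (Ioo_ae_eq_Ico (a := 1 - δ) (b := (1 + δ)⁻¹)),
      ← Set.Ioo_union_Ico_eq_Ioo hb0 hbc]
    exact lintegral_union_le _ _ _
  have herr : ∫⁻ y in Set.Ioo (1 - δ) (1 + δ)⁻¹, g y ≤ ENNReal.ofReal B := by
    have h := lintegral_Ioo_rpow_mul_one_sub_rpow hα0 hb0 hbc hc1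
    have e : (1 + δ)⁻¹ ^ α * (1 - (1 + δ)⁻¹) ^ (-α) = δ ^ (-α) := by
      have : 1 - (1 + δ)⁻¹ = δ * (1 + δ)⁻¹ := by field_simp; ring
      have h1 : 0 < (1 + δ)⁻¹ := by positivity
      rw [this, Real.mul_rpow hδ0.le h1.le, mul_left_comm, ← Real.rpow_add h1]
      simp
    rw [mul_assoc, e, _root_.sub_sub_cancel] at h
    rw [hB, ENNReal.ofReal_mul (by positivity), ← h, ← lintegral_const_mul _ (by fun_prop)]
    refine setLIntegral_mono (by fun_prop) fun y hy => ?_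
    have hy0 : 0 < y := hb0.trans hy.1
    have hy1 : 0 < 1 - y := by linarith [hy.2]
    rw [hg, ← ENNReal.ofReal_mul (by positivity), ← mul_assoc]
    refine ENNReal.ofReal_le_ofReal (mul_le_mul_of_nonneg_right ?_ (by positivity))
    rw [show α - 1 - s = -s + (α - 1) by ring, Real.rpow_add hy0]
    refine mul_le_mul_of_nonneg_right ?_ (by positivity)
    calc y ^ (-s) ≤ y ^ (-1 : ℝ) :=
          Real.rpow_le_rpow_of_exponent_ge hy0 (by linarith) (by linarith)
      _ = y⁻¹ := Real.rpow_neg_one y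
      _ ≤ (1 - δ)⁻¹ := inv_anti₀ hb0 hy.1.le
  have hmain : (∫⁻ y in Set.Ioo 0 (1 - δ), ENNReal.ofReal (y ^ s * (1 - y) ^ (-1 - α))) +
      (∫⁻ y in Set.Ioo 0 (1 - δ), g y) + ENNReal.ofReal c' ≤ ENNReal.ofReal A := by
    have h := lintegral_Ioo_zero_eq (a := α / 2) (by linarith) ⟨hb0, by linarith⟩
    rw [show -(2 * (α / 2)) = -α by ring, _root_.sub_sub_cancel] at h
    rw [hA, ← h]
    calc _ ≤ (∫⁻ y in Set.Ioo 0 (1 - δ), ENNReal.ofReal (y ^ s * (1 - y) ^ (-1 - α))) +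
          (∫⁻ y in Set.Ioo 0 (1 - δ), g y) + ∫⁻ y in Set.Ioo 0 (1 - δ), ENNReal.ofReal (P y) := by
          gcongr
          refine hc'J.trans (lintegral_mono_set (Set.Ioo_subset_Ioo_right (by linarith)))
      _ = ∫⁻ y in Set.Ioo 0 (1 - δ), (ENNReal.ofReal (y ^ s * (1 - y) ^ (-1 - α)) + g y +
            ENNReal.ofReal (P y)) := by
          rw [lintegral_add_right _ (by fun_prop), lintegral_add_right _ (by fun_prop)]
      _ ≤ _ := by
          refine setLIntegral_mono (by fun_prop) fun y hy => ?_
          have hy' : y ∈ Set.Ioo (0 : ℝ) 1 := ⟨hy.1, by linarith [hy.2]⟩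
          have hy0 : 0 < y := hy.1
          have hy1 : 0 < 1 - y := by linarith [hy'.2]
          rw [hg, ← ENNReal.ofReal_add (by positivity) (by positivity),
            ← ENNReal.ofReal_add (by positivity) (hPpos y hy').le, hsum y hy']
  have hreal : A + B ≤ 2 * α⁻¹ * δ ^ (-α) + c := by
    have hq2 : (1 - δ) ^ α = ((1 - δ) ^ (α / 2)) ^ 2 := by
      rw [← Real.rpow_natCast, ← Real.rpow_mul hb0.le]; norm_num
    have hq : 1 - 2 * δ ≤ (1 - δ) ^ α := by
      have : (1 - δ) ^ (2 : ℝ) ≤ (1 - δ) ^ α :=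
        Real.rpow_le_rpow_of_exponent_ge hb0 (by linarith) hα2.le
      rw [Real.rpow_two] at this
      nlinarith
    have hd : δ ^ (2 - α) = δ ^ 2 * δ ^ (-α) := by
      rw [sub_eq_add_neg, Real.rpow_add hδ0, Real.rpow_two]
    have hinv : (1 - δ)⁻¹ ≤ 1 + 2 * δ := by
      rw [← one_div, div_le_iff₀ hb0]; nlinarith
    set q := (1 - δ) ^ (α / 2)
    set k := α⁻¹ * δ ^ (-α) with hk
    have hk0 : 0 < k := by positivity
    have hkc : 4 * δ ^ 2 * k ≤ c := by
      have : 4 * δ ^ 2 * k = 4 * α⁻¹ * δ ^ (2 - α) := by rw [hd, hk]; ring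
      rw [this]
      calc 4 * α⁻¹ * δ ^ (2 - α) ≤ 4 * α⁻¹ * (α * c / 4) := by gcongr
        _ = c := by field_simp
    have hA' : A = 2 * q * k := by rw [hA, hk]; field_simp
    have hB' : B = (1 - δ)⁻¹ * (1 - q ^ 2) * k := by rw [hB, hk, hq2]; ring
    rw [hq2] at hq
    have hq1 : q ≤ 1 := Real.rpow_le_one hb0.le (by linarith) (by linarith)
    have hq0 : 0 < q := by positivity
    have h1 : (1 - δ)⁻¹ * (1 - q ^ 2) ≤ (1 + 2 * δ) * (1 - q ^ 2) := by
      gcongr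
      nlinarith
    have h2 : 2 * q + (1 - δ)⁻¹ * (1 - q ^ 2) ≤ 2 + 4 * δ ^ 2 := by nlinarith [sq_nonneg (1 - q)]
    rw [hA', hB']
    calc 2 * q * k + (1 - δ)⁻¹ * (1 - q ^ 2) * k = (2 * q + (1 - δ)⁻¹ * (1 - q ^ 2)) * k := by ring
      _ ≤ (2 + 4 * δ ^ 2) * k := by gcongr
      _ ≤ 2 * α⁻¹ * δ ^ (-α) + c := by
        have : 2 * k = 2 * α⁻¹ * δ ^ (-α) := by rw [hk]; ring
        linarith
  have hA0 : 0 ≤ A := by positivity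
  have hB0 : 0 ≤ B := by
    have : (1 - δ) ^ α ≤ 1 := Real.rpow_le_one hb0.le (by linarith) hα0.le
    have h2 : 0 ≤ α⁻¹ * δ ^ (-α) := by positivity
    refine mul_nonneg (by positivity) ?_
    nlinarith
  refine (ENNReal.add_le_add_iff_right (ENNReal.ofReal_ne_top (r := c))).1 ?_
  rw [← ENNReal.ofReal_add (by positivity) hc0.le]
  refine le_trans ?_ (ENNReal.ofReal_le_ofReal hreal)
  rw [ENNReal.ofReal_add hA0 hB0, add_assoc _ (ENNReal.ofReal c),
    ← ENNReal.ofReal_add hc0.le hc0.le,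
    show c + c = c' by rw [hc]; ring]
  refine le_trans ?_ (add_le_add hmain herr)
  refine (add_le_add_left (add_le_add_left hsplit _) _).trans (le_of_eq ?_)
  ring

/-- The power function `x ↦ x₊ ^ s`, extended by zero to the half line `x ≤ 0`. -/
noncomputable def posRpow (s x : ℝ) : ℝ≥0∞ := if 0 < x then ENNReal.ofReal (x ^ s) else 0

@[fun_prop]
lemma measurable_posRpow (s : ℝ) : Measurable (posRpow s) :=
  Measurable.ite measurableSet_Ioi (by fun_prop) measurable_const

lemma posRpow_of_pos {s x : ℝ} (hx : 0 < x) : posRpow s x = ENNReal.ofReal (x ^ s) := if_pos hx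

lemma posRpow_of_nonpos {s x : ℝ} (hx : x ≤ 0) : posRpow s x = 0 := if_neg hx.not_gt

lemma posRpow_mul {s x y : ℝ} (hx : 0 < x) :
    posRpow s (x * y) = ENNReal.ofReal (x ^ s) * posRpow s y := by
  by_cases hy : 0 < y
  · rw [posRpow_of_pos (mul_pos hx hy), posRpow_of_pos hy, Real.mul_rpow hx.le hy.le,
      ENNReal.ofReal_mul (by positivity)]
  · rw [posRpow_of_nonpos (not_lt.1 hy), mul_zero,
      posRpow_of_nonpos (mul_nonpos_of_nonneg_of_nonpos hx.le (not_lt.1 hy))]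

lemma lintegral_Ioi_comp_mul_left {c : ℝ} (hc : 0 < c) (a : ℝ) (f : ℝ → ℝ≥0∞) :
    ∫⁻ t in Set.Ioi (c * a), f t = ENNReal.ofReal c * ∫⁻ t in Set.Ioi a, f (c * t) := by
  have him : (fun y : ℝ => c * y) '' Set.Ioi a = Set.Ioi (c * a) := by
    rw [Set.image_mul_left_Ioi hc]
  rw [← him, lintegral_image_eq_lintegral_abs_deriv_mul (f' := fun _ => c) measurableSet_Ioi]
  · rw [abs_of_pos hc, lintegral_const_mul' _ _ ENNReal.ofReal_ne_top]
  · intro x _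
    simpa using ((hasDerivAt_id x).const_mul c).hasDerivWithinAt
  · intro x _ y _ h
    simpa [hc.ne'] using h

lemma lintegral_Ioi_rpow {α ε : ℝ} (hα : 0 < α) (hε : 0 < ε) :
    ∫⁻ t in Set.Ioi ε, ENNReal.ofReal (t ^ (-1 - α)) = ENNReal.ofReal (α⁻¹ * ε ^ (-α)) := by
  rw [← ofReal_integral_eq_lintegral_ofReal
    (integrableOn_Ioi_rpow_of_lt (by linarith) hε), integral_Ioi_rpow_of_lt (by linarith) hε]
  · congr 1
    rw [show -1 - α + 1 = -α by ring]
    field_simp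
  · filter_upwards [ae_restrict_mem measurableSet_Ioi] with t ht
    have : 0 < t := hε.trans ht
    simp only [Pi.zero_apply]
    positivity

lemma exists_truncated_posRpow_estimate {α s : ℝ} (hα : α ∈ Set.Ioo (0 : ℝ) 2)
    (hs : s ∈ Set.Ioo (α / 2 - 1) (α / 2)) :
    ∃ c δ₀ : ℝ, 0 < c ∧ 0 < δ₀ ∧ ∀ x l ε : ℝ, 0 < x → |l| ≤ 1 → ε ∈ Set.Ioo 0 (δ₀ * x) →
      (∫⁻ t in Set.Ioi ε, (posRpow s (x + l * t) + posRpow s (x - l * t)) *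
          ENNReal.ofReal (t ^ (-1 - α))) + ENNReal.ofReal (c * |l| ^ α * x ^ (s - α)) ≤
        2 * posRpow s x * ∫⁻ t in Set.Ioi ε, ENNReal.ofReal (t ^ (-1 - α)) := by
  obtain ⟨c, δ₀, hc, hδ₀, hδ₀1, H⟩ := exists_truncated_rpow_estimate hα hs
  refine ⟨c, δ₀, hc, hδ₀, fun x l ε hx hl hε => ?_⟩
  wlog hl0 : 0 ≤ l generalizing l
  · have h := this (-l) (by simpa using hl) (by linarith)
    rw [abs_neg] at h
    refine le_trans (le_of_eq ?_) h
    congr 2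
    funext t
    rw [neg_mul, sub_neg_eq_add, ← sub_eq_add_neg, add_comm (posRpow s (x + l * t))]
  rcases hl0.eq_or_lt with rfl | hlpos
  · simp only [zero_mul, add_zero, sub_zero, abs_zero, Real.zero_rpow hα.1.ne', mul_zero,
      ENNReal.ofReal_zero]
    rw [lintegral_const_mul _ (by fun_prop), two_mul]
  rw [abs_of_pos hlpos] at hl ⊢
  have hε0 := hε.1
  set δ := ε * l / x with hδ
  have hδ0 : 0 < δ := by positivity
  have hδ1 : δ < δ₀ := by
    rw [hδ, div_lt_iff₀ hx]
    calc ε * l ≤ ε * 1 := by gcongr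
      _ < δ₀ * x := by linarith [hε.2]
  have hεδ : ε = x / l * δ := by rw [hδ]; field_simp
  have hxl : 0 < x / l := by positivity
  have key := H δ ⟨hδ0, hδ1⟩
  have h1 : ∫⁻ t in Set.Ioi ε, (posRpow s (x + l * t) + posRpow s (x - l * t)) *
      ENNReal.ofReal (t ^ (-1 - α)) = ENNReal.ofReal (x ^ s * (x / l) ^ (-α)) *
        ∫⁻ t in Set.Ioi δ, (posRpow s (1 + t) + posRpow s (1 - t)) *
          ENNReal.ofReal (t ^ (-1 - α)) := by
    rw [hεδ, lintegral_Ioi_comp_mul_left hxl, ← lintegral_const_mul' _ _ ENNReal.ofReal_ne_top,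
      ← lintegral_const_mul' _ _ ENNReal.ofReal_ne_top]
    refine setLIntegral_congr_fun measurableSet_Ioi fun t ht => ?_
    have ht0 : 0 < t := hδ0.trans ht
    have e1 : x + l * (x / l * t) = x * (1 + t) := by field_simp
    have e2 : x - l * (x / l * t) = x * (1 - t) := by field_simp
    have e3 : (x / l) ^ (-α) = (x / l) * (x / l) ^ (-1 - α) := by
      rw [show -α = 1 + (-1 - α) by ring, Real.rpow_add hxl, Real.rpow_one]
    rw [e1, e2, e3, posRpow_mul hx, posRpow_mul hx, Real.mul_rpow hxl.le ht0.le,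
      ENNReal.ofReal_mul (by positivity), ENNReal.ofReal_mul (by positivity),
      ENNReal.ofReal_mul (by positivity)]
    ring
  have h2 : ∫⁻ t in Set.Ioi δ, (posRpow s (1 + t) + posRpow s (1 - t)) *
      ENNReal.ofReal (t ^ (-1 - α)) =
      (∫⁻ t in Set.Ioi δ, ENNReal.ofReal ((1 + t) ^ s * t ^ (-1 - α))) +
        (∫⁻ t in Set.Ioo δ 1, ENNReal.ofReal ((1 - t) ^ s * t ^ (-1 - α))) := by
    have : Set.Ioo δ 1 = Set.Iio 1 ∩ Set.Ioi δ := by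
      ext; simp [and_comm]
    rw [this, ← Measure.restrict_restrict measurableSet_Iio,
      ← lintegral_indicator measurableSet_Iio, ← lintegral_add_left (by fun_prop)]
    refine setLIntegral_congr_fun measurableSet_Ioi fun t ht => ?_
    have ht0 : 0 < t := hδ0.trans ht
    rw [posRpow_of_pos (by linarith : 0 < 1 + t), add_mul, ENNReal.ofReal_mul (by positivity)]
    congr 1
    by_cases h : t < 1
    · have h' : 0 < 1 - t := by linarith
      rw [Set.indicator_of_mem (by exact h), posRpow_of_pos h', ENNReal.ofReal_mul (by positivity)]
    · rw [Set.indicator_of_notMem (by exact h), posRpow_of_nonpos (by linarith), zero_mul]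
  have h3 : c * l ^ α * x ^ (s - α) = x ^ s * (x / l) ^ (-α) * c := by
    rw [Real.rpow_neg hxl.le, Real.div_rpow hx.le hlpos.le, Real.rpow_sub hx]
    field_simp
  rw [h1, h2, h3, lintegral_Ioi_rpow hα.1 hε0, posRpow_of_pos hx, hεδ,
    Real.mul_rpow hxl.le hδ0.le, ENNReal.ofReal_mul (q := c) (by positivity), ← mul_add]
  refine (mul_le_mul_right key _).trans (le_of_eq ?_)
  have h2' : (2 : ℝ≥0∞) = ENNReal.ofReal 2 := by simp
  rw [h2', ← ENNReal.ofReal_mul (by positivity), ← ENNReal.ofReal_mul (by positivity),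
    ← ENNReal.ofReal_mul (by positivity)]
  congr 1
  ring

lemma lintegral_eq_lintegral_toSphere {E : Type*} [NormedAddCommGroup E] [NormedSpace ℝ E]
    [MeasurableSpace E] [BorelSpace E] [FiniteDimensional ℝ E] [Nontrivial E]
    (μ : Measure E) [μ.IsAddHaarMeasure] {f : E → ℝ≥0∞} (hf : Measurable f) :
    ∫⁻ x, f x ∂μ = ∫⁻ ω, ∫⁻ r in Set.Ioi (0 : ℝ),
      ENNReal.ofReal (r ^ (Module.finrank ℝ E - 1)) * f (r • (ω : E)) ∂volume ∂μ.toSphere := by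
  have hmp := μ.measurePreserving_homeomorphUnitSphereProd
  have h1 : ∫⁻ x, f x ∂μ = ∫⁻ x : ({(0 : E)}ᶜ : Set E), f x ∂(μ.comap (↑)) := by
    rw [lintegral_subtype_comap (measurableSet_singleton _).compl, restrict_compl_singleton]
  have h2 : ∫⁻ x : ({(0 : E)}ᶜ : Set E), f x ∂(μ.comap (↑)) =
      ∫⁻ z, f ((z.2 : ℝ) • (z.1 : E))
        ∂(μ.toSphere.prod (.volumeIoiPow (Module.finrank ℝ E - 1))) := by
    rw [← hmp.lintegral_comp (by fun_prop)]
    refine lintegral_congr fun x => ?_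
    congr 1
    have hx : ‖(x : E)‖ ≠ 0 := norm_ne_zero_iff.2 x.2
    simp [homeomorphUnitSphereProd, smul_smul, hx]
  rw [h1, h2, lintegral_prod _ (by fun_prop)]
  refine lintegral_congr fun ω => ?_
  rw [Measure.volumeIoiPow, lintegral_withDensity_eq_lintegral_mul _ (by fun_prop) (by fun_prop),
    ← lintegral_subtype_comap measurableSet_Ioi]
  rfl

lemma setLIntegral_norm_lt_eq {d : ℕ} [NeZero d] (α ε : ℝ) (hε : 0 < ε)
    {f : EuclideanSpace ℝ (Fin d) → ℝ≥0∞} (hf : Measurable f) :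
    ∫⁻ z in {z : EuclideanSpace ℝ (Fin d) | ε < ‖z‖},
        f z * ENNReal.ofReal (‖z‖ ^ (-(d : ℝ) - α)) =
      ∫⁻ ω, ∫⁻ r in Set.Ioi ε, f (r • (ω : EuclideanSpace ℝ (Fin d))) *
        ENNReal.ofReal (r ^ (-1 - α)) ∂volume
        ∂(volume : Measure (EuclideanSpace ℝ (Fin d))).toSphere := by
  have hd : 1 ≤ d := Nat.one_le_iff_ne_zero.2 (NeZero.ne d)
  have : Nonempty (Fin d) := ⟨0⟩
  have hS : MeasurableSet {z : EuclideanSpace ℝ (Fin d) | ε < ‖z‖} :=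
    measurableSet_lt measurable_const measurable_norm
  rw [← lintegral_indicator hS, lintegral_eq_lintegral_toSphere _
    (Measurable.indicator (by fun_prop) hS)]
  refine lintegral_congr fun ω => ?_
  have hω : ‖(ω : EuclideanSpace ℝ (Fin d))‖ = 1 := by simp
  have hsub : Set.Ioi ε ⊆ Set.Ioi 0 := Set.Ioi_subset_Ioi hε.le
  have hres : (volume : Measure ℝ).restrict (Set.Ioi ε) =
      (volume.restrict (Set.Ioi 0)).restrict (Set.Ioi ε) := by
    rw [Measure.restrict_restrict measurableSet_Ioi, Set.inter_eq_left.2 hsub]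
  rw [hres, ← lintegral_indicator (s := Set.Ioi ε) measurableSet_Ioi]
  refine setLIntegral_congr_fun measurableSet_Ioi fun r hr => ?_
  have hr0 : 0 < r := hr
  have hn : ‖r • (ω : EuclideanSpace ℝ (Fin d))‖ = r := by
    rw [norm_smul, hω, mul_one, Real.norm_of_nonneg hr0.le]
  by_cases h : ε < r
  · rw [Set.indicator_of_mem (by simpa [hn] using h), Set.indicator_of_mem (by exact h), hn,
      mul_left_comm, ← ENNReal.ofReal_mul (by positivity), finrank_euclideanSpace_fin,
      ← Real.rpow_natCast, ← Real.rpow_add hr0, Nat.cast_sub hd]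
    congr 3
    push_cast
    ring
  · rw [Set.indicator_of_notMem (by simpa [hn] using h), Set.indicator_of_notMem (by exact h),
      mul_zero]

lemma setLIntegral_norm_lt_rpow_ne_top {d : ℕ} [NeZero d] {α ε : ℝ} (hα : 0 < α) (hε : 0 < ε) :
    ∫⁻ z in {z : EuclideanSpace ℝ (Fin d) | ε < ‖z‖},
      ENNReal.ofReal (‖z‖ ^ (-(d : ℝ) - α)) ≠ ∞ := by
  have h := setLIntegral_norm_lt_eq (d := d) α ε hε (f := fun _ => 1) measurable_const
  simp only [one_mul, lintegral_Ioi_rpow hα hε, lintegral_const] at h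
  rw [h]
  exact ENNReal.mul_ne_top ENNReal.ofReal_ne_top (measure_ne_top _ _)

lemma exists_kernel_posRpow_estimate {d : ℕ} [NeZero d] (i : Fin d) {α s : ℝ}
    (hα : α ∈ Set.Ioo (0 : ℝ) 2) (hs : s ∈ Set.Ioo (α / 2 - 1) (α / 2)) :
    ∃ c δ₀ : ℝ, 0 < c ∧ 0 < δ₀ ∧ ∀ x ε : ℝ, 0 < x → ε ∈ Set.Ioo 0 (δ₀ * x) →
      (∫⁻ z in {z : EuclideanSpace ℝ (Fin d) | ε < ‖z‖},
        posRpow s (x + z i) * ENNReal.ofReal (‖z‖ ^ (-(d : ℝ) - α))) +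
          ENNReal.ofReal c * posRpow (s - α) x ≤
        posRpow s x * ∫⁻ z in {z : EuclideanSpace ℝ (Fin d) | ε < ‖z‖},
          ENNReal.ofReal (‖z‖ ^ (-(d : ℝ) - α)) := by
  obtain ⟨c, δ₀, hc, hδ₀, H⟩ := exists_truncated_posRpow_estimate hα hs
  have hcoord : ∀ (ω : Metric.sphere (0 : EuclideanSpace ℝ (Fin d)) 1),
      |(ω : EuclideanSpace ℝ (Fin d)) i| ≤ 1 := fun ω => by
    have h : ‖(ω : EuclideanSpace ℝ (Fin d))‖ = 1 := by simp
    exact (Real.norm_eq_abs _).symm.le.trans ((PiLp.norm_apply_le _ i).trans h.le)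
  set σ := (volume : Measure (EuclideanSpace ℝ (Fin d))).toSphere with hσ
  have hcont : Continuous fun ω : Metric.sphere (0 : EuclideanSpace ℝ (Fin d)) 1 =>
      ENNReal.ofReal (c * |(ω : EuclideanSpace ℝ (Fin d)) i| ^ α) := by
    refine ENNReal.continuous_ofReal.comp (continuous_const.mul
      (Continuous.rpow_const (by fun_prop) fun _ => Or.inr hα.1.le))
  set J := ∫⁻ ω : Metric.sphere (0 : EuclideanSpace ℝ (Fin d)) 1,
      ENNReal.ofReal (c * |(ω : EuclideanSpace ℝ (Fin d)) i| ^ α) ∂σ with hJ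
  have hJpos : 0 < J := by
    rw [hJ, lintegral_pos_iff_support hcont.measurable]
    refine (hcont.isOpen_support).measure_pos σ
      ⟨⟨EuclideanSpace.single i 1, by simp⟩, ?_⟩
    simp [hc]
  obtain ⟨c', hc'0, hc'J⟩ : ∃ c' : ℝ, 0 < c' ∧ ENNReal.ofReal c' ≤ J := by
    obtain ⟨r, hr0, hr⟩ := ENNReal.lt_iff_exists_nnreal_btwn.1 hJpos
    exact ⟨r, by simpa using hr0, by simpa using hr.le⟩
  refine ⟨c' / 2, δ₀, by positivity, hδ₀, fun x ε hx hε => ?_⟩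
  have hε0 := hε.1
  set k : EuclideanSpace ℝ (Fin d) → ℝ≥0∞ := fun z => ENNReal.ofReal (‖z‖ ^ (-(d : ℝ) - α)) with hk
  have hkm : Measurable k := by fun_prop
  have hS : MeasurableSet {z : EuclideanSpace ℝ (Fin d) | ε < ‖z‖} :=
    measurableSet_lt measurable_const measurable_norm
  have hsymm : ∫⁻ z in {z : EuclideanSpace ℝ (Fin d) | ε < ‖z‖}, posRpow s (x - z i) * k z =
      ∫⁻ z in {z : EuclideanSpace ℝ (Fin d) | ε < ‖z‖}, posRpow s (x + z i) * k z := by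
    rw [← lintegral_indicator hS, ← lintegral_indicator hS, ← lintegral_neg_eq_self]
    refine lintegral_congr fun z => ?_
    simp [Set.indicator, hk]
  have hadd : 2 * ∫⁻ z in {z : EuclideanSpace ℝ (Fin d) | ε < ‖z‖}, posRpow s (x + z i) * k z =
      ∫⁻ z in {z : EuclideanSpace ℝ (Fin d) | ε < ‖z‖},
        (posRpow s (x + z i) + posRpow s (x - z i)) * k z := by
    simp_rw [add_mul]
    rw [lintegral_add_left (by fun_prop), hsymm, two_mul]
  have hpol := setLIntegral_norm_lt_eq (d := d) α ε hε0
    (f := fun z => posRpow s (x + z i) + posRpow s (x - z i)) (by fun_prop)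
  have hpol1 := setLIntegral_norm_lt_eq (d := d) α ε hε0 (f := fun _ => 1) measurable_const
  simp only [one_mul] at hpol1
  have hle : (∫⁻ z in {z : EuclideanSpace ℝ (Fin d) | ε < ‖z‖},
      (posRpow s (x + z i) + posRpow s (x - z i)) * k z) + J * posRpow (s - α) x ≤
      2 * posRpow s x * ∫⁻ z in {z : EuclideanSpace ℝ (Fin d) | ε < ‖z‖}, k z := by
    rw [hpol, hpol1, hJ, ← lintegral_mul_const _ hcont.measurable,
      ← lintegral_add_right _ (hcont.measurable.mul_const _),
      ← lintegral_const_mul _ (by fun_prop)]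
    refine lintegral_mono fun ω => ?_
    have h := H x ((ω : EuclideanSpace ℝ (Fin d)) i) ε hx (hcoord ω) hε
    rw [ENNReal.ofReal_mul (by positivity), ← posRpow_of_pos hx] at h
    refine le_trans (le_of_eq ?_) h
    congr 1
    refine lintegral_congr fun r => ?_
    simp [mul_comm r]
  have h2 : (2 : ℝ≥0∞) ≠ 0 := by simp
  have h2' : (2 : ℝ≥0∞) ≠ ∞ := by simp
  refine (ENNReal.mul_le_mul_iff_right h2 h2').1 ?_
  rw [mul_add, hadd, ← mul_assoc 2 (posRpow s x)]
  refine le_trans (add_le_add_right ?_ _) hle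
  rw [← mul_assoc]
  gcongr
  refine le_trans (le_of_eq ?_) hc'J
  rw [show (2 : ℝ≥0∞) = ENNReal.ofReal 2 by simp, ← ENNReal.ofReal_mul (by norm_num)]
  congr 1
  ring

lemma posRpow_mul_posRpow {a b x : ℝ} (hx : 0 < x) :
    posRpow a x * posRpow b x = posRpow (a + b) x := by
  rw [posRpow_of_pos hx, posRpow_of_pos hx, posRpow_of_pos hx, Real.rpow_add hx,
    ENNReal.ofReal_mul (by positivity)]

lemma weighted_young {p a b x y s m : ℝ} (hp : 1 < p) (ha : 0 ≤ a) (hb : 0 ≤ b) (hx : 0 < x)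
    (hy : 0 < y) :
    x ^ (m - (p - 1) * s) * a ^ (p - 1) * b ≤
      x ^ m * y ^ s * ((1 - p⁻¹) * (x ^ (-(s * p)) * a ^ p) + p⁻¹ * (y ^ (-(s * p)) * b ^ p)) := by
  have hp0 : 0 < p := by linarith
  have hpq : p.HolderConjugate (p / (p - 1)) := Real.HolderConjugate.conjExponent hp
  have h := Real.young_inequality_of_nonneg (a := b * y ^ (-s))
    (b := (a * x ^ (-s)) ^ (p - 1)) (by positivity) (by positivity) hpq
  have e1 : ((a * x ^ (-s)) ^ (p - 1)) ^ (p / (p - 1)) = x ^ (-(s * p)) * a ^ p := by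
    have : p - 1 ≠ 0 := by linarith
    rw [← Real.rpow_mul (by positivity), mul_div_cancel₀ _ this, Real.mul_rpow ha (by positivity),
      ← Real.rpow_mul hx.le, mul_comm, neg_mul]
  have e2 : (b * y ^ (-s)) ^ p = y ^ (-(s * p)) * b ^ p := by
    rw [Real.mul_rpow hb (by positivity), ← Real.rpow_mul hy.le, mul_comm, neg_mul]
  have e3 : (a * x ^ (-s)) ^ (p - 1) = a ^ (p - 1) * x ^ (-((p - 1) * s)) := by
    rw [Real.mul_rpow ha (by positivity), ← Real.rpow_mul hx.le]
    ring_nf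
  have e4 : (p / (p - 1))⁻¹ = 1 - p⁻¹ := by field_simp
  rw [e1, e2, e3] at h
  have e5 : x ^ (m - (p - 1) * s) * a ^ (p - 1) * b = x ^ m * y ^ s *
      (b * y ^ (-s) * (a ^ (p - 1) * x ^ (-((p - 1) * s)))) := by
    have h1 : y ^ s * y ^ (-s) = 1 := by rw [← Real.rpow_add hy]; simp
    rw [sub_eq_add_neg, Real.rpow_add hx]
    linear_combination (-(x ^ m * x ^ (-((p - 1) * s)) * a ^ (p - 1) * b)) * h1
  rw [e5]
  refine mul_le_mul_of_nonneg_left (h.trans (le_of_eq ?_)) (by positivity)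
  rw [← e4, div_eq_mul_inv, div_eq_mul_inv (_ * _)]
  ring

lemma energy_estimate {d : ℕ} (i : Fin d) {p s m α c r : ℝ} (hp : 1 < p) (hr : 0 < r)
    {K : EuclideanSpace ℝ (Fin d) → ℝ≥0∞} (hK : Measurable K) (hKneg : ∀ z, K (-z) = K z)
    (hs : ∀ t, r ≤ t → (∫⁻ z, posRpow s (t + z i) * K z) + ENNReal.ofReal c * posRpow (s - α) t ≤
      posRpow s t * ∫⁻ z, K z)
    (hm : ∀ t, r ≤ t → (∫⁻ z, posRpow m (t + z i) * K z) + ENNReal.ofReal c * posRpow (m - α) t ≤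
      posRpow m t * ∫⁻ z, K z)
    {f : EuclideanSpace ℝ (Fin d) → ℝ} (hf : Measurable f) (hfr : ∀ x, f x ≠ 0 → r ≤ x i) :
    (∫⁻ x, ∫⁻ z, posRpow (m - (p - 1) * s) (x i) * ENNReal.ofReal (|f x| ^ (p - 1)) *
        ENNReal.ofReal |f (x + z)| * K z) +
      ENNReal.ofReal c * ∫⁻ x, posRpow (m - (p - 1) * s - α) (x i) * ENNReal.ofReal (|f x| ^ p) ≤
    (∫⁻ z, K z) * ∫⁻ x, posRpow (m - (p - 1) * s) (x i) * ENNReal.ofReal (|f x| ^ p) := by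
  have hp0 : 0 < p := by linarith
  have hpi : 0 ≤ 1 - p⁻¹ := by
    have := inv_lt_one_of_one_lt₀ hp
    linarith
  set q' := ENNReal.ofReal (1 - p⁻¹) with hq'
  set p' := ENNReal.ofReal p⁻¹ with hp'
  have hpq : q' + p' = 1 := by
    rw [hq', hp', ← ENNReal.ofReal_add hpi (by positivity)]
    simp
  set W : EuclideanSpace ℝ (Fin d) → ℝ≥0∞ := fun x =>
    posRpow (-(s * p)) (x i) * ENNReal.ofReal (|f x| ^ p) with hW
  have hWm : Measurable W := by fun_prop
  have hIs : Measurable fun x : EuclideanSpace ℝ (Fin d) => ∫⁻ z, posRpow s (x i + z i) * K z :=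
    Measurable.lintegral_prod_right (by fun_prop)
  have hIm : Measurable fun x : EuclideanSpace ℝ (Fin d) => ∫⁻ z, posRpow m (x i + z i) * K z :=
    Measurable.lintegral_prod_right (by fun_prop)
  have hyoung : ∀ x z : EuclideanSpace ℝ (Fin d),
      posRpow (m - (p - 1) * s) (x i) * ENNReal.ofReal (|f x| ^ (p - 1)) *
        ENNReal.ofReal |f (x + z)| * K z ≤
      q' * (posRpow m (x i) * W x) * (posRpow s (x i + z i) * K z) +
        p' * (posRpow m (x i) * (posRpow s ((x + z) i) * W (x + z)) * K z) := by
    intro x z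
    by_cases hx : f x = 0
    · simp [hx, Real.zero_rpow (by linarith : p - 1 ≠ 0)]
    by_cases hz : f (x + z) = 0
    · simp [hz]
    have hxi : 0 < x i := hr.trans_le (hfr x hx)
    have hzi : 0 < (x + z) i := hr.trans_le (hfr _ hz)
    have hadd : x i + z i = (x + z) i := rfl
    have h := ENNReal.ofReal_le_ofReal (weighted_young (s := s) (m := m) hp (abs_nonneg (f x))
      (abs_nonneg (f (x + z))) hxi hzi)
    rw [ENNReal.ofReal_mul (by positivity), ENNReal.ofReal_mul (by positivity),
      ENNReal.ofReal_mul (by positivity), ENNReal.ofReal_mul (by positivity),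
      ENNReal.ofReal_add (by positivity) (by positivity), ENNReal.ofReal_mul hpi,
      ENNReal.ofReal_mul (by positivity), ENNReal.ofReal_mul (by positivity),
      ENNReal.ofReal_mul (by positivity)] at h
    simp only [hW, hadd, posRpow_of_pos hxi, posRpow_of_pos hzi]
    refine (mul_le_mul_left h (K z)).trans (le_of_eq ?_)
    ring
  have hswap : ∫⁻ x, ∫⁻ z, posRpow m (x i) * (posRpow s ((x + z) i) * W (x + z)) * K z =
      ∫⁻ x, posRpow s (x i) * W x * ∫⁻ z, posRpow m (x i + z i) * K z := by
    rw [lintegral_lintegral_swap (by fun_prop)]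
    have h1 : ∀ z : EuclideanSpace ℝ (Fin d),
        ∫⁻ x, posRpow m (x i) * (posRpow s ((x + z) i) * W (x + z)) * K z =
        ∫⁻ x, posRpow m ((x - z) i) * (posRpow s (x i) * W x) * K z := by
      intro z
      rw [← lintegral_sub_right_eq_self
        (fun x => posRpow m (x i) * (posRpow s ((x + z) i) * W (x + z)) * K z) z]
      simp
    simp_rw [h1]
    rw [← lintegral_neg_eq_self]
    simp_rw [hKneg, sub_neg_eq_add]
    rw [lintegral_lintegral_swap (by fun_prop)]
    refine lintegral_congr fun x => ?_
    rw [← lintegral_const_mul _ (by fun_prop)]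
    refine lintegral_congr fun z => ?_
    rw [PiLp.add_apply]
    ring
  calc _ ≤ (∫⁻ x, ∫⁻ z, (q' * (posRpow m (x i) * W x) * (posRpow s (x i + z i) * K z) +
        p' * (posRpow m (x i) * (posRpow s ((x + z) i) * W (x + z)) * K z))) +
        ENNReal.ofReal c * ∫⁻ x, posRpow (m - (p - 1) * s - α) (x i) *
          ENNReal.ofReal (|f x| ^ p) := by
        gcongr with x z
        exact hyoung x z
    _ = (∫⁻ x, q' * (posRpow m (x i) * W x) * ∫⁻ z, posRpow s (x i + z i) * K z) +
        p' * (∫⁻ x, posRpow s (x i) * W x * ∫⁻ z, posRpow m (x i + z i) * K z) +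
        ENNReal.ofReal c * ∫⁻ x, posRpow (m - (p - 1) * s - α) (x i) *
          ENNReal.ofReal (|f x| ^ p) := by
        congr 1
        rw [← hswap, ← lintegral_const_mul _ (Measurable.lintegral_prod_right (by fun_prop)),
          ← lintegral_add_left (by fun_prop)]
        refine lintegral_congr fun x => ?_
        rw [lintegral_add_left (by fun_prop), lintegral_const_mul _ (by fun_prop),
          lintegral_const_mul _ (by fun_prop)]
    _ = ∫⁻ x, (q' * (posRpow m (x i) * W x) * (∫⁻ z, posRpow s (x i + z i) * K z) +
        p' * (posRpow s (x i) * W x * ∫⁻ z, posRpow m (x i + z i) * K z) +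
        ENNReal.ofReal c * (posRpow (m - (p - 1) * s - α) (x i) *
          ENNReal.ofReal (|f x| ^ p))) := by
        rw [lintegral_add_right _ (by fun_prop), lintegral_add_left (by fun_prop),
          lintegral_const_mul _ (by fun_prop),
          lintegral_const_mul _ (by fun_prop)]
    _ ≤ ∫⁻ x, (∫⁻ z, K z) * (posRpow (m - (p - 1) * s) (x i) * ENNReal.ofReal (|f x| ^ p)) := by
        refine lintegral_mono fun x => ?_
        by_cases hx : f x = 0
        · simp [hW, hx, Real.zero_rpow hp0.ne']
        have hxr := hfr x hx
        have hxi : 0 < x i := hr.trans_le hxr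
        have e1 : posRpow (m - (p - 1) * s - α) (x i) * ENNReal.ofReal (|f x| ^ p) =
            posRpow m (x i) * posRpow (s - α) (x i) * W x := by
          simp only [hW, ← mul_assoc]
          rw [posRpow_mul_posRpow hxi, posRpow_mul_posRpow hxi]
          ring_nf
        have e2 : posRpow (m - (p - 1) * s - α) (x i) * ENNReal.ofReal (|f x| ^ p) =
            posRpow s (x i) * posRpow (m - α) (x i) * W x := by
          simp only [hW, ← mul_assoc]
          rw [posRpow_mul_posRpow hxi, posRpow_mul_posRpow hxi]
          ring_nf
        have e3 : posRpow (m - (p - 1) * s) (x i) * ENNReal.ofReal (|f x| ^ p) =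
            posRpow m (x i) * posRpow s (x i) * W x := by
          simp only [hW, ← mul_assoc]
          rw [posRpow_mul_posRpow hxi, posRpow_mul_posRpow hxi]
          ring_nf
        have e4 : ENNReal.ofReal c *
            (posRpow (m - (p - 1) * s - α) (x i) * ENNReal.ofReal (|f x| ^ p)) =
            q' * (posRpow m (x i) * W x) * (ENNReal.ofReal c * posRpow (s - α) (x i)) +
            p' * (posRpow s (x i) * W x) * (ENNReal.ofReal c * posRpow (m - α) (x i)) := by
          calc _ = (q' + p') * (ENNReal.ofReal c *
              (posRpow (m - (p - 1) * s - α) (x i) * ENNReal.ofReal (|f x| ^ p))) := by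
                rw [hpq, one_mul]
            _ = _ := by
                rw [add_mul]
                nth_rewrite 1 [e1]
                rw [e2]
                ring
        rw [e4, e3]
        calc _ = q' * (posRpow m (x i) * W x) * ((∫⁻ z, posRpow s (x i + z i) * K z) +
              ENNReal.ofReal c * posRpow (s - α) (x i)) +
              p' * (posRpow s (x i) * W x) * ((∫⁻ z, posRpow m (x i + z i) * K z) +
              ENNReal.ofReal c * posRpow (m - α) (x i)) := by ring
          _ ≤ q' * (posRpow m (x i) * W x) * (posRpow s (x i) * ∫⁻ z, K z) +
              p' * (posRpow s (x i) * W x) * (posRpow m (x i) * ∫⁻ z, K z) := by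
              gcongr
              · exact hs _ hxr
              · exact hm _ hxr
          _ = (q' + p') * ((∫⁻ z, K z) * (posRpow m (x i) * posRpow s (x i) * W x)) := by ring
          _ = _ := by rw [hpq, one_mul]
    _ = _ := by rw [lintegral_const_mul _ (by fun_prop)]

lemma exists_pos_le_of_tsupport_subset {d : ℕ} (i : Fin d) {u : EuclideanSpace ℝ (Fin d) → ℝ}
    (hu : HasCompactSupport u) (hs : tsupport u ⊆ {x | 0 < x i}) :
    ∃ r : ℝ, 0 < r ∧ ∀ x, u x ≠ 0 → r ≤ x i := by
  rcases (tsupport u).eq_empty_or_nonempty with h | h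
  · refine ⟨1, one_pos, fun x hx => ?_⟩
    have : x ∈ tsupport u := subset_tsupport u hx
    simp [h] at this
  · obtain ⟨y, hy, hmin⟩ := hu.isCompact.exists_isMinOn h
      (f := fun x : EuclideanSpace ℝ (Fin d) => x i) (by fun_prop)
    exact ⟨y i, hs hy, fun x hx => hmin (subset_tsupport u hx)⟩

lemma lintegral_posRpow_mul_ne_top {d : ℕ} (i : Fin d) (b : ℝ)
    {A : Set (EuclideanSpace ℝ (Fin d))} (hA : IsCompact A) (hs : A ⊆ {x | 0 < x i})
    {g : EuclideanSpace ℝ (Fin d) → ℝ} (hg : Continuous g) (hgA : ∀ x, x ∉ A → g x = 0) :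
    ∫⁻ x, posRpow b (x i) * ENNReal.ofReal (g x) ≠ ∞ := by
  obtain ⟨B, hB⟩ := hA.exists_bound_of_continuousOn
    (f := fun x : EuclideanSpace ℝ (Fin d) => (x i) ^ b * g x) (by
      refine ContinuousOn.mul (ContinuousOn.rpow_const (by fun_prop) ?_) hg.continuousOn
      exact fun x hx => Or.inl (hs hx).ne')
  have h : ∀ x : EuclideanSpace ℝ (Fin d), posRpow b (x i) * ENNReal.ofReal (g x) ≤
      A.indicator (fun _ => ENNReal.ofReal B) x := by
    intro x
    by_cases hx : x ∈ A
    · have hxi : 0 < x i := hs hx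
      rw [Set.indicator_of_mem hx, posRpow_of_pos hxi, ← ENNReal.ofReal_mul (by positivity)]
      exact ENNReal.ofReal_le_ofReal ((le_abs_self _).trans (hB x hx))
    · simp [hgA x hx]
  refine ne_top_of_le_ne_top ?_ (lintegral_mono h)
  rw [lintegral_indicator_const hA.measurableSet]
  exact ENNReal.mul_ne_top (by simp) hA.measure_lt_top.ne

/-- The kernel `‖z‖ ^ (-d - α)` truncated to `ε < ‖z‖`. -/
noncomputable def truncKernel (d : ℕ) (α ε : ℝ) : EuclideanSpace ℝ (Fin d) → ℝ≥0∞ :=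
  {z | ε < ‖z‖}.indicator fun z => ENNReal.ofReal (‖z‖ ^ (-(d : ℝ) - α))

lemma measurableSet_lt_norm (d : ℕ) (ε : ℝ) :
    MeasurableSet {z : EuclideanSpace ℝ (Fin d) | ε < ‖z‖} :=
  measurableSet_lt measurable_const measurable_norm

@[fun_prop]
lemma measurable_truncKernel (d : ℕ) (α ε : ℝ) : Measurable (truncKernel d α ε) :=
  Measurable.indicator (by fun_prop) (measurableSet_lt_norm d ε)

lemma truncKernel_neg {d : ℕ} (α ε : ℝ) (z : EuclideanSpace ℝ (Fin d)) :
    truncKernel d α ε (-z) = truncKernel d α ε z := by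
  simp [truncKernel, Set.indicator]

lemma lintegral_mul_truncKernel {d : ℕ} (α ε : ℝ) (f : EuclideanSpace ℝ (Fin d) → ℝ≥0∞) :
    ∫⁻ z, f z * truncKernel d α ε z =
      ∫⁻ z in {z | ε < ‖z‖}, f z * ENNReal.ofReal (‖z‖ ^ (-(d : ℝ) - α)) := by
  rw [← lintegral_indicator (measurableSet_lt_norm d ε)]
  refine lintegral_congr fun z => ?_
  simp only [truncKernel, Set.indicator]
  split_ifs <;> simp

lemma lintegral_truncKernel {d : ℕ} (α ε : ℝ) :
    ∫⁻ z, truncKernel d α ε z =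
      ∫⁻ z in {z : EuclideanSpace ℝ (Fin d) | ε < ‖z‖}, ENNReal.ofReal (‖z‖ ^ (-(d : ℝ) - α)) :=
  lintegral_indicator (measurableSet_lt_norm d ε) _

/-- The truncated fractional Laplacian, up to the normalizing factor. -/
noncomputable def truncFracLap {d : ℕ} (α : ℝ) (u : EuclideanSpace ℝ (Fin d) → ℝ) (ε : ℝ)
    (x : EuclideanSpace ℝ (Fin d)) : ℝ :=
  ∫ y in {y : EuclideanSpace ℝ (Fin d) | ε < ‖y‖}, (u (x + y) - u x) * ‖y‖ ^ (-(d : ℝ) - α)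

lemma integrableOn_norm_rpow {d : ℕ} [NeZero d] {α ε : ℝ} (hα : 0 < α) (hε : 0 < ε) :
    IntegrableOn (fun y : EuclideanSpace ℝ (Fin d) => ‖y‖ ^ (-(d : ℝ) - α)) {y | ε < ‖y‖} := by
  refine ⟨Measurable.aestronglyMeasurable (by fun_prop), ?_⟩
  rw [hasFiniteIntegral_iff_ofReal (ae_of_all _ fun y => by positivity)]
  exact (setLIntegral_norm_lt_rpow_ne_top hα hε).lt_top

lemma integrableOn_mul_norm_rpow {d : ℕ} [NeZero d] {α ε B : ℝ} (hα : 0 < α) (hε : 0 < ε)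
    {g : EuclideanSpace ℝ (Fin d) → ℝ} (hg : Continuous g) (hB : ∀ y, |g y| ≤ B) :
    IntegrableOn (fun y : EuclideanSpace ℝ (Fin d) => g y * ‖y‖ ^ (-(d : ℝ) - α))
      {y | ε < ‖y‖} :=
  (integrableOn_norm_rpow hα hε).bdd_mul hg.aestronglyMeasurable (ae_of_all _ hB)

lemma ofReal_abs_mul_lintegral_truncKernel_le {d : ℕ} [NeZero d] {α ε : ℝ} (hα : 0 < α)
    (hε : 0 < ε) {u : EuclideanSpace ℝ (Fin d) → ℝ} (hu : Continuous u)
    (hc : HasCompactSupport u) (x : EuclideanSpace ℝ (Fin d)) :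
    ENNReal.ofReal |u x| * ∫⁻ z, truncKernel d α ε z ≤
      ENNReal.ofReal |truncFracLap α u ε x| +
        ∫⁻ z, ENNReal.ofReal |u (x + z)| * truncKernel d α ε z := by
  obtain ⟨B, hB⟩ := hc.exists_bound_of_continuous hu
  have h1 : IntegrableOn (fun y => u (x + y) * ‖y‖ ^ (-(d : ℝ) - α)) {y | ε < ‖y‖} :=
    integrableOn_mul_norm_rpow hα hε (by fun_prop) fun y => hB (x + y)
  have h2 := (integrableOn_norm_rpow (d := d) hα hε).const_mul (u x)
  have h3 : truncFracLap α u ε x = (∫ y in {y : EuclideanSpace ℝ (Fin d) | ε < ‖y‖},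
      u (x + y) * ‖y‖ ^ (-(d : ℝ) - α)) - u x * ∫ y in {y : EuclideanSpace ℝ (Fin d) | ε < ‖y‖},
      ‖y‖ ^ (-(d : ℝ) - α) := by
    rw [← integral_const_mul, ← integral_sub h1 h2]
    simp only [truncFracLap, sub_mul]
  have h4 : ENNReal.ofReal |∫ y in {y : EuclideanSpace ℝ (Fin d) | ε < ‖y‖},
      u (x + y) * ‖y‖ ^ (-(d : ℝ) - α)| ≤
      ∫⁻ z, ENNReal.ofReal |u (x + z)| * truncKernel d α ε z := by
    rw [lintegral_mul_truncKernel, ← Real.enorm_eq_ofReal_abs]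
    refine (enorm_integral_le_lintegral_enorm _).trans (le_of_eq (lintegral_congr fun y => ?_))
    rw [Real.enorm_eq_ofReal_abs, abs_mul, ENNReal.ofReal_mul (abs_nonneg _),
      abs_of_nonneg (a := ‖y‖ ^ _) (by positivity)]
  have h5 : ∫⁻ z, truncKernel d α ε z = ENNReal.ofReal
      (∫ y in {y : EuclideanSpace ℝ (Fin d) | ε < ‖y‖}, ‖y‖ ^ (-(d : ℝ) - α)) := by
    rw [lintegral_truncKernel, ofReal_integral_eq_lintegral_ofReal
      (integrableOn_norm_rpow (d := d) hα hε) (ae_of_all _ fun y => by positivity)]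
  rw [h5, ← ENNReal.ofReal_mul (abs_nonneg _)]
  refine le_trans ?_ (add_le_add_right h4 _)
  rw [← ENNReal.ofReal_add (abs_nonneg _) (abs_nonneg _), h3]
  apply ENNReal.ofReal_le_ofReal
  have h6 : 0 ≤ ∫ y in {y : EuclideanSpace ℝ (Fin d) | ε < ‖y‖}, ‖y‖ ^ (-(d : ℝ) - α) :=
    integral_nonneg fun y => by positivity
  rw [← abs_of_nonneg h6, ← abs_mul, abs_of_nonneg h6]
  set P := u x * ∫ y in {y : EuclideanSpace ℝ (Fin d) | ε < ‖y‖}, ‖y‖ ^ (-(d : ℝ) - α)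
  set Q := ∫ y in {y : EuclideanSpace ℝ (Fin d) | ε < ‖y‖}, u (x + y) * ‖y‖ ^ (-(d : ℝ) - α)
  have := abs_sub Q (Q - P)
  rw [_root_.sub_sub_cancel] at this
  linarith

lemma exists_second_difference_bound {E : Type*} [NormedAddCommGroup E]
    [NormedSpace ℝ E] {u : E → ℝ}
    (hu : ContDiff ℝ (⊤ : ℕ∞) u) (hc : HasCompactSupport u) :
    ∃ M N : ℝ, 0 ≤ M ∧ 0 ≤ N ∧
      ∀ x y, |u (x + y) - u x + (u (x - y) - u x)| ≤ min (M * ‖y‖ ^ 2) N := by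
  obtain ⟨L, hL⟩ := ContDiff.lipschitzWith_of_hasCompactSupport
    (hc.fderiv (𝕜 := ℝ)) (hu.fderiv_right (m := 1) (WithTop.coe_le_coe.2 le_top)) one_ne_zero
  obtain ⟨B, hB⟩ := hc.exists_bound_of_continuous hu.continuous
  have hB0 : 0 ≤ B := (norm_nonneg _).trans (hB 0)
  have hd : Differentiable ℝ u := hu.differentiable (by simp)
  refine ⟨2 * L, 4 * B, by positivity, by positivity, fun x y => le_min ?_ ?_⟩
  · have hg : ∀ z, HasFDerivAt (fun z => u (x + z) + u (x - z))
        (fderiv ℝ u (x + z) - fderiv ℝ u (x - z)) z := by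
      intro z
      have h1 := (hd (x + z)).hasFDerivAt.comp z ((hasFDerivAt_id z).const_add x)
      have h2 := (hd (x - z)).hasFDerivAt.comp z ((hasFDerivAt_id z).const_sub x)
      refine (h1.add h2).congr_fderiv ?_
      ext v
      simp [sub_eq_add_neg]
    have h := (convex_closedBall (0 : E) ‖y‖).norm_image_sub_le_of_norm_hasFDerivWithin_le
      (f := fun z => u (x + z) + u (x - z)) (C := 2 * L * ‖y‖) (x := 0) (y := y)
      (fun z _ => (hg z).hasFDerivWithinAt) (fun z hz => ?_) (by simp) (by simp)
    · simp only [add_zero, sub_zero, Real.norm_eq_abs] at h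
      calc _ = |u (x + y) + u (x - y) - (u x + u x)| := by ring_nf
        _ ≤ _ := h
        _ = _ := by ring
    · have hz' : ‖z‖ ≤ ‖y‖ := by simpa using hz
      refine (hL.norm_sub_le _ _).trans ?_
      have : x + z - (x - z) = (2 : ℝ) • z := by module
      rw [this, norm_smul]
      simp only [Real.norm_ofNat]
      nlinarith [L.coe_nonneg, norm_nonneg z, mul_le_mul_of_nonneg_left hz' L.coe_nonneg]
  · have h1 := abs_le.1 (hB (x + y))
    have h2 := abs_le.1 (hB (x - y))
    have h3 := abs_le.1 (hB x)
    rw [abs_le]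
    constructor <;> linarith

lemma lintegral_Ioi_min_mul_rpow_ne_top {α M N : ℝ} (hα : α ∈ Set.Ioo (0 : ℝ) 2) (hM : 0 ≤ M)
    (hN : 0 ≤ N) :
    ∫⁻ r in Set.Ioi (0 : ℝ), ENNReal.ofReal (min (M * r ^ 2) N) *
      ENNReal.ofReal (r ^ (-1 - α)) ≠ ∞ := by
  have h1 : IntegrableOn (fun r : ℝ => M * r ^ (1 - α)) (Set.Ioc 0 1) :=
    (((intervalIntegral.intervalIntegrable_rpow' (by linarith [hα.2])).1).const_mul M)
  have h2 : IntegrableOn (fun r : ℝ => N * r ^ (-1 - α)) (Set.Ioi 1) :=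
    (integrableOn_Ioi_rpow_of_lt (by linarith [hα.1]) one_pos).const_mul N
  rw [← Set.Ioc_union_Ioi_eq_Ioi (zero_le_one' ℝ)]
  refine ne_top_of_le_ne_top (ENNReal.add_ne_top.2 ⟨h1.lintegral_lt_top.ne,
    h2.lintegral_lt_top.ne⟩) ((lintegral_union_le _ _ _).trans (add_le_add ?_ ?_))
  · refine setLIntegral_mono' measurableSet_Ioc fun r hr => ?_
    have hr0 : 0 < r := hr.1
    rw [← ENNReal.ofReal_mul (le_min (by positivity) hN)]
    refine ENNReal.ofReal_le_ofReal ((mul_le_mul_of_nonneg_right (min_le_left _ _)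
      (by positivity)).trans (le_of_eq ?_))
    rw [mul_assoc, ← Real.rpow_natCast, ← Real.rpow_add hr0]
    congr 2
    push_cast
    ring
  · refine setLIntegral_mono' measurableSet_Ioi fun r hr => ?_
    have hr0 : 0 < r := one_pos.trans hr
    rw [← ENNReal.ofReal_mul (le_min (by positivity) hN)]
    exact ENNReal.ofReal_le_ofReal (mul_le_mul_of_nonneg_right (min_le_right _ _) (by positivity))

lemma two_mul_truncFracLap {d : ℕ} [NeZero d] {α ε : ℝ} (hα : 0 < α) (hε : 0 < ε)
    {u : EuclideanSpace ℝ (Fin d) → ℝ} (hu : Continuous u) (hc : HasCompactSupport u)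
    (x : EuclideanSpace ℝ (Fin d)) :
    2 * truncFracLap α u ε x = ∫ y in {y : EuclideanSpace ℝ (Fin d) | ε < ‖y‖},
      (u (x + y) - u x + (u (x - y) - u x)) * ‖y‖ ^ (-(d : ℝ) - α) := by
  obtain ⟨B, hB⟩ := hc.exists_bound_of_continuous hu
  have hB' : ∀ y, |u y| ≤ B := hB
  have h1 : IntegrableOn (fun y => (u (x + y) - u x) * ‖y‖ ^ (-(d : ℝ) - α)) {y | ε < ‖y‖} :=
    integrableOn_mul_norm_rpow (B := B + B) hα hε (by fun_prop) fun y =>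
      (abs_sub _ _).trans (add_le_add (hB' _) (hB' _))
  have h2 : IntegrableOn (fun y => (u (x - y) - u x) * ‖y‖ ^ (-(d : ℝ) - α)) {y | ε < ‖y‖} :=
    integrableOn_mul_norm_rpow (B := B + B) hα hε (by fun_prop) fun y =>
      (abs_sub _ _).trans (add_le_add (hB' _) (hB' _))
  have h3 : truncFracLap α u ε x = ∫ y in {y : EuclideanSpace ℝ (Fin d) | ε < ‖y‖},
      (u (x - y) - u x) * ‖y‖ ^ (-(d : ℝ) - α) := by
    rw [truncFracLap, ← integral_indicator (measurableSet_lt_norm d ε),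
      ← integral_indicator (measurableSet_lt_norm d ε), ← integral_neg_eq_self]
    refine integral_congr_ae (ae_of_all _ fun y => ?_)
    simp [Set.indicator, sub_eq_add_neg]
  rw [two_mul]
  nth_rewrite 2 [h3]
  rw [truncFracLap, ← integral_add h1 h2]
  simp only [add_mul]

lemma exists_truncFracLap_bound {d : ℕ} [NeZero d] {α : ℝ} (hα : α ∈ Set.Ioo (0 : ℝ) 2)
    {u : EuclideanSpace ℝ (Fin d) → ℝ} (hu : ContDiff ℝ (⊤ : ℕ∞) u) (hc : HasCompactSupport u) :
    ∃ T : ℝ≥0∞, T ≠ ∞ ∧ ∀ ε x, 0 < ε → ENNReal.ofReal |truncFracLap α u ε x| ≤ T := by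
  obtain ⟨M, N, hM, hN, hMN⟩ := exists_second_difference_bound hu hc
  refine ⟨_, ENNReal.mul_ne_top (lintegral_Ioi_min_mul_rpow_ne_top hα hM hN)
    (measure_ne_top (volume : Measure (EuclideanSpace ℝ (Fin d))).toSphere Set.univ),
    fun ε x hε => ?_⟩
  calc ENNReal.ofReal |truncFracLap α u ε x|
      ≤ ENNReal.ofReal |2 * truncFracLap α u ε x| := by
        refine ENNReal.ofReal_le_ofReal ?_
        rw [abs_mul, abs_two]
        linarith [abs_nonneg (truncFracLap α u ε x)]
    _ ≤ ∫⁻ y in {y : EuclideanSpace ℝ (Fin d) | ε < ‖y‖},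
        ENNReal.ofReal (min (M * ‖y‖ ^ 2) N) * ENNReal.ofReal (‖y‖ ^ (-(d : ℝ) - α)) := by
        rw [two_mul_truncFracLap hα.1 hε hu.continuous hc, ← Real.enorm_eq_ofReal_abs]
        refine (enorm_integral_le_lintegral_enorm _).trans (lintegral_mono fun y => ?_)
        rw [Real.enorm_eq_ofReal_abs, abs_mul, ENNReal.ofReal_mul (abs_nonneg _),
          abs_of_nonneg (a := ‖y‖ ^ _) (by positivity)]
        gcongr
        exact hMN x y
    _ = ∫⁻ ω, ∫⁻ r in Set.Ioi ε,
        ENNReal.ofReal (min (M * ‖r • (ω : EuclideanSpace ℝ (Fin d))‖ ^ 2) N) *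
          ENNReal.ofReal (r ^ (-1 - α)) ∂volume
          ∂(volume : Measure (EuclideanSpace ℝ (Fin d))).toSphere :=
        setLIntegral_norm_lt_eq α ε hε
          (f := fun y => ENNReal.ofReal (min (M * ‖y‖ ^ 2) N)) (by fun_prop)
    _ ≤ ∫⁻ _, (∫⁻ r in Set.Ioi (0 : ℝ), ENNReal.ofReal (min (M * r ^ 2) N) *
          ENNReal.ofReal (r ^ (-1 - α)))
          ∂(volume : Measure (EuclideanSpace ℝ (Fin d))).toSphere := by
        refine lintegral_mono fun ω => ?_
        have hω : ‖(ω : EuclideanSpace ℝ (Fin d))‖ = 1 := by simp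
        simp only [norm_smul, hω, mul_one, Real.norm_eq_abs, sq_abs]
        exact lintegral_mono_set (Set.Ioi_subset_Ioi hε.le)
    _ = _ := lintegral_const _

lemma measurable_truncFracLap {d : ℕ} (α ε : ℝ) {u : EuclideanSpace ℝ (Fin d) → ℝ}
    (hu : Measurable u) : Measurable (truncFracLap α u ε) := by
  have h : Measurable fun q : EuclideanSpace ℝ (Fin d) × EuclideanSpace ℝ (Fin d) =>
      (u (q.1 + q.2) - u q.1) * ‖q.2‖ ^ (-(d : ℝ) - α) := by fun_prop
  exact (StronglyMeasurable.integral_prod_right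
    (ν := volume.restrict {y : EuclideanSpace ℝ (Fin d) | ε < ‖y‖}) h.stronglyMeasurable).measurable

/-- Testing the truncated fractional Laplacian of `u` against `x₁ ^ b |u| ^ (p - 2) u`. -/
lemma trunc_energy_inequality {d : ℕ} [NeZero d] (i : Fin d) {p s m α c r δ ε : ℝ} (hp : 1 < p)
    (hα : 0 < α) (hr : 0 < r) (hε : ε ∈ Set.Ioo 0 (δ * r)) (hδ : 0 < δ)
    (hs : ∀ x ε, 0 < x → ε ∈ Set.Ioo 0 (δ * x) →
      (∫⁻ z : EuclideanSpace ℝ (Fin d), posRpow s (x + z i) * truncKernel d α ε z) +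
        ENNReal.ofReal c * posRpow (s - α) x ≤ posRpow s x * ∫⁻ z, truncKernel d α ε z)
    (hm : ∀ x ε, 0 < x → ε ∈ Set.Ioo 0 (δ * x) →
      (∫⁻ z : EuclideanSpace ℝ (Fin d), posRpow m (x + z i) * truncKernel d α ε z) +
        ENNReal.ofReal c * posRpow (m - α) x ≤ posRpow m x * ∫⁻ z, truncKernel d α ε z)
    {u : EuclideanSpace ℝ (Fin d) → ℝ} (hu : Continuous u) (hc : HasCompactSupport u)
    (hsupp : tsupport u ⊆ {x | 0 < x i}) (hur : ∀ x, u x ≠ 0 → r ≤ x i) :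
    ENNReal.ofReal c * ∫⁻ x, posRpow (m - (p - 1) * s - α) (x i) * ENNReal.ofReal (|u x| ^ p) ≤
      ∫⁻ x, posRpow (m - (p - 1) * s) (x i) * ENNReal.ofReal (|u x| ^ (p - 1)) *
        ENNReal.ofReal |truncFracLap α u ε x| := by
  have hp0 : 0 < p := by linarith
  set b := m - (p - 1) * s with hb
  have hmeas := hu.measurable
  have hlap := measurable_truncFracLap α ε hmeas
  have hεt : ∀ t, r ≤ t → ε ∈ Set.Ioo 0 (δ * t) := fun t ht =>
    ⟨hε.1, hε.2.trans_le (mul_le_mul_of_nonneg_left ht hδ.le)⟩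
  have hE := energy_estimate i hp hr (measurable_truncKernel d α ε) (truncKernel_neg α ε)
    (fun t ht => hs t ε (hr.trans_le ht) (hεt t ht))
    (fun t ht => hm t ε (hr.trans_le ht) (hεt t ht)) hmeas hur
  rw [← hb] at hE
  set D := ∫⁻ x, ∫⁻ z, posRpow b (x i) * ENNReal.ofReal (|u x| ^ (p - 1)) *
    ENNReal.ofReal |u (x + z)| * truncKernel d α ε z with hD
  have hfin : (∫⁻ z, truncKernel d α ε z) *
      ∫⁻ x, posRpow b (x i) * ENNReal.ofReal (|u x| ^ p) ≠ ∞ := by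
    refine ENNReal.mul_ne_top ?_ (lintegral_posRpow_mul_ne_top i b hc.isCompact hsupp ?_ ?_)
    · rw [lintegral_truncKernel]
      exact setLIntegral_norm_lt_rpow_ne_top hα hε.1
    · exact hu.abs.rpow_const fun x => Or.inr hp0.le
    · intro x hx
      simp [image_eq_zero_of_notMem_tsupport hx, Real.zero_rpow hp0.ne']
  have hD_ne : D ≠ ∞ := ne_top_of_le_ne_top hfin (le_self_add.trans hE)
  refine (ENNReal.add_le_add_iff_left hD_ne).1 (hE.trans ?_)
  have hpow : ∀ x, ENNReal.ofReal (|u x| ^ p) =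
      ENNReal.ofReal (|u x| ^ (p - 1)) * ENNReal.ofReal |u x| := by
    intro x
    rw [← ENNReal.ofReal_mul (by positivity)]
    congr 1
    rcases eq_or_ne (u x) 0 with h | h
    · simp [h, Real.zero_rpow hp0.ne']
    · rw [← Real.rpow_add_one (abs_ne_zero.2 h), sub_add_cancel]
  rw [hD, ← lintegral_add_right _ (by fun_prop), ← lintegral_const_mul _ (by fun_prop)]
  refine lintegral_mono fun x => ?_
  have h1 : ∫⁻ z, posRpow b (x i) * ENNReal.ofReal (|u x| ^ (p - 1)) *
      ENNReal.ofReal |u (x + z)| * truncKernel d α ε z =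
      posRpow b (x i) * ENNReal.ofReal (|u x| ^ (p - 1)) *
        ∫⁻ z, ENNReal.ofReal |u (x + z)| * truncKernel d α ε z := by
    rw [← lintegral_const_mul _ (by fun_prop)]
    simp only [mul_assoc]
  rw [h1, hpow, ← mul_add, add_comm]
  refine le_trans (le_of_eq ?_) (mul_le_mul_right
    (ofReal_abs_mul_lintegral_truncKernel_le hα hε.1 hu hc x) _)
  ring

/-- Testing the fractional Laplacian `w` of `u` against `x₁ ^ b |u| ^ (p - 2) u`. -/
lemma energy_inequality {d : ℕ} [NeZero d] (i : Fin d) {p s m α c δ : ℝ} (hp : 1 < p)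
    (hα : α ∈ Set.Ioo (0 : ℝ) 2) (hδ : 0 < δ)
    (hs : ∀ x ε, 0 < x → ε ∈ Set.Ioo 0 (δ * x) →
      (∫⁻ z : EuclideanSpace ℝ (Fin d), posRpow s (x + z i) * truncKernel d α ε z) +
        ENNReal.ofReal c * posRpow (s - α) x ≤ posRpow s x * ∫⁻ z, truncKernel d α ε z)
    (hm : ∀ x ε, 0 < x → ε ∈ Set.Ioo 0 (δ * x) →
      (∫⁻ z : EuclideanSpace ℝ (Fin d), posRpow m (x + z i) * truncKernel d α ε z) +
        ENNReal.ofReal c * posRpow (m - α) x ≤ posRpow m x * ∫⁻ z, truncKernel d α ε z)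
    {u w : EuclideanSpace ℝ (Fin d) → ℝ} (hu : ContDiff ℝ (⊤ : ℕ∞) u) (hc : HasCompactSupport u)
    (hsupp : tsupport u ⊆ {x | 0 < x i})
    (hw : ∀ x, Tendsto (fun ε => truncFracLap α u ε x) (𝓝[>] 0) (𝓝 (w x))) :
    Measurable w ∧
    ENNReal.ofReal c * ∫⁻ x, posRpow (m - (p - 1) * s - α) (x i) * ENNReal.ofReal (|u x| ^ p) ≤
      ∫⁻ x, posRpow (m - (p - 1) * s) (x i) * ENNReal.ofReal (|u x| ^ (p - 1)) *
        ENNReal.ofReal |w x| := by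
  have hp1 : 0 < p - 1 := by linarith
  obtain ⟨r, hr, hur⟩ := exists_pos_le_of_tsupport_subset i hc hsupp
  obtain ⟨T, hT, hTle⟩ := exists_truncFracLap_bound hα hu hc
  have hmeas := hu.continuous.measurable
  set e : ℕ → ℝ := fun n => δ * r / (n + 2) with he
  have he_mem : ∀ n, e n ∈ Set.Ioo 0 (δ * r) := fun n =>
    ⟨by positivity, div_lt_self (by positivity) (by linarith [n.cast_nonneg (α := ℝ)])⟩
  have he_lim : Tendsto e atTop (𝓝[>] 0) := by
    refine tendsto_nhdsWithin_iff.2 ⟨?_, Eventually.of_forall fun n => (he_mem n).1⟩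
    exact tendsto_const_nhds.div_atTop (tendsto_atTop_add_const_right _ _
      tendsto_natCast_atTop_atTop)
  have hw' : ∀ x, Tendsto (fun n => truncFracLap α u (e n) x) atTop (𝓝 (w x)) :=
    fun x => (hw x).comp he_lim
  have hlap := fun n => measurable_truncFracLap α (e n) hmeas
  refine ⟨measurable_of_tendsto_metrizable hlap (tendsto_pi_nhds.2 hw'), ?_⟩
  set g : EuclideanSpace ℝ (Fin d) → ℝ≥0∞ := fun x =>
    posRpow (m - (p - 1) * s) (x i) * ENNReal.ofReal (|u x| ^ (p - 1)) with hg
  have hgm : Measurable g := by fun_prop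
  have hg_fin : ∫⁻ x, g x ≠ ∞ := by
    refine lintegral_posRpow_mul_ne_top i _ hc.isCompact hsupp
      (hu.continuous.abs.rpow_const fun x => Or.inr hp1.le) fun x hx => ?_
    simp [image_eq_zero_of_notMem_tsupport hx, Real.zero_rpow hp1.ne']
  have hlim : Tendsto (fun n => ∫⁻ x, g x * ENNReal.ofReal |truncFracLap α u (e n) x|) atTop
      (𝓝 (∫⁻ x, g x * ENNReal.ofReal |w x|)) := by
    refine tendsto_lintegral_of_dominated_convergence (fun x => g x * T)
      (fun n => by have := hlap n; fun_prop) (fun n => ae_of_all _ fun x => ?_) ?_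
      (ae_of_all _ fun x => ?_)
    · exact mul_le_mul_right (hTle _ x (he_mem n).1) _
    · rw [lintegral_mul_const _ hgm]
      exact ENNReal.mul_ne_top hg_fin hT
    · refine ENNReal.Tendsto.const_mul (ENNReal.tendsto_ofReal (hw' x).abs) (Or.inr ?_)
      exact ENNReal.mul_ne_top (by unfold posRpow; split_ifs <;> simp) ENNReal.ofReal_ne_top
  exact ge_of_tendsto' hlim fun n => trunc_energy_inequality i hp hα.1 hr (he_mem n) hδ hs hm
    hu.continuous hc hsupp hur

lemma posRpow_rpow {a p : ℝ} (hp : 0 < p) (x : ℝ) : posRpow a x ^ p = posRpow (a * p) x := by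
  by_cases hx : 0 < x
  · rw [posRpow_of_pos hx, posRpow_of_pos hx, ENNReal.ofReal_rpow_of_nonneg (by positivity) hp.le,
      ← Real.rpow_mul hx.le]
  · rw [posRpow_of_nonpos (not_lt.1 hx), posRpow_of_nonpos (not_lt.1 hx),
      ENNReal.zero_rpow_of_pos hp]

lemma lintegral_posRpow_mul_le_Lp_mul_Lq {d : ℕ} (i : Fin d) {p b α : ℝ} (hp : 1 < p)
    {u w : EuclideanSpace ℝ (Fin d) → ℝ} (hu : Measurable u) (hw : Measurable w) :
    ∫⁻ x, posRpow b (x i) * ENNReal.ofReal (|u x| ^ (p - 1)) * ENNReal.ofReal |w x| ≤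
      (∫⁻ x, posRpow (b + (p - 1) * α) (x i) * ENNReal.ofReal (|w x| ^ p)) ^ (1 / p) *
      (∫⁻ x, posRpow (b - α) (x i) * ENNReal.ofReal (|u x| ^ p)) ^ (1 - 1 / p) := by
  have hp0 : 0 < p := by linarith
  have hp1 : 0 < p - 1 := by linarith
  have hpq : p.HolderConjugate (p / (p - 1)) := Real.HolderConjugate.conjExponent hp
  have h := ENNReal.lintegral_mul_le_Lp_mul_Lq volume hpq
    (f := fun x : EuclideanSpace ℝ (Fin d) =>
      posRpow ((b + (p - 1) * α) / p) (x i) * ENNReal.ofReal |w x|)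
    (g := fun x => posRpow ((b - α) / (p / (p - 1))) (x i) * ENNReal.ofReal (|u x| ^ (p - 1)))
    (by fun_prop) (by fun_prop)
  have e1 : 1 / (p / (p - 1)) = 1 - 1 / p := by field_simp
  rw [e1] at h
  convert h using 1
  · refine lintegral_congr fun x => ?_
    by_cases hx : 0 < x i
    · have e2 : b = (b + (p - 1) * α) / p + (b - α) / (p / (p - 1)) := by
        field_simp
        ring
      rw [e2, ← posRpow_mul_posRpow hx, ← e2, Pi.mul_apply]
      ring
    · simp [posRpow_of_nonpos (not_lt.1 hx)]
  · congr 2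
    · refine lintegral_congr fun x => ?_
      rw [ENNReal.mul_rpow_of_nonneg _ _ hp0.le, posRpow_rpow hp0, div_mul_cancel₀ _ hp0.ne',
        ENNReal.ofReal_rpow_of_nonneg (abs_nonneg _) hp0.le]
    · refine lintegral_congr fun x => ?_
      have hq : 0 < p / (p - 1) := by positivity
      rw [ENNReal.mul_rpow_of_nonneg _ _ hq.le, posRpow_rpow hq, div_mul_cancel₀ _ hq.ne',
        ENNReal.ofReal_rpow_of_nonneg (by positivity) hq.le, ← Real.rpow_mul (abs_nonneg _),
        mul_div_cancel₀ _ hp1.ne']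

lemma le_ofReal_rpow_mul_of_mul_le {c p : ℝ} (hc : 0 < c) (hp : 0 < p) {X Y : ℝ≥0∞} (hX : X ≠ ∞)
    (h : ENNReal.ofReal c * X ≤ Y ^ (1 / p) * X ^ (1 - 1 / p)) :
    X ≤ ENNReal.ofReal (c ^ (-p)) * Y := by
  rcases eq_or_ne X 0 with rfl | hX0
  · simp
  have h1 : X = X ^ (1 / p) * X ^ (1 - 1 / p) := by
    rw [← ENNReal.rpow_add _ _ hX0 hX]
    simp
  have h2 : ENNReal.ofReal c * X ^ (1 / p) ≤ Y ^ (1 / p) := by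
    rw [h1, ← mul_assoc, ← h1] at h
    exact (ENNReal.mul_le_mul_iff_left (ENNReal.rpow_pos (pos_iff_ne_zero.2 hX0) hX).ne'
      (ENNReal.rpow_ne_top_of_ne_zero hX0 hX)).1 h
  have h3 := ENNReal.rpow_le_rpow h2 hp.le
  rw [ENNReal.mul_rpow_of_nonneg _ _ hp.le, ← ENNReal.rpow_mul, ← ENNReal.rpow_mul,
    one_div_mul_cancel hp.ne', ENNReal.rpow_one, ENNReal.rpow_one,
    ENNReal.ofReal_rpow_of_pos hc] at h3
  calc X = ENNReal.ofReal (c ^ (-p)) * (ENNReal.ofReal (c ^ p) * X) := by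
        rw [← mul_assoc, ← ENNReal.ofReal_mul (by positivity), ← Real.rpow_add hc]
        simp
    _ ≤ _ := mul_le_mul_right h3 _

lemma setLIntegral_ofReal_rpow_mul {d : ℕ} (i : Fin d) (a : ℝ)
    {g : EuclideanSpace ℝ (Fin d) → ℝ} :
    ∫⁻ x in {x : EuclideanSpace ℝ (Fin d) | 0 < x i}, ENNReal.ofReal ((x i) ^ a * g x) =
      ∫⁻ x, posRpow a (x i) * ENNReal.ofReal (g x) := by
  have hH : MeasurableSet {x : EuclideanSpace ℝ (Fin d) | 0 < x i} :=
    measurableSet_lt measurable_const (by fun_prop)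
  rw [← lintegral_indicator hH]
  refine lintegral_congr fun x => ?_
  by_cases hx : 0 < x i
  · rw [Set.indicator_of_mem (by exact hx), posRpow_of_pos hx, ENNReal.ofReal_mul (by positivity)]
  · rw [Set.indicator_of_notMem (by exact hx), posRpow_of_nonpos (not_lt.1 hx), zero_mul]

lemma exists_truncKernel_posRpow_estimate {d : ℕ} [NeZero d] (i : Fin d) {α s m : ℝ}
    (hα : α ∈ Set.Ioo (0 : ℝ) 2) (hs : s ∈ Set.Ioo (α / 2 - 1) (α / 2))
    (hm : m ∈ Set.Ioo (α / 2 - 1) (α / 2)) :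
    ∃ c δ : ℝ, 0 < c ∧ 0 < δ ∧ ∀ a ∈ ({s, m} : Set ℝ), ∀ x ε : ℝ, 0 < x → ε ∈ Set.Ioo 0 (δ * x) →
      (∫⁻ z : EuclideanSpace ℝ (Fin d), posRpow a (x + z i) * truncKernel d α ε z) +
        ENNReal.ofReal c * posRpow (a - α) x ≤ posRpow a x * ∫⁻ z, truncKernel d α ε z := by
  obtain ⟨c₁, δ₁, hc₁, hδ₁, h₁⟩ := exists_kernel_posRpow_estimate i hα hs
  obtain ⟨c₂, δ₂, hc₂, hδ₂, h₂⟩ := exists_kernel_posRpow_estimate i hα hm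
  refine ⟨min c₁ c₂, min δ₁ δ₂, lt_min hc₁ hc₂, lt_min hδ₁ hδ₂, fun a ha x ε hx hε => ?_⟩
  rw [lintegral_mul_truncKernel, lintegral_truncKernel]
  rcases ha with rfl | rfl
  · refine le_trans ?_ (h₁ x ε hx ⟨hε.1, hε.2.trans_le ?_⟩) <;> gcongr <;> exact min_le_left _ _
  · refine le_trans ?_ (h₂ x ε hx ⟨hε.1, hε.2.trans_le ?_⟩) <;> gcongr <;> exact min_le_right _ _

/-- Weighted fractional Hardy–Rellich inequality on the half space: for `d ≥ 1`, `α ∈ (0,2)`,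
`p ∈ (1,∞)`, `θ ∈ (d-1, d-1+p)` there is `C = C(d,p,α,θ) > 0` such that for every
`u ∈ C_c^∞` with support a compact subset of `ℝ^d_+ = {x¹ > 0}`, and `w` given by the
principal value limits `w(x) = lim_{ε→0+} ∫_{|y|>ε} (u(x+y)-u(x))|y|^{-d-α} dy`,
`∫_{ℝ^d_+} (x¹)^{θ-d-αp/2} |u|^p dx ≤ C ∫_{ℝ^d_+} (x¹)^{θ-d+αp/2} |w|^p dx`. -/
theorem stmt_12 (d : ℕ) (hd : 1 ≤ d) (α p θ : ℝ) (hα : α ∈ Set.Ioo (0 : ℝ) 2)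
    (hp : 1 < p) (hθ : θ ∈ Set.Ioo ((d : ℝ) - 1) ((d : ℝ) - 1 + p)) :
    ∃ C : ℝ, 0 < C ∧ ∀ u w : EuclideanSpace ℝ (Fin d) → ℝ,
      ContDiff ℝ (⊤ : ℕ∞) u → HasCompactSupport u →
      tsupport u ⊆ {x : EuclideanSpace ℝ (Fin d) | 0 < x ⟨0, hd⟩} →
      (∀ x, Tendsto (fun ε : ℝ =>
          ∫ y in {y : EuclideanSpace ℝ (Fin d) | ε < ‖y‖},
            (u (x + y) - u x) * ‖y‖ ^ (-(d : ℝ) - α))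
        (𝓝[>] (0 : ℝ)) (𝓝 (w x))) →
      ∫⁻ x in {x : EuclideanSpace ℝ (Fin d) | 0 < x ⟨0, hd⟩},
          ENNReal.ofReal ((x ⟨0, hd⟩) ^ (θ - d - α * p / 2) * |u x| ^ p)
        ≤ ENNReal.ofReal C *
            ∫⁻ x in {x : EuclideanSpace ℝ (Fin d) | 0 < x ⟨0, hd⟩},
              ENNReal.ofReal ((x ⟨0, hd⟩) ^ (θ - d + α * p / 2) * |w x| ^ p) := by
  have : NeZero d := ⟨by lia⟩
  set i : Fin d := ⟨0, hd⟩
  have hp0 : 0 < p := by linarith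
  set t := (θ - d + 1) / p with ht
  have htp : t * p = θ - d + 1 := div_mul_cancel₀ _ hp0.ne'
  have ht0 : 0 < t := div_pos (by linarith [hθ.1]) hp0
  have ht1 : t < 1 := (div_lt_one hp0).2 (by linarith [hθ.2])
  obtain ⟨c, δ, hc, hδ, H⟩ := exists_truncKernel_posRpow_estimate (s := α / 2 - t)
    (m := α / 2 - 1 + t) i hα ⟨by linarith, by linarith⟩ ⟨by linarith, by linarith⟩
  refine ⟨c ^ (-p), by positivity, fun u w hu hcs hsupp hw => ?_⟩
  obtain ⟨hwm, hE⟩ := energy_inequality i hp hα hδ (H (α / 2 - t) (by simp))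
    (H (α / 2 - 1 + t) (by simp)) hu hcs hsupp hw
  have hb : α / 2 - 1 + t - (p - 1) * (α / 2 - t) = θ - d - α * p / 2 + α := by
    linear_combination htp
  have hE' := hE.trans (lintegral_posRpow_mul_le_Lp_mul_Lq i (α := α) hp
    hu.continuous.measurable hwm)
  have hb' : θ - d - α * p / 2 + α + (p - 1) * α = θ - d + α * p / 2 := by ring
  rw [hb, hb', add_sub_cancel_right] at hE'
  rw [setLIntegral_ofReal_rpow_mul, setLIntegral_ofReal_rpow_mul]
  refine le_ofReal_rpow_mul_of_mul_le hc hp0 ?_ hE'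
  refine lintegral_posRpow_mul_ne_top i _ hcs.isCompact hsupp
    (hu.continuous.abs.rpow_const fun x => Or.inr hp0.le) fun x hx => ?_
  simp [image_eq_zero_of_notMem_tsupport hx, Real.zero_rpow hp0.ne']
end
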